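/- Under the Viscous Setup, with additionally b > 2 and ρ̄ ≤ 1, let ω ∈ C_c^∞(ℝ) with ω(r) = 1 for r ∈ [0,1] and ω(r) = 0 for r ≥ 2. Then for any Δ ∈ (0,½) there exists a constant M > 0, depending only on n, γ, T, E₀ and ω but independent of Δ and ε, such that ε∫₀^T∫_a^b (ρ_r²/ρ) 𝟙_{{ρ<Δ}} ω(r)² r^{n−1} dr dt ≤ M(|log Δ| + √Δ/√ε + √Δ/a + √ε|log Δ|Δ^{(2−γ)/2}). -/

import Mathlib

open MeasureTheory Real Set

noncomputable section

/-- The internal energy function `h_δ(ρ) = κρ^γ/(γ-1) + δρ²`. -/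
def hDelta (γ κ δ ρ : ℝ) : ℝ := κ * ρ ^ γ / (γ - 1) + δ * ρ ^ (2 : ℕ)

/-- Its derivative `h_δ'(ρ̄) = κγρ̄^{γ-1}/(γ-1) + 2δρ̄`. -/
def hDelta' (γ κ δ ρbar : ℝ) : ℝ := κ * γ * ρbar ^ (γ - 1) / (γ - 1) + 2 * δ * ρbar

/-- Its second derivative `h_δ''(ρ) = κγρ^{γ-2} + 2δ`. -/
def hDelta'' (γ κ δ ρ : ℝ) : ℝ := κ * γ * ρ ^ (γ - 2) + 2 * δ

/-- The relative internal energy `h̄_δ(ρ,ρ̄) = h_δ(ρ) − h_δ(ρ̄) − h_δ'(ρ̄)(ρ−ρ̄)`. -/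
def hBarDelta (γ κ δ ρ ρbar : ℝ) : ℝ :=
  hDelta γ κ δ ρ - hDelta γ κ δ ρbar - hDelta' γ κ δ ρbar * (ρ - ρbar)

/-- The Viscous Setup: `n ≥ 2`, `γ > 1`, `κ = (γ−1)²/(4γ)`, `p_δ(ρ) = κρ^γ + δρ²`;
`T > 0`, `ε > 0`, `δ > 0`, `0 < a < 1 < b`, `ρ̄ > 0`; smooth functions `(ρ, m)` on
`[0,T]×[a,b]` with `ρ ≥ c_ε > 0` and `u = m/ρ`, satisfying the viscous system
`(r^{n−1}ρ)_t + (r^{n−1}m)_r = ε(r^{n−1}ρ_r)_r`,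
`(r^{n−1}m)_t + (r^{n−1}m²/ρ)_r + r^{n−1}(p_δ(ρ))_r
  = ε(r^{n−1}m)_{rr} − ε((n−1)/r)(r^{n−1}m)_r` on `(0,T)×(a,b)`,
the boundary conditions `ρ_r(t,a) = 0`, `m(t,a) = 0`, `ρ(t,b) = ρ̄`, `m(t,b) = 0`,
and the energy estimate with total energy bound `E₀`. -/
structure ViscousSetup (n : ℕ) (γ T E₀ : ℝ) where
  ε : ℝ
  δ : ℝ
  a : ℝ
  b : ℝ
  ρbar : ℝ
  cε : ℝ
  ρ : ℝ → ℝ → ℝ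
  m : ℝ → ℝ → ℝ
  hn : 2 ≤ n
  hγ : 1 < γ
  hT : 0 < T
  hε : 0 < ε
  hδ : 0 < δ
  ha0 : 0 < a
  ha1 : a < 1
  hb : 1 < b
  hρbar : 0 < ρbar
  hcε : 0 < cε
  smooth_ρ : ContDiff ℝ (⊤ : ℕ∞) (Function.uncurry ρ)
  smooth_m : ContDiff ℝ (⊤ : ℕ∞) (Function.uncurry m)
  pos : ∀ t ∈ Set.Icc 0 T, ∀ r ∈ Set.Icc a b, cε ≤ ρ t r
  continuity_eq : ∀ t ∈ Set.Ioo 0 T, ∀ r ∈ Set.Ioo a b,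
    r ^ (n - 1) * deriv (fun s => ρ s r) t + deriv (fun y => y ^ (n - 1) * m t y) r
      = ε * deriv (fun y => y ^ (n - 1) * deriv (fun z => ρ t z) y) r
  momentum_eq : ∀ t ∈ Set.Ioo 0 T, ∀ r ∈ Set.Ioo a b,
    r ^ (n - 1) * deriv (fun s => m s r) t
      + deriv (fun y => y ^ (n - 1) * (m t y) ^ (2:ℕ) / ρ t y) r
      + r ^ (n - 1) * deriv (fun y =>
          (γ - 1) ^ (2:ℕ) / (4 * γ) * (ρ t y) ^ γ + δ * (ρ t y) ^ (2:ℕ)) r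
      = ε * deriv (fun y => deriv (fun z => z ^ (n - 1) * m t z) y) r
        - ε * ((n - 1 : ℝ) / r) * deriv (fun y => y ^ (n - 1) * m t y) r
  bc_ρr : ∀ t ∈ Set.Icc 0 T, deriv (fun y => ρ t y) a = 0
  bc_ma : ∀ t ∈ Set.Icc 0 T, m t a = 0
  bc_ρb : ∀ t ∈ Set.Icc 0 T, ρ t b = ρbar
  bc_mb : ∀ t ∈ Set.Icc 0 T, m t b = 0
  energy : ∀ t ∈ Set.Icc 0 T,
    (∫ r in Set.Ioo a b,
      ((1/2) * ρ t r * (m t r / ρ t r) ^ (2:ℕ)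
        + hBarDelta γ ((γ - 1) ^ (2:ℕ) / (4 * γ)) δ (ρ t r) ρbar) * r ^ (n - 1))
    + ε * ∫ s in Set.Ioo 0 T, ∫ r in Set.Ioo a b,
        (hDelta'' γ ((γ - 1) ^ (2:ℕ) / (4 * γ)) δ (ρ s r) * (deriv (fun y => ρ s y) r) ^ (2:ℕ)
          + ρ s r * (deriv (fun y => m s y / ρ s y) r) ^ (2:ℕ)
          + (n - 1 : ℝ) * ρ s r * (m s r / ρ s r) ^ (2:ℕ) / r ^ (2:ℕ)) * r ^ (n - 1)
      ≤ E₀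

/-- Slice version of Green's formula on a rectangle. -/
theorem setIntegral_sub_eq_of_hasDerivAt_slices {T a b : ℝ} (hT : 0 ≤ T) (hab : a ≤ b)
    {A A' J J' : ℝ → ℝ → ℝ}
    (hA : ContinuousOn (fun p : ℝ × ℝ => A p.1 p.2) (Icc 0 T ×ˢ Icc a b))
    (hA' : ContinuousOn (fun p : ℝ × ℝ => A' p.1 p.2) (Icc 0 T ×ˢ Icc a b))
    (hJ : ContinuousOn (fun p : ℝ × ℝ => J p.1 p.2) (Icc 0 T ×ˢ Icc a b))
    (hJ' : ContinuousOn (fun p : ℝ × ℝ => J' p.1 p.2) (Icc 0 T ×ˢ Icc a b))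
    (dA : ∀ t ∈ Ioo 0 T, ∀ r ∈ Ioo a b, HasDerivAt (fun s => A s r) (A' t r) t)
    (dJ : ∀ t ∈ Ioo 0 T, ∀ r ∈ Ioo a b, HasDerivAt (fun y => J t y) (J' t r) r) :
    ∫ p in Icc 0 T ×ˢ Icc a b, (A' p.1 p.2 - J' p.1 p.2)
      = (∫ r in Icc a b, (A T r - A 0 r)) - ∫ t in Icc 0 T, (J t b - J t a) := by
  have hc : IsCompact (Icc 0 T ×ˢ Icc a b) := isCompact_Icc.prod isCompact_Icc
  have iA' := hA'.integrableOn_compact (μ := volume) hc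
  have iJ' := hJ'.integrableOn_compact (μ := volume) hc
  have sl1 : ∀ (f : ℝ → ℝ → ℝ),
      ContinuousOn (fun p : ℝ × ℝ => f p.1 p.2) (Icc 0 T ×ˢ Icc a b) →
      ∀ r ∈ Icc a b, ContinuousOn (fun s => f s r) (Icc 0 T) := fun f hf r hr =>
    hf.comp (f := fun s => (s, r)) (by fun_prop) (fun s hs => ⟨hs, hr⟩)
  have sl2 : ∀ (f : ℝ → ℝ → ℝ),
      ContinuousOn (fun p : ℝ × ℝ => f p.1 p.2) (Icc 0 T ×ˢ Icc a b) →
      ∀ t ∈ Icc 0 T, ContinuousOn (fun y => f t y) (Icc a b) := fun f hf t ht =>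
    hf.comp (f := fun y => (t, y)) (by fun_prop) (fun s hs => ⟨ht, hs⟩)
  rw [integral_sub iA' iJ']
  congr 1
  · have h1 : IntegrableOn (fun p : ℝ × ℝ => A' p.2 p.1) (Icc a b ×ˢ Icc 0 T)
        (volume.prod volume) := by
      have : ContinuousOn (fun p : ℝ × ℝ => A' p.2 p.1) (Icc a b ×ˢ Icc 0 T) :=
        hA'.comp (f := fun p : ℝ × ℝ => (p.2, p.1)) (by fun_prop) (fun p hp => ⟨hp.2, hp.1⟩)
      exact this.integrableOn_compact (isCompact_Icc.prod isCompact_Icc)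
    have h2 : ∫ p in Icc 0 T ×ˢ Icc a b, A' p.1 p.2
        = ∫ p in Icc a b ×ˢ Icc 0 T, A' p.2 p.1 := by
      rw [Measure.volume_eq_prod]
      exact (setIntegral_prod_swap (Icc 0 T) (Icc a b) (fun p : ℝ × ℝ => A' p.1 p.2)).symm
    rw [h2, Measure.volume_eq_prod, setIntegral_prod _ h1]
    rw [integral_Icc_eq_integral_Ioo, integral_Icc_eq_integral_Ioo]
    refine setIntegral_congr_fun measurableSet_Ioo (fun r hr => ?_)
    have hr' := Ioo_subset_Icc_self hr
    have := intervalIntegral.integral_eq_sub_of_hasDerivAt_of_le hT (sl1 A hA r hr')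
      (fun t ht => dA t ht r hr) ((sl1 A' hA' r hr').intervalIntegrable_of_Icc hT)
    rw [intervalIntegral.integral_of_le hT, ← integral_Icc_eq_integral_Ioc] at this
    exact this
  · rw [Measure.volume_eq_prod] at iJ' ⊢
    rw [setIntegral_prod _ iJ']
    rw [integral_Icc_eq_integral_Ioo, integral_Icc_eq_integral_Ioo]
    refine setIntegral_congr_fun measurableSet_Ioo (fun t ht => ?_)
    have ht' := Ioo_subset_Icc_self ht
    have := intervalIntegral.integral_eq_sub_of_hasDerivAt_of_le hab (sl2 J hJ t ht')
      (fun r hr => dJ t ht r hr) ((sl2 J' hJ' t ht').intervalIntegrable_of_Icc hab)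
    rw [intervalIntegral.integral_of_le hab, ← integral_Icc_eq_integral_Ioc] at this
    exact this

theorem ContinuousOn.slice_right {s u : Set ℝ} {f : ℝ → ℝ → ℝ}
    (hf : ContinuousOn (fun p : ℝ × ℝ => f p.1 p.2) (s ×ˢ u)) {t : ℝ} (ht : t ∈ s) :
    ContinuousOn (fun y => f t y) u :=
  hf.comp (f := fun y => (t, y)) (by fun_prop) (fun _ hs => ⟨ht, hs⟩)

theorem setIntegral_rect_eq {T a b : ℝ} {f : ℝ → ℝ → ℝ}
    (hf : ContinuousOn (fun p : ℝ × ℝ => f p.1 p.2) (Icc 0 T ×ˢ Icc a b)) :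
    ∫ p in Icc 0 T ×ˢ Icc a b, f p.1 p.2 = ∫ t in Icc 0 T, ∫ r in Icc a b, f t r := by
  have i := hf.integrableOn_compact (μ := volume) (isCompact_Icc.prod isCompact_Icc)
  rw [Measure.volume_eq_prod] at i ⊢
  rw [setIntegral_prod _ i]

/-- A uniform bound on the slices gives a bound on the integral over the rectangle. -/
theorem setIntegral_rect_le {T a b C : ℝ} (hT : 0 ≤ T) {f : ℝ → ℝ → ℝ}
    (hf : ContinuousOn (fun p : ℝ × ℝ => f p.1 p.2) (Icc 0 T ×ˢ Icc a b))
    (h : ∀ t ∈ Icc 0 T, ∫ r in Icc a b, f t r ≤ C) :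
    ∫ p in Icc 0 T ×ˢ Icc a b, f p.1 p.2 ≤ T * C := by
  have i := hf.integrableOn_compact (μ := volume) (isCompact_Icc.prod isCompact_Icc)
  rw [setIntegral_rect_eq hf]
  rw [Measure.volume_eq_prod, IntegrableOn, ← Measure.prod_restrict] at i
  have i2 := i.integral_prod_left
  calc _ ≤ ∫ t in Icc 0 T, C := setIntegral_mono_on i2 (by simp) measurableSet_Icc h
    _ = T * C := by simp [hT]

theorem setIntegral_rect_le_integral {T a b : ℝ} {f : ℝ → ℝ → ℝ} {g : ℝ → ℝ}
    (hf : ContinuousOn (fun p : ℝ × ℝ => f p.1 p.2) (Icc 0 T ×ˢ Icc a b))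
    (hg : IntegrableOn g (Icc 0 T))
    (h : ∀ t ∈ Icc 0 T, ∫ r in Icc a b, f t r ≤ g t) :
    ∫ p in Icc 0 T ×ˢ Icc a b, f p.1 p.2 ≤ ∫ t in Icc 0 T, g t := by
  have i := hf.integrableOn_compact (μ := volume) (isCompact_Icc.prod isCompact_Icc)
  rw [setIntegral_rect_eq hf]
  rw [Measure.volume_eq_prod, IntegrableOn, ← Measure.prod_restrict] at i
  exact setIntegral_mono_on i.integral_prod_left hg measurableSet_Icc h

theorem integrableOn_slice_integral {T a b : ℝ} {f : ℝ → ℝ → ℝ}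
    (hf : ContinuousOn (fun p : ℝ × ℝ => f p.1 p.2) (Icc 0 T ×ˢ Icc a b)) :
    IntegrableOn (fun t => ∫ r in Icc a b, f t r) (Icc 0 T) := by
  have i := hf.integrableOn_compact (μ := volume) (isCompact_Icc.prod isCompact_Icc)
  rw [Measure.volume_eq_prod, IntegrableOn, ← Measure.prod_restrict] at i
  exact i.integral_prod_left

theorem setIntegral_nonneg_rect {T a b : ℝ} {f : ℝ × ℝ → ℝ}
    (h : ∀ p ∈ Icc 0 T ×ˢ Icc a b, 0 ≤ f p) :
    0 ≤ ∫ p in Icc 0 T ×ˢ Icc a b, f p :=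
  setIntegral_nonneg (measurableSet_Icc.prod measurableSet_Icc) h

/-- Cauchy–Schwarz for continuous functions on an interval. -/
theorem sq_setIntegral_mul_le {a b : ℝ} {f g : ℝ → ℝ}
    (hf : ContinuousOn f (Icc a b)) (hg : ContinuousOn g (Icc a b)) :
    (∫ r in Icc a b, f r * g r) ^ 2 ≤ (∫ r in Icc a b, f r ^ 2) * ∫ r in Icc a b, g r ^ 2 := by
  have i1 : IntegrableOn (fun r => f r ^ 2) (Icc a b) := (hf.pow 2).integrableOn_Icc
  have i2 : IntegrableOn (fun r => g r ^ 2) (Icc a b) := (hg.pow 2).integrableOn_Icc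
  have i3 : IntegrableOn (fun r => f r * g r) (Icc a b) := (hf.mul hg).integrableOn_Icc
  have key : ∀ x : ℝ, 0 ≤ (∫ r in Icc a b, f r ^ 2) * (x * x)
      + (-2 * ∫ r in Icc a b, f r * g r) * x + ∫ r in Icc a b, g r ^ 2 := by
    intro x
    have : ∫ r in Icc a b, (f r * x - g r) ^ 2 = (∫ r in Icc a b, f r ^ 2) * (x * x)
      + (-2 * ∫ r in Icc a b, f r * g r) * x + ∫ r in Icc a b, g r ^ 2 := by
      have e : (fun r => (f r * x - g r) ^ 2)
          = fun r => (x * x) * f r ^ 2 + (-2 * x) * (f r * g r) + g r ^ 2 := by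
        ext r; ring
      rw [e, integral_add (by exact ((i1.const_mul _).add (i3.const_mul _))) i2,
        integral_add (i1.const_mul _) (i3.const_mul _), integral_const_mul, integral_const_mul]
      ring
    rw [← this]
    exact setIntegral_nonneg measurableSet_Icc (fun r _ => sq_nonneg _)
  have := discrim_le_zero key
  unfold discrim at this
  nlinarith

theorem continuous_deriv_right_of_contDiff {f : ℝ → ℝ → ℝ}
    (hf : ContDiff ℝ (⊤ : ℕ∞) (Function.uncurry f)) :
    Continuous (fun p : ℝ × ℝ => deriv (fun y => f p.1 y) p.2) := by
  have h : (fun p : ℝ × ℝ => deriv (fun y => f p.1 y) p.2)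
      = fun p => fderiv ℝ (Function.uncurry f) p (0, 1) := by
    ext ⟨t, r⟩
    have h1 := (hf.differentiable (by simp) (t, r)).hasFDerivAt
    have h2 : HasDerivAt (fun y : ℝ => (t, y)) ((0 : ℝ), (1 : ℝ)) r :=
      (hasDerivAt_const r t).prodMk (hasDerivAt_id r)
    exact (h1.comp_hasDerivAt r h2).deriv
  rw [h]
  exact (hf.continuous_fderiv (by simp)).clm_apply continuous_const

theorem continuous_deriv_left_of_contDiff {f : ℝ → ℝ → ℝ}
    (hf : ContDiff ℝ (⊤ : ℕ∞) (Function.uncurry f)) :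
    Continuous (fun p : ℝ × ℝ => deriv (fun s => f s p.2) p.1) := by
  have h : (fun p : ℝ × ℝ => deriv (fun s => f s p.2) p.1)
      = fun p => fderiv ℝ (Function.uncurry f) p (1, 0) := by
    ext ⟨t, r⟩
    have h1 := (hf.differentiable (by simp) (t, r)).hasFDerivAt
    have h2 : HasDerivAt (fun y : ℝ => (y, r)) ((1 : ℝ), (0 : ℝ)) t :=
      (hasDerivAt_id t).prodMk (hasDerivAt_const t r)
    exact (h1.comp_hasDerivAt t h2).deriv
  rw [h]
  exact (hf.continuous_fderiv (by simp)).clm_apply continuous_const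

theorem contDiff_slice_right {f : ℝ → ℝ → ℝ}
    (hf : ContDiff ℝ (⊤ : ℕ∞) (Function.uncurry f)) (t : ℝ) :
    ContDiff ℝ (⊤ : ℕ∞) (fun y => f t y) :=
  hf.comp (contDiff_const.prodMk contDiff_id)

theorem contDiff_slice_left {f : ℝ → ℝ → ℝ}
    (hf : ContDiff ℝ (⊤ : ℕ∞) (Function.uncurry f)) (r : ℝ) :
    ContDiff ℝ (⊤ : ℕ∞) (fun s => f s r) :=
  hf.comp (contDiff_id.prodMk contDiff_const)

namespace ViscousSetup

variable {n : ℕ} {γ T E₀ : ℝ} (S : ViscousSetup n γ T E₀)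

/-- The radial derivative of the density. -/
def ρr (t r : ℝ) : ℝ := deriv (fun y => S.ρ t y) r

/-- The time derivative of the density. -/
def ρt (t r : ℝ) : ℝ := deriv (fun s => S.ρ s r) t

/-- The radial derivative of the momentum. -/
def mr (t r : ℝ) : ℝ := deriv (fun y => S.m t y) r

/-- The radial derivative of the velocity. -/
def ur (t r : ℝ) : ℝ := (S.mr t r * S.ρ t r - S.m t r * S.ρr t r) / S.ρ t r ^ 2

/-- The viscous mass flux `r^{n-1}(ερ_r - m)`. -/
def flux (t r : ℝ) : ℝ := r ^ (n - 1) * (S.ε * S.ρr t r - S.m t r)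

/-- The space-time rectangle `[0,T] × [a,b]`. -/
def dom : Set (ℝ × ℝ) := Icc 0 T ×ˢ Icc S.a S.b

@[fun_prop]
theorem continuous_ρ : Continuous (fun p : ℝ × ℝ => S.ρ p.1 p.2) := S.smooth_ρ.continuous

@[fun_prop]
theorem continuous_m : Continuous (fun p : ℝ × ℝ => S.m p.1 p.2) := S.smooth_m.continuous

@[fun_prop]
theorem continuous_ρr : Continuous (fun p : ℝ × ℝ => S.ρr p.1 p.2) :=
  continuous_deriv_right_of_contDiff S.smooth_ρ

@[fun_prop]
theorem continuous_ρt : Continuous (fun p : ℝ × ℝ => S.ρt p.1 p.2) :=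
  continuous_deriv_left_of_contDiff S.smooth_ρ

@[fun_prop]
theorem continuous_mr : Continuous (fun p : ℝ × ℝ => S.mr p.1 p.2) :=
  continuous_deriv_right_of_contDiff S.smooth_m

@[fun_prop]
theorem continuous_flux : Continuous (fun p : ℝ × ℝ => S.flux p.1 p.2) := by
  unfold flux; fun_prop

theorem hasDerivAt_ρ_right (t r : ℝ) : HasDerivAt (fun y => S.ρ t y) (S.ρr t r) r :=
  ((contDiff_slice_right S.smooth_ρ t).differentiable (by simp) r).hasDerivAt

theorem hasDerivAt_ρ_left (t r : ℝ) : HasDerivAt (fun s => S.ρ s r) (S.ρt t r) t :=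
  ((contDiff_slice_left S.smooth_ρ r).differentiable (by simp) t).hasDerivAt

theorem hasDerivAt_m_right (t r : ℝ) : HasDerivAt (fun y => S.m t y) (S.mr t r) r :=
  ((contDiff_slice_right S.smooth_m t).differentiable (by simp) r).hasDerivAt

theorem a_le_b : S.a ≤ S.b := by linarith [S.ha1, S.hb]

theorem ρ_pos {t r : ℝ} (ht : t ∈ Icc 0 T) (hr : r ∈ Icc S.a S.b) : 0 < S.ρ t r :=
  S.hcε.trans_le (S.pos t ht r hr)

theorem r_pos {r : ℝ} (hr : r ∈ Icc S.a S.b) : 0 < r := S.ha0.trans_le hr.1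

theorem hasDerivAt_u_right {t r : ℝ} (ht : t ∈ Icc 0 T) (hr : r ∈ Icc S.a S.b) :
    HasDerivAt (fun y => S.m t y / S.ρ t y) (S.ur t r) r :=
  (S.hasDerivAt_m_right t r).div (S.hasDerivAt_ρ_right t r) (S.ρ_pos ht hr).ne'

theorem hasDerivAt_flux {t r : ℝ} (ht : t ∈ Ioo 0 T) (hr : r ∈ Ioo S.a S.b) :
    HasDerivAt (fun y => S.flux t y) (r ^ (n - 1) * S.ρt t r) r := by
  have h1 : ContDiff ℝ (⊤ : ℕ∞) (fun y => S.ρr t y) := by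
    have := contDiff_slice_right S.smooth_ρ t
    exact (contDiff_infty_iff_deriv.1 this).2
  have d1 : DifferentiableAt ℝ (fun y => y ^ (n - 1) * S.ρr t y) r :=
    (by fun_prop : DifferentiableAt ℝ (fun y : ℝ => y ^ (n - 1)) r).mul
      (h1.differentiable (by simp) r)
  have d2 : DifferentiableAt ℝ (fun y => y ^ (n - 1) * S.m t y) r :=
    (by fun_prop : DifferentiableAt ℝ (fun y : ℝ => y ^ (n - 1)) r).mul
      (S.hasDerivAt_m_right t r).differentiableAt
  have h := S.continuity_eq t ht r hr
  have h3 := (d1.hasDerivAt.const_mul S.ε).sub d2.hasDerivAt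
  have e : r ^ (n - 1) * S.ρt t r = S.ε * deriv (fun y => y ^ (n - 1) * S.ρr t y) r
      - deriv (fun y => y ^ (n - 1) * S.m t y) r := by
    unfold ρt ρr; linarith
  rw [e]
  refine h3.congr_of_eventuallyEq (Filter.Eventually.of_forall fun y => ?_)
  simp only [flux, Pi.sub_apply]; ring

theorem flux_a {t : ℝ} (ht : t ∈ Icc 0 T) : S.flux t S.a = 0 := by
  simp [flux, ρr, S.bc_ρr t ht, S.bc_ma t ht]

theorem isCompact_dom : IsCompact S.dom := isCompact_Icc.prod isCompact_Icc

theorem measurableSet_dom : MeasurableSet S.dom := measurableSet_Icc.prod measurableSet_Icc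

/-- Positivity of the coordinates and of the density on the rectangle. -/
theorem ρ_pos_dom {p : ℝ × ℝ} (hp : p ∈ S.dom) : 0 < S.ρ p.1 p.2 := S.ρ_pos hp.1 hp.2

theorem r_pos_dom {p : ℝ × ℝ} (hp : p ∈ S.dom) : 0 < p.2 := S.r_pos hp.2

theorem ρ_ne_dom : ∀ p ∈ S.dom, S.ρ p.1 p.2 ≠ 0 := fun _ hp => (S.ρ_pos_dom hp).ne'

theorem r_ne_dom : ∀ p ∈ S.dom, p.2 ≠ 0 := fun _ hp => (S.r_pos_dom hp).ne'

theorem continuousOn_ur : ContinuousOn (fun p : ℝ × ℝ => S.ur p.1 p.2) S.dom := by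
  unfold ur
  exact ContinuousOn.div (by fun_prop) (by fun_prop) (fun p hp => pow_ne_zero 2 (S.ρ_ne_dom p hp))

end ViscousSetup
theorem hasDerivAt_pow_div {k : ℕ} {r : ℝ} (hr : r ≠ 0) :
    HasDerivAt (fun y : ℝ => y ^ k) (k * r ^ k / r) r := by
  have e : (k : ℝ) * r ^ k / r = k * r ^ (k - 1) := by
    cases k with
    | zero => simp
    | succ k => rw [pow_succ, Nat.add_sub_cancel]; field_simp
  rw [e]
  exact hasDerivAt_pow k r

theorem hBarDelta_eq {γ κ δ x y : ℝ} :
    hBarDelta γ κ δ x y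
      = κ / (γ - 1) * (x ^ γ - y ^ γ - γ * y ^ (γ - 1) * (x - y)) + δ * (x - y) ^ 2 := by
  unfold hBarDelta hDelta hDelta'
  ring

theorem rpow_tangent_le {γ x y : ℝ} (hγ : 1 < γ) (hx : 0 < x) (hy : 0 < y) :
    y ^ γ + γ * y ^ (γ - 1) * (x - y) ≤ x ^ γ := by
  have h := one_add_mul_self_le_rpow_one_add (s := x / y - 1)
    (by have := div_pos hx hy; linarith) hγ.le
  rw [add_sub_cancel, div_rpow hx.le hy.le, le_div_iff₀ (by positivity)] at h
  have e : y ^ γ = y ^ (γ - 1) * y := by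
    rw [← rpow_add_one hy.ne']; simp
  calc _ = (1 + γ * (x / y - 1)) * y ^ γ := by rw [e]; field_simp
    _ ≤ _ := h

theorem hBarDelta_nonneg {γ δ x y : ℝ} (hγ : 1 < γ) (hδ : 0 < δ) (hx : 0 < x) (hy : 0 < y) :
    0 ≤ hBarDelta γ ((γ - 1) ^ (2:ℕ) / (4 * γ)) δ x y := by
  rw [hBarDelta_eq]
  have h1 := rpow_tangent_le hγ hx hy
  have h2 : 0 < γ - 1 := by linarith
  have h3 : 0 ≤ (γ - 1) ^ (2:ℕ) / (4 * γ) / (γ - 1) := by positivity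
  have := mul_nonneg h3 (by linarith : 0 ≤ x ^ γ - y ^ γ - γ * y ^ (γ - 1) * (x - y))
  positivity

/-- The relative internal energy controls the pressure. -/
theorem exists_rpow_le_hBarDelta {γ : ℝ} (hγ : 1 < γ) :
    ∃ C : ℝ, 1 ≤ C ∧ ∀ δ x y : ℝ, 0 < δ → 0 < x → 0 < y → y ≤ 1 →
      x ^ γ ≤ C * (1 + hBarDelta γ ((γ - 1) ^ (2:ℕ) / (4 * γ)) δ x y) := by
  have h2 : 0 < γ - 1 := by linarith
  set L : ℝ := (2 * γ) ^ (1 / (γ - 1)) with hL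
  have hLpos : 0 < L := by positivity
  set c : ℝ := (γ - 1) ^ (2:ℕ) / (4 * γ) / (γ - 1) with hc
  have hcpos : 0 < c := by positivity
  refine ⟨2 / c + 2 * γ * L + 1, by have : 0 < 2 / c + 2 * γ * L := by positivity
                                    linarith, ?_⟩
  intro δ x y hδ hx hy hy1
  have hnn := hBarDelta_nonneg hγ hδ hx hy
  rw [hBarDelta_eq, ← hc] at hnn ⊢
  set H := c * (x ^ γ - y ^ γ - γ * y ^ (γ - 1) * (x - y)) + δ * (x - y) ^ 2 with hH
  have hlin : γ * x ≤ x ^ γ / 2 + γ * L := by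
    rcases le_total x L with h | h
    · have : 0 < x ^ γ := by positivity
      nlinarith
    · have h3 : 2 * γ ≤ x ^ (γ - 1) := by
        have : L ^ (γ - 1) = 2 * γ := by
          rw [hL, ← rpow_mul (by positivity)]
          rw [one_div_mul_cancel h2.ne', rpow_one]
        rw [← this]
        exact rpow_le_rpow hLpos.le h h2.le
      have e : x ^ γ = x ^ (γ - 1) * x := by
        rw [← rpow_add_one hx.ne']; simp
      have : 0 < γ * L := by positivity
      rw [e]; nlinarith
  have hy2 : y ^ (γ - 1) ≤ 1 := rpow_le_one hy.le hy1 h2.le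
  have e : y ^ γ = y ^ (γ - 1) * y := by
    rw [← rpow_add_one hy.ne']; simp
  have hyp : 0 < y ^ (γ - 1) := by positivity
  have h5 : x ^ γ / 2 - γ * L ≤ x ^ γ - y ^ γ - γ * y ^ (γ - 1) * (x - y) := by
    have : y ^ (γ - 1) * (γ * x) ≤ γ * x := by
      have : 0 < γ * x := by positivity
      nlinarith
    have : 0 ≤ (γ - 1) * (y ^ (γ - 1) * y) := by positivity
    rw [e]; nlinarith
  have h6 : c * (x ^ γ / 2 - γ * L) ≤ H := by
    have := mul_le_mul_of_nonneg_left h5 hcpos.le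
    have : 0 ≤ δ * (x - y) ^ 2 := by positivity
    rw [hH]; linarith
  have h7 : x ^ γ ≤ 2 / c * H + 2 * γ * L := by
    have : 2 / c * (c * (x ^ γ / 2 - γ * L)) = x ^ γ - 2 * γ * L := by field_simp
    have := mul_le_mul_of_nonneg_left h6 (by positivity : 0 ≤ 2 / c)
    linarith
  have : 0 ≤ (2 * γ * L + 1) * H + 2 / c + 1 := by positivity
  linarith

namespace ViscousSetup

variable {n : ℕ} {γ T E₀ : ℝ} (S : ViscousSetup n γ T E₀)

/-- The relative internal energy density. -/
def hbar (t r : ℝ) : ℝ := hBarDelta γ ((γ - 1) ^ (2:ℕ) / (4 * γ)) S.δ (S.ρ t r) S.ρbar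

/-- The weighted energy density. -/
def energyDensity (t r : ℝ) : ℝ := (S.m t r ^ 2 / S.ρ t r + S.hbar t r) * r ^ (n - 1)

/-- The weighted dissipation density. -/
def dissDensity (t r : ℝ) : ℝ :=
  (S.ρ t r ^ (γ - 2) * S.ρr t r ^ 2 + S.ρ t r * S.ur t r ^ 2
    + S.m t r ^ 2 / S.ρ t r / r ^ 2) * r ^ (n - 1)

theorem hbar_nonneg {t r : ℝ} (ht : t ∈ Icc 0 T) (hr : r ∈ Icc S.a S.b) : 0 ≤ S.hbar t r :=
  hBarDelta_nonneg S.hγ S.hδ (S.ρ_pos ht hr) S.hρbar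

theorem energyDensity_nonneg {t r : ℝ} (ht : t ∈ Icc 0 T) (hr : r ∈ Icc S.a S.b) :
    0 ≤ S.energyDensity t r := by
  have := S.hbar_nonneg ht hr
  have := S.ρ_pos ht hr
  have := S.r_pos hr
  unfold energyDensity; positivity

theorem dissDensity_nonneg {t r : ℝ} (ht : t ∈ Icc 0 T) (hr : r ∈ Icc S.a S.b) :
    0 ≤ S.dissDensity t r := by
  have := S.ρ_pos ht hr
  have := S.r_pos hr
  unfold dissDensity; positivity

theorem continuousOn_hbar : ContinuousOn (fun p : ℝ × ℝ => S.hbar p.1 p.2) S.dom := by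
  unfold hbar hBarDelta hDelta
  have : ContinuousOn (fun p : ℝ × ℝ => S.ρ p.1 p.2 ^ γ) S.dom :=
    ContinuousOn.rpow_const (by fun_prop) (fun p hp => Or.inl (S.ρ_ne_dom p hp))
  fun_prop

theorem continuousOn_m_sq_div : ContinuousOn (fun p : ℝ × ℝ => S.m p.1 p.2 ^ 2 / S.ρ p.1 p.2) S.dom :=
  ContinuousOn.div (by fun_prop) (by fun_prop) S.ρ_ne_dom

theorem continuousOn_energyDensity :
    ContinuousOn (fun p : ℝ × ℝ => S.energyDensity p.1 p.2) S.dom := by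
  unfold energyDensity
  have := S.continuousOn_m_sq_div
  have := S.continuousOn_hbar
  fun_prop

theorem continuousOn_dissDensity :
    ContinuousOn (fun p : ℝ × ℝ => S.dissDensity p.1 p.2) S.dom := by
  unfold dissDensity
  have h1 := S.continuousOn_m_sq_div
  have h2 := S.continuousOn_ur
  have h3 : ContinuousOn (fun p : ℝ × ℝ => S.ρ p.1 p.2 ^ (γ - 2)) S.dom :=
    ContinuousOn.rpow_const (by fun_prop) (fun p hp => Or.inl (S.ρ_ne_dom p hp))
  have h4 : ContinuousOn (fun p : ℝ × ℝ => S.m p.1 p.2 ^ 2 / S.ρ p.1 p.2 / p.2 ^ 2) S.dom :=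
    h1.div (by fun_prop) (fun p hp => pow_ne_zero 2 (S.r_ne_dom p hp))
  fun_prop

theorem energy_Icc {t : ℝ} (ht : t ∈ Icc 0 T) :
    (∫ r in Icc S.a S.b, ((1/2) * (S.m t r ^ 2 / S.ρ t r) + S.hbar t r) * r ^ (n - 1))
    + S.ε * ∫ p in S.dom,
        (hDelta'' γ ((γ - 1) ^ (2:ℕ) / (4 * γ)) S.δ (S.ρ p.1 p.2) * S.ρr p.1 p.2 ^ 2
          + S.ρ p.1 p.2 * S.ur p.1 p.2 ^ 2
          + (n - 1 : ℝ) * (S.m p.1 p.2 ^ 2 / S.ρ p.1 p.2 / p.2 ^ 2)) * p.2 ^ (n - 1) ≤ E₀ := by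
  have h := S.energy t ht
  have h1 := S.continuousOn_m_sq_div
  have h2 := S.continuousOn_ur
  have h3 : ContinuousOn (fun p : ℝ × ℝ => S.ρ p.1 p.2 ^ (γ - 2)) S.dom :=
    ContinuousOn.rpow_const (by fun_prop) (fun p hp => Or.inl (S.ρ_ne_dom p hp))
  have h4 : ContinuousOn (fun p : ℝ × ℝ => S.m p.1 p.2 ^ 2 / S.ρ p.1 p.2 / p.2 ^ 2) S.dom :=
    h1.div (by fun_prop) (fun p hp => pow_ne_zero 2 (S.r_ne_dom p hp))
  have e := setIntegral_rect_eq (T := T) (a := S.a) (b := S.b) (f := fun t r =>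
    (hDelta'' γ ((γ - 1) ^ (2:ℕ) / (4 * γ)) S.δ (S.ρ t r) * S.ρr t r ^ 2
          + S.ρ t r * S.ur t r ^ 2
          + (n - 1 : ℝ) * (S.m t r ^ 2 / S.ρ t r / r ^ 2)) * r ^ (n - 1))
    (by
      change ContinuousOn _ S.dom
      unfold hDelta''
      fun_prop)
  unfold dom
  rw [e]
  convert h using 2
  · rw [integral_Icc_eq_integral_Ioo]
    refine setIntegral_congr_fun measurableSet_Ioo (fun r hr => ?_)
    have := S.ρ_pos ht (Ioo_subset_Icc_self hr)
    simp only [hbar]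
    field_simp
  · congr 1
    rw [integral_Icc_eq_integral_Ioo]
    refine setIntegral_congr_fun measurableSet_Ioo (fun s hs => ?_)
    rw [integral_Icc_eq_integral_Ioo]
    refine setIntegral_congr_fun measurableSet_Ioo (fun r hr => ?_)
    have hs' := Ioo_subset_Icc_self hs
    have hr' := Ioo_subset_Icc_self hr
    have h0 := S.ρ_pos hs' hr'
    have h0' := S.r_pos hr'
    simp only [(S.hasDerivAt_u_right hs' hr').deriv]
    simp only [ρr]
    field_simp

theorem one_le_n_sub_one (S : ViscousSetup n γ T E₀) : (1 : ℝ) ≤ n - 1 := by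
  have : (2 : ℝ) ≤ n := by exact_mod_cast S.hn
  linarith

theorem diss_integrand_nonneg {p : ℝ × ℝ} (hp : p ∈ S.dom) :
    0 ≤ (hDelta'' γ ((γ - 1) ^ (2:ℕ) / (4 * γ)) S.δ (S.ρ p.1 p.2) * S.ρr p.1 p.2 ^ 2
          + S.ρ p.1 p.2 * S.ur p.1 p.2 ^ 2
          + (n - 1 : ℝ) * (S.m p.1 p.2 ^ 2 / S.ρ p.1 p.2 / p.2 ^ 2)) * p.2 ^ (n - 1) := by
  have h0 := S.ρ_pos_dom hp
  have h0' := S.r_pos_dom hp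
  have := S.hδ
  have h1 : 0 < γ := by linarith [S.hγ]
  have h2 := S.one_le_n_sub_one
  have h3 : (0 : ℝ) ≤ n - 1 := by linarith
  unfold hDelta''
  positivity

theorem continuousOn_slice {f : ℝ → ℝ → ℝ}
    (hf : ContinuousOn (fun p : ℝ × ℝ => f p.1 p.2) S.dom) {t : ℝ} (ht : t ∈ Icc 0 T) :
    ContinuousOn (fun y => f t y) (Icc S.a S.b) :=
  ContinuousOn.slice_right hf ht

theorem integral_energyDensity_le {t : ℝ} (ht : t ∈ Icc 0 T) :
    ∫ r in Icc S.a S.b, S.energyDensity t r ≤ 2 * E₀ := by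
  have h := S.energy_Icc ht
  have h1 := setIntegral_nonneg_rect (T := T) (a := S.a) (b := S.b) fun p hp =>
    S.diss_integrand_nonneg (p := p) hp
  have c1 := S.continuousOn_slice S.continuousOn_energyDensity ht
  have c2 := S.continuousOn_slice (f := fun t r => S.m t r ^ 2 / S.ρ t r)
    S.continuousOn_m_sq_div ht
  have c3 := S.continuousOn_slice S.continuousOn_hbar ht
  have h2 : ∫ r in Icc S.a S.b, S.energyDensity t r
      ≤ ∫ r in Icc S.a S.b,
        2 * (((1/2) * (S.m t r ^ 2 / S.ρ t r) + S.hbar t r) * r ^ (n - 1)) := by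
    refine setIntegral_mono_on c1.integrableOn_Icc ?_ measurableSet_Icc fun r hr => ?_
    · apply ContinuousOn.integrableOn_Icc
      fun_prop
    · have := S.hbar_nonneg ht hr
      have := S.r_pos hr
      have : 0 ≤ S.hbar t r * r ^ (n - 1) := by positivity
      simp only [energyDensity]
      linarith
  rw [integral_const_mul] at h2
  have := mul_nonneg S.hε.le h1
  change 0 ≤ S.ε * ∫ p in S.dom, _ at this
  linarith

theorem E₀_nonneg (S : ViscousSetup n γ T E₀) : 0 ≤ E₀ := by
  have ht : (0 : ℝ) ∈ Icc 0 T := ⟨le_rfl, S.hT.le⟩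
  have h := S.integral_energyDensity_le ht
  have := setIntegral_nonneg (μ := volume) measurableSet_Icc
    fun r hr => S.energyDensity_nonneg ht hr
  linarith

theorem integral_dissDensity_le :
    S.ε * ∫ p in S.dom, S.dissDensity p.1 p.2 ≤ (4 / (γ - 1) ^ 2 + 1) * E₀ := by
  have ht : (0 : ℝ) ∈ Icc 0 T := ⟨le_rfl, S.hT.le⟩
  have h := S.energy_Icc ht
  have hγ1 : 0 < γ - 1 := by linarith [S.hγ]
  have h1 := setIntegral_nonneg (μ := volume) measurableSet_Icc (s := Icc S.a S.b) (f := fun r =>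
    ((1/2) * (S.m 0 r ^ 2 / S.ρ 0 r) + S.hbar 0 r) * r ^ (n - 1)) fun r hr => by
      have := S.hbar_nonneg ht hr
      have := S.ρ_pos ht hr
      have := S.r_pos hr
      positivity
  have i1 := S.continuousOn_dissDensity.integrableOn_compact (μ := volume) S.isCompact_dom
  have h1' := S.continuousOn_m_sq_div
  have h2' := S.continuousOn_ur
  have h3' : ContinuousOn (fun p : ℝ × ℝ => S.ρ p.1 p.2 ^ (γ - 2)) S.dom :=
    ContinuousOn.rpow_const (by fun_prop) (fun p hp => Or.inl (S.ρ_ne_dom p hp))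
  have h4' : ContinuousOn (fun p : ℝ × ℝ => S.m p.1 p.2 ^ 2 / S.ρ p.1 p.2 / p.2 ^ 2) S.dom :=
    h1'.div (by fun_prop) (fun p hp => pow_ne_zero 2 (S.r_ne_dom p hp))
  have h2 : ∫ p in S.dom, S.dissDensity p.1 p.2
      ≤ ∫ p in S.dom, (4 / (γ - 1) ^ 2 + 1) *
        ((hDelta'' γ ((γ - 1) ^ (2:ℕ) / (4 * γ)) S.δ (S.ρ p.1 p.2) * S.ρr p.1 p.2 ^ 2
          + S.ρ p.1 p.2 * S.ur p.1 p.2 ^ 2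
          + (n - 1 : ℝ) * (S.m p.1 p.2 ^ 2 / S.ρ p.1 p.2 / p.2 ^ 2)) * p.2 ^ (n - 1)) := by
    refine setIntegral_mono_on i1 ?_ S.measurableSet_dom fun p hp => ?_
    · refine ContinuousOn.integrableOn_compact S.isCompact_dom ?_
      unfold hDelta''
      fun_prop
    · have h0 := S.ρ_pos_dom hp
      have h0' := S.r_pos_dom hp
      have hδ := S.hδ
      have hγ : 0 < γ := by linarith
      have hn := S.one_le_n_sub_one
      simp only [dissDensity, hDelta'']
      rw [← mul_assoc]
      refine mul_le_mul_of_nonneg_right ?_ (by positivity)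
      have e : (γ - 1) ^ (2:ℕ) / (4 * γ) * γ = (γ - 1) ^ 2 / 4 := by field_simp
      rw [e]
      have a1 : S.ρ p.1 p.2 ^ (γ - 2) * S.ρr p.1 p.2 ^ 2 ≤ (4 / (γ - 1) ^ 2 + 1) *
          (((γ - 1) ^ 2 / 4 * S.ρ p.1 p.2 ^ (γ - 2) + 2 * S.δ) * S.ρr p.1 p.2 ^ 2) := by
        have : (4 / (γ - 1) ^ 2) * ((γ - 1) ^ 2 / 4 * (S.ρ p.1 p.2 ^ (γ - 2)
          * S.ρr p.1 p.2 ^ 2)) = S.ρ p.1 p.2 ^ (γ - 2) * S.ρr p.1 p.2 ^ 2 := by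
          field_simp
        have : 0 ≤ (4 / (γ - 1) ^ 2) * (2 * S.δ * S.ρr p.1 p.2 ^ 2) +
          (((γ - 1) ^ 2 / 4 * S.ρ p.1 p.2 ^ (γ - 2) + 2 * S.δ) * S.ρr p.1 p.2 ^ 2) := by
          positivity
        linarith
      have hK : 0 ≤ 4 / (γ - 1) ^ 2 := by positivity
      have a2 : S.ρ p.1 p.2 * S.ur p.1 p.2 ^ 2
          ≤ (4 / (γ - 1) ^ 2 + 1) * (S.ρ p.1 p.2 * S.ur p.1 p.2 ^ 2) := by
        have : 0 ≤ S.ρ p.1 p.2 * S.ur p.1 p.2 ^ 2 := by positivity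
        nlinarith
      have a3 : S.m p.1 p.2 ^ 2 / S.ρ p.1 p.2 / p.2 ^ 2
          ≤ (4 / (γ - 1) ^ 2 + 1) * ((n - 1 : ℝ) * (S.m p.1 p.2 ^ 2 / S.ρ p.1 p.2 / p.2 ^ 2)) := by
        have : 0 ≤ S.m p.1 p.2 ^ 2 / S.ρ p.1 p.2 / p.2 ^ 2 := by positivity
        have : S.m p.1 p.2 ^ 2 / S.ρ p.1 p.2 / p.2 ^ 2
          ≤ (n - 1 : ℝ) * (S.m p.1 p.2 ^ 2 / S.ρ p.1 p.2 / p.2 ^ 2) := by nlinarith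
        nlinarith
      linarith
  rw [integral_const_mul] at h2
  have hK : 0 ≤ 4 / (γ - 1) ^ 2 + 1 := by positivity
  have h3 := mul_le_mul_of_nonneg_left h2 S.hε.le
  rw [mul_left_comm] at h3
  exact h3.trans (mul_le_mul_of_nonneg_left (by linarith) hK)

end ViscousSetup

/-- The convex function with second derivative `d / (x (x + d))`. -/
def logPhi (d x : ℝ) : ℝ := -(x * (log (x + d) - log x)) - d * (log (x + d) - log d)

/-- The derivative of `logPhi`. -/
def logPhi' (d x : ℝ) : ℝ := -(log (x + d) - log x)

/-- The Legendre-type companion `x φ'(x) - φ(x)` of `logPhi`. -/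
def logG (d x : ℝ) : ℝ := d * (log (x + d) - log d)

theorem logPhi_eq (d x : ℝ) : x * logPhi' d x - logPhi d x = logG d x := by
  unfold logPhi logPhi' logG; ring

theorem hasDerivAt_logPhi' {d x : ℝ} (hd : 0 < d) (hx : 0 < x) :
    HasDerivAt (logPhi' d) (d / (x * (x + d))) x := by
  unfold logPhi'
  have h1 : HasDerivAt (fun x => log (x + d)) (1 / (x + d)) x :=
    ((hasDerivAt_id x).add_const d).log (by simp; positivity)
  have h2 := hasDerivAt_log hx.ne'
  refine (h1.sub h2).neg.congr_deriv ?_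
  field_simp; ring

theorem hasDerivAt_logG {d x : ℝ} (hd : 0 < d) (hx : 0 < x) :
    HasDerivAt (logG d) (d / (x + d)) x := by
  unfold logG
  have h1 : HasDerivAt (fun x => log (x + d)) (1 / (x + d)) x :=
    ((hasDerivAt_id x).add_const d).log (by simp; positivity)
  refine ((h1.sub_const (log d)).const_mul d).congr_deriv ?_
  field_simp

theorem hasDerivAt_logPhi {d x : ℝ} (hd : 0 < d) (hx : 0 < x) :
    HasDerivAt (logPhi d) (logPhi' d x) x := by
  have h := ((hasDerivAt_id x).mul (hasDerivAt_logPhi' hd hx)).sub (hasDerivAt_logG hd hx)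
  have e : logPhi d = (id * logPhi' d) - logG d := by
    ext y; simp [← logPhi_eq]
  rw [e]
  refine h.congr_deriv ?_
  simp only [id]; field_simp; ring

theorem sq_log_mul_le {y : ℝ} (hy : 0 ≤ y) : log (1 + y) ^ 2 * (1 + y) ≤ y ^ 2 := by
  set s := log (1 + y) / 2 with hs
  have h0 : 0 ≤ s := div_nonneg (log_nonneg (by linarith)) (by norm_num)
  have h1 : exp s * exp s = 1 + y := by
    rw [← exp_add]
    have : s + s = log (1 + y) := by rw [hs]; ring
    rw [this, exp_log (by linarith)]
  have h2 : s ≤ sinh s := self_le_sinh_iff.2 h0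
  rw [sinh_eq] at h2
  have h3 : exp s * exp (-s) = 1 := by rw [← exp_add]; simp
  have h4 : 2 * s * exp s ≤ y := by
    have := mul_le_mul_of_nonneg_right h2 (exp_pos s).le
    nlinarith
  have h5 : log (1 + y) = 2 * s := by rw [hs]; ring
  rw [h5, ← h1]
  have : (2 * s * exp s) ^ 2 ≤ y ^ 2 := pow_le_pow_left₀ (by positivity) h4 2
  nlinarith

theorem sq_log_sub_log_mul_le {d x : ℝ} (hd : 0 < d) (hx : 0 < x) :
    (log (x + d) - log x) ^ 2 * (x * (x + d)) ≤ d ^ 2 := by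
  have h := sq_log_mul_le (y := d / x) (by positivity)
  have e : log (x + d) - log x = log (1 + d / x) := by
    rw [← log_div (by positivity) (by positivity)]
    congr 1; field_simp
  rw [e]
  have e2 : x * (x + d) = (1 + d / x) * x ^ 2 := by field_simp
  have := mul_le_mul_of_nonneg_right h (by positivity : 0 ≤ x ^ 2)
  rw [e2, ← mul_assoc]
  refine this.trans_eq ?_
  field_simp

theorem log_sub_log_nonneg {d x : ℝ} (hd : 0 < d) (hx : 0 < x) : 0 ≤ log (x + d) - log x :=
  sub_nonneg.2 (log_le_log hx (by linarith))

theorem sq_logPhi'_le {d x : ℝ} (hd : 0 < d) (hx : 0 < x) :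
    logPhi' d x ^ 2 ≤ d * (d / (x * (x + d))) := by
  have := sq_log_sub_log_mul_le hd hx
  rw [logPhi', neg_sq, ← mul_div_assoc, le_div_iff₀ (by positivity)]
  linarith

theorem sq_logG_le {d x : ℝ} (hd : 0 < d) (hx : 0 < x) : logG d x ^ 2 ≤ d * x := by
  have h := sq_log_sub_log_mul_le hx hd
  rw [add_comm] at h
  unfold logG
  set L := log (x + d) - log d
  have h2 : 0 ≤ L ^ 2 * d := by positivity
  have h3 : L ^ 2 * d * x ≤ x * x := by nlinarith [mul_nonneg h2 hd.le]
  have := le_of_mul_le_mul_right h3 hx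
  nlinarith

theorem sq_logPhi_le {d x : ℝ} (hd : 0 < d) (hx : 0 < x) : logPhi d x ^ 2 ≤ 4 * (d * x) := by
  have h1 := sq_logG_le hd hx
  have h2 := sq_logG_le hx hd
  have e : logPhi d x = -logG x d - logG d x := by
    unfold logPhi logG; rw [add_comm d x]
  rw [e]
  nlinarith [sq_nonneg (logG x d - logG d x)]

theorem logPhi_nonpos {d x : ℝ} (hd : 0 < d) (hx : 0 < x) : logPhi d x ≤ 0 := by
  have h1 := log_sub_log_nonneg hd hx
  have h2 := log_sub_log_nonneg hx hd
  rw [add_comm] at h2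
  unfold logPhi
  have := mul_nonneg hx.le h1
  have := mul_nonneg hd.le h2
  linarith

theorem continuousOn_logPhi {d : ℝ} (hd : 0 < d) : ContinuousOn (logPhi d) (Ioi 0) :=
  fun _ hx => (hasDerivAt_logPhi hd hx).continuousAt.continuousWithinAt

theorem continuousOn_logPhi' {d : ℝ} (hd : 0 < d) : ContinuousOn (logPhi' d) (Ioi 0) :=
  fun _ hx => (hasDerivAt_logPhi' hd hx).continuousAt.continuousWithinAt

theorem continuousOn_logG {d : ℝ} (hd : 0 < d) : ContinuousOn (logG d) (Ioi 0) :=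
  fun _ hx => (hasDerivAt_logG hd hx).continuousAt.continuousWithinAt

/-- For `γ < 2` the logarithm is dominated by a power. -/
theorem exists_sq_logPhi'_le_rpow {γ : ℝ} (hγ : 1 < γ) (hγ2 : γ < 2) :
    ∃ K : ℝ, 0 < K ∧ ∀ d x : ℝ, 0 < d → 0 < x →
      logPhi' d x ^ 2 ≤ K * (d ^ (2 - γ) * x ^ (γ - 2)) := by
  set β := (2 - γ) / 2 with hβ
  have hβ0 : 0 < β := by rw [hβ]; linarith
  refine ⟨1 + (2 ^ β / β) ^ 2, by positivity, ?_⟩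
  intro d x hd hx
  have e : logPhi' d x ^ 2 = log (1 + d / x) ^ 2 := by
    rw [logPhi', neg_sq, ← log_div (by positivity) (by positivity)]
    congr 2; field_simp
  have e2 : d ^ (2 - γ) * x ^ (γ - 2) = (d / x) ^ (2 - γ) := by
    rw [div_rpow hd.le hx.le, show γ - 2 = -(2 - γ) by ring, rpow_neg hx.le]
    rfl
  rw [e, e2]
  set y := d / x with hy
  have hy0 : 0 < y := by positivity
  have hl0 : 0 ≤ log (1 + y) := log_nonneg (by linarith)
  have hyp : 0 < y ^ (2 - γ) := by positivity
  rcases le_total y 1 with h | h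
  · have h1 : log (1 + y) ≤ y := by
      have := log_le_sub_one_of_pos (by linarith : 0 < 1 + y); linarith
    have h2 : y ^ 2 ≤ y ^ (2 - γ) := by
      rw [← rpow_natCast]
      exact rpow_le_rpow_of_exponent_ge hy0 h (by push_cast; linarith)
    have h3 : log (1 + y) ^ 2 ≤ y ^ 2 := pow_le_pow_left₀ hl0 h1 2
    have : 0 ≤ (2 ^ β / β) ^ 2 * y ^ (2 - γ) := by positivity
    linarith
  · have h1 : log (1 + y) ≤ (1 + y) ^ β / β := log_le_rpow_div (by linarith) hβ0
    have h2 : (1 + y) ^ β ≤ 2 ^ β * y ^ β := by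
      rw [← mul_rpow (by norm_num) hy0.le]
      exact rpow_le_rpow (by linarith) (by linarith) hβ0.le
    have h3 : log (1 + y) ≤ 2 ^ β / β * y ^ β := by
      refine h1.trans ?_
      rw [div_mul_eq_mul_div]
      gcongr
    have h4 := pow_le_pow_left₀ hl0 h3 2
    have e3 : (y ^ β) ^ 2 = y ^ (2 - γ) := by
      rw [← rpow_natCast, ← rpow_mul hy0.le, hβ]; congr 1; push_cast; ring
    rw [mul_pow, e3] at h4
    linarith

theorem abs_le_of_sq_le_mul {X d ε q : ℝ} (hd : 0 < d) (hε : 0 < ε) (hq : 0 ≤ q)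
    (h : X ^ 2 ≤ d * q) : |X| ≤ √d / √ε * (1 + ε * q) := by
  refine abs_le_of_sq_le_sq ?_ (by positivity)
  rw [mul_pow, div_pow, sq_sqrt hd.le, sq_sqrt hε.le]
  refine h.trans ?_
  rw [div_mul_eq_mul_div, le_div_iff₀ hε]
  have : ε * q ≤ (1 + ε * q) ^ 2 := by nlinarith [mul_nonneg hε.le hq]
  nlinarith

/-- An integrable weight dominating the cutoffs. -/
def decay (r : ℝ) : ℝ := 1 / (1 + r) ^ 2

theorem decay_nonneg (r : ℝ) : 0 ≤ decay r := by unfold decay; positivity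

theorem continuousOn_decay {a b : ℝ} (ha : 0 ≤ a) : ContinuousOn decay (Icc a b) := by
  unfold decay
  refine ContinuousOn.div (by fun_prop) (by fun_prop) fun r hr => ?_
  have : 0 < 1 + r := by linarith [hr.1]
  positivity

theorem integral_decay_le {a b : ℝ} (ha : 0 ≤ a) (hab : a ≤ b) :
    ∫ r in Icc a b, decay r ≤ 1 := by
  have h := intervalIntegral.integral_eq_sub_of_hasDerivAt_of_le (f := fun r => -(1 / (1 + r)))
    (f' := decay) hab ?_ ?_ ((continuousOn_decay ha).intervalIntegrable_of_Icc hab)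
  · rw [intervalIntegral.integral_of_le hab, ← integral_Icc_eq_integral_Ioc] at h
    rw [h]
    have h1 : 0 < 1 / (1 + b) := by have : 0 < 1 + b := by linarith
                                    positivity
    have h2 : 1 / (1 + a) ≤ 1 := by rw [div_le_one (by linarith)]; linarith
    linarith
  · refine ContinuousOn.neg (ContinuousOn.div (by fun_prop) (by fun_prop) fun r hr => ?_)
    have : 0 < 1 + r := by linarith [hr.1]
    positivity
  · intro r hr
    have hr0 : 1 + r ≠ 0 := by linarith [hr.1]
    have h1 : HasDerivAt (fun r : ℝ => 1 + r) 1 r := (hasDerivAt_id r).const_add 1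
    have h2 := (h1.inv hr0).neg
    convert h2 using 1
    · ext y; simp
    · unfold decay; ring

theorem pow_le_decay {k : ℕ} {r : ℝ} (h0 : 0 < r) (h2 : r < 2) :
    r ^ k ≤ 9 * 2 ^ k * decay r := by
  have h1 : r ^ k ≤ 2 ^ k := pow_le_pow_left₀ h0.le h2.le k
  unfold decay
  rw [mul_one_div, le_div_iff₀ (by positivity)]
  have : (1 + r) ^ 2 ≤ 9 := by nlinarith
  have h3 : 0 < r ^ k := by positivity
  nlinarith

/-- A radial cutoff equal to one on `[0,1]`, vanishing on `[2,∞)`, bounded in `C¹` by `W`. -/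
structure IsCutoff (ω : ℝ → ℝ) (W : ℝ) : Prop where
  smooth : ContDiff ℝ (⊤ : ℕ∞) ω
  one_le : 1 ≤ W
  abs_le : ∀ r, |ω r| ≤ W
  abs_deriv_le : ∀ r, |deriv ω r| ≤ W
  eq_one : ∀ r ∈ Icc (0:ℝ) 1, ω r = 1
  eq_zero : ∀ r : ℝ, 2 ≤ r → ω r = 0

theorem exists_isCutoff {ω : ℝ → ℝ} (hω_smooth : ContDiff ℝ (⊤ : ℕ∞) ω)
    (hω_supp : HasCompactSupport ω) (hω_one : ∀ r ∈ Icc (0:ℝ) 1, ω r = 1)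
    (hω_zero : ∀ r : ℝ, 2 ≤ r → ω r = 0) : ∃ W, IsCutoff ω W := by
  obtain ⟨C₁, h₁⟩ := hω_supp.exists_bound_of_continuous hω_smooth.continuous
  obtain ⟨C₂, h₂⟩ := hω_supp.deriv.exists_bound_of_continuous
    (hω_smooth.continuous_deriv (by simp))
  refine ⟨max 1 (max C₁ C₂), hω_smooth, le_max_left _ _, fun r => ?_, fun r => ?_, hω_one, hω_zero⟩
  · exact (h₁ r).trans ((le_max_left _ _).trans (le_max_right _ _))
  · exact (h₂ r).trans ((le_max_right _ _).trans (le_max_right _ _))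

namespace IsCutoff

variable {ω : ℝ → ℝ} {W : ℝ}

theorem continuous (h : IsCutoff ω W) : Continuous ω := h.smooth.continuous

theorem continuous_deriv (h : IsCutoff ω W) : Continuous (deriv ω) :=
  h.smooth.continuous_deriv (by simp)

theorem hasDerivAt (h : IsCutoff ω W) (r : ℝ) : HasDerivAt ω (deriv ω r) r :=
  (h.smooth.differentiable (by simp) r).hasDerivAt

theorem sq_le (h : IsCutoff ω W) (r : ℝ) : ω r ^ 2 ≤ W ^ 2 :=
  sq_le_sq' (_root_.abs_le.1 (h.abs_le r)).1 (_root_.abs_le.1 (h.abs_le r)).2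

end IsCutoff

namespace ViscousSetup

variable {n : ℕ} {γ T E₀ : ℝ} (S : ViscousSetup n γ T E₀)

theorem continuousOn_comp_ρ {f : ℝ → ℝ} (hf : ContinuousOn f (Ioi 0)) :
    ContinuousOn (fun p : ℝ × ℝ => f (S.ρ p.1 p.2)) S.dom :=
  hf.comp S.continuous_ρ.continuousOn (fun _ hp => S.ρ_pos_dom hp)

theorem integral_energyDensity_dom_le :
    ∫ p in S.dom, S.energyDensity p.1 p.2 ≤ T * (2 * E₀) :=
  setIntegral_rect_le S.hT.le S.continuousOn_energyDensity
    (fun _ ht => S.integral_energyDensity_le ht)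

theorem continuousOn_decay_dom : ContinuousOn (fun p : ℝ × ℝ => decay p.2) S.dom :=
  (continuousOn_decay (b := S.b) S.ha0.le).comp continuousOn_snd (fun _ hp => hp.2)

theorem integral_decay_dom_le : ∫ p in S.dom, decay p.2 ≤ T := by
  have := setIntegral_rect_le (f := fun _ r => decay r) S.hT.le S.continuousOn_decay_dom
    (fun _ _ => integral_decay_le S.ha0.le S.a_le_b)
  rwa [mul_one] at this

/-- Green's formula on the space-time rectangle. -/
theorem green {A A' J J' : ℝ → ℝ → ℝ}
    (hA : ContinuousOn (fun p : ℝ × ℝ => A p.1 p.2) S.dom)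
    (hA' : ContinuousOn (fun p : ℝ × ℝ => A' p.1 p.2) S.dom)
    (hJ : ContinuousOn (fun p : ℝ × ℝ => J p.1 p.2) S.dom)
    (hJ' : ContinuousOn (fun p : ℝ × ℝ => J' p.1 p.2) S.dom)
    (dA : ∀ t ∈ Ioo 0 T, ∀ r ∈ Ioo S.a S.b, HasDerivAt (fun s => A s r) (A' t r) t)
    (dJ : ∀ t ∈ Ioo 0 T, ∀ r ∈ Ioo S.a S.b, HasDerivAt (fun y => J t y) (J' t r) r) :
    ∫ p in S.dom, (A' p.1 p.2 - J' p.1 p.2)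
      = (∫ r in Icc S.a S.b, (A T r - A 0 r)) - ∫ t in Icc 0 T, (J t S.b - J t S.a) :=
  setIntegral_sub_eq_of_hasDerivAt_slices S.hT.le S.a_le_b hA hA' hJ hJ' dA dJ

/-- The logarithmic entropy balance, localized by a cutoff. -/
theorem integral_logPhi_balance {ω : ℝ → ℝ} {W : ℝ} (h : IsCutoff ω W) (hb : 2 < S.b)
    {d : ℝ} (hd : 0 < d) :
    ∫ p in S.dom,
      (-2 * ω p.2 * deriv ω p.2 * (logPhi' d (S.ρ p.1 p.2) * S.ε * S.ρr p.1 p.2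
          - logPhi d (S.ρ p.1 p.2) * (S.m p.1 p.2 / S.ρ p.1 p.2))
        - ω p.2 ^ 2 * (S.ε * (d / (S.ρ p.1 p.2 * (S.ρ p.1 p.2 + d))) * S.ρr p.1 p.2 ^ 2
          + logG d (S.ρ p.1 p.2) * S.ur p.1 p.2
          + (n - 1 : ℝ) * (logG d (S.ρ p.1 p.2) * (S.m p.1 p.2 / S.ρ p.1 p.2 / p.2))))
        * p.2 ^ (n - 1)
      = ∫ r in Icc S.a S.b, (r ^ (n - 1) * logPhi d (S.ρ T r) * ω r ^ 2
          - r ^ (n - 1) * logPhi d (S.ρ 0 r) * ω r ^ 2) := by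
  have hω := h.continuous
  have hω' := h.continuous_deriv
  have c1 := S.continuousOn_comp_ρ (continuousOn_logPhi hd)
  have c2 := S.continuousOn_comp_ρ (continuousOn_logPhi' hd)
  have c3 := S.continuousOn_comp_ρ (continuousOn_logG hd)
  have c4 := S.continuousOn_ur
  have c5 : ContinuousOn (fun p : ℝ × ℝ => S.m p.1 p.2 / S.ρ p.1 p.2) S.dom :=
    ContinuousOn.div (by fun_prop) (by fun_prop) S.ρ_ne_dom
  have c6 : ContinuousOn (fun p : ℝ × ℝ => (n - 1 : ℕ) * p.2 ^ (n - 1) / p.2) S.dom :=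
    ContinuousOn.div (by fun_prop) (by fun_prop) S.r_ne_dom
  have c7 : ContinuousOn (fun p : ℝ × ℝ => d / (S.ρ p.1 p.2 * (S.ρ p.1 p.2 + d))) S.dom :=
    ContinuousOn.div (by fun_prop) (by fun_prop) fun p hp => by
      have := S.ρ_pos_dom hp; positivity
  have c8 : ContinuousOn (fun p : ℝ × ℝ => d / (S.ρ p.1 p.2 + d)) S.dom :=
    ContinuousOn.div (by fun_prop) (by fun_prop) fun p hp => by
      have := S.ρ_pos_dom hp; positivity
  have hω2 : ContinuousOn (fun p : ℝ × ℝ => ω p.2) S.dom := by fun_prop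
  have hω2' : ContinuousOn (fun p : ℝ × ℝ => deriv ω p.2) S.dom := by fun_prop
  have g := S.green
    (A := fun t r => r ^ (n - 1) * logPhi d (S.ρ t r) * ω r ^ 2)
    (A' := fun t r => r ^ (n - 1) * (logPhi' d (S.ρ t r) * S.ρt t r) * ω r ^ 2)
    (J := fun t r => ω r ^ 2 * (logPhi' d (S.ρ t r) * S.flux t r
      + logG d (S.ρ t r) * (S.m t r / S.ρ t r) * r ^ (n - 1)))
    (J' := fun t r => 2 * ω r * deriv ω r * (logPhi' d (S.ρ t r) * S.flux t r
      + logG d (S.ρ t r) * (S.m t r / S.ρ t r) * r ^ (n - 1))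
      + ω r ^ 2 * ((d / (S.ρ t r * (S.ρ t r + d)) * S.ρr t r) * S.flux t r
        + logPhi' d (S.ρ t r) * (r ^ (n - 1) * S.ρt t r)
        + (((d / (S.ρ t r + d) * S.ρr t r) * (S.m t r / S.ρ t r)
          + logG d (S.ρ t r) * S.ur t r) * r ^ (n - 1)
          + logG d (S.ρ t r) * (S.m t r / S.ρ t r) * ((n - 1 : ℕ) * r ^ (n - 1) / r))))
    (by fun_prop) (by fun_prop) (by fun_prop) (by fun_prop) ?_ ?_
  · have e : ∫ t in Icc 0 T, (ω S.b ^ 2 * (logPhi' d (S.ρ t S.b) * S.flux t S.b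
      + logG d (S.ρ t S.b) * (S.m t S.b / S.ρ t S.b) * S.b ^ (n - 1)) -
        ω S.a ^ 2 * (logPhi' d (S.ρ t S.a) * S.flux t S.a
      + logG d (S.ρ t S.a) * (S.m t S.a / S.ρ t S.a) * S.a ^ (n - 1))) = 0 := by
      rw [setIntegral_congr_fun (g := fun _ => 0) measurableSet_Icc]
      · simp
      · intro t ht
        simp [h.eq_zero S.b hb.le, S.flux_a ht, S.bc_ma t ht]
    rw [e, sub_zero] at g
    rw [← g]
    refine setIntegral_congr_fun S.measurableSet_dom fun p hp => ?_
    have h0 := S.ρ_pos_dom hp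
    have h0' := S.r_pos_dom hp
    have hn : ((n - 1 : ℕ) : ℝ) = n - 1 := by
      have := S.hn; push_cast [Nat.cast_sub (by omega : 1 ≤ n)]; ring
    have e3 := logPhi_eq d (S.ρ p.1 p.2)
    have e4 : logPhi d (S.ρ p.1 p.2)
      = S.ρ p.1 p.2 * logPhi' d (S.ρ p.1 p.2) - logG d (S.ρ p.1 p.2) := by linarith
    simp only [flux, hn]
    rw [e4]
    field_simp
    ring
  · intro t ht r hr
    have h0 := S.ρ_pos (Ioo_subset_Icc_self ht) (Ioo_subset_Icc_self hr)
    exact (((hasDerivAt_logPhi hd h0).comp t (S.hasDerivAt_ρ_left t r)).const_mul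
      (r ^ (n - 1))).mul_const (ω r ^ 2)
  · intro t ht r hr
    have ht' := Ioo_subset_Icc_self ht
    have hr' := Ioo_subset_Icc_self hr
    have h0 := S.ρ_pos ht' hr'
    have hr0 := S.r_pos hr'
    have d1 := (h.hasDerivAt r).fun_pow 2
    have d2 := (hasDerivAt_logPhi' hd h0).comp r (S.hasDerivAt_ρ_right t r)
    have d3 := (hasDerivAt_logG hd h0).comp r (S.hasDerivAt_ρ_right t r)
    have d4 := S.hasDerivAt_u_right ht' hr'
    have d5 := hasDerivAt_pow_div (k := n - 1) hr0.ne'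
    have d6 := d1.mul ((d2.mul (S.hasDerivAt_flux ht hr)).add ((d3.mul d4).mul d5))
    refine d6.congr_deriv ?_
    simp only [Pi.mul_apply, Pi.add_apply, Function.comp_apply]
    ring

end ViscousSetup

theorem rpow_le_one_add_rpow {x p q : ℝ} (hx : 0 < x) (hp : 0 ≤ p) (hpq : p ≤ q) :
    x ^ p ≤ 1 + x ^ q := by
  have hq : 0 < x ^ q := by positivity
  rcases le_total x 1 with h | h
  · have := rpow_le_one hx.le h hp
    linarith
  · have := rpow_le_rpow_of_exponent_le h hpq
    linarith

theorem neg_mul_le_mul_abs {X Y B : ℝ} (h : |X| ≤ B) : -(X * Y) ≤ B * |Y| := by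
  have h1 := neg_abs_le (X * Y)
  rw [abs_mul] at h1
  have := mul_le_mul_of_nonneg_right h (abs_nonneg Y)
  linarith

namespace ViscousSetup

variable {n : ℕ} {γ T E₀ : ℝ} (S : ViscousSetup n γ T E₀)

theorem m_sq_div_mul_le {t r : ℝ} (ht : t ∈ Icc 0 T) (hr : r ∈ Icc S.a S.b) :
    S.m t r ^ 2 / S.ρ t r * r ^ (n - 1) ≤ S.energyDensity t r := by
  have h1 := S.hbar_nonneg ht hr
  have h2 := S.r_pos hr
  have : 0 ≤ S.hbar t r * r ^ (n - 1) := by positivity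
  unfold energyDensity
  linarith

theorem diss_terms_le {t r : ℝ} (ht : t ∈ Icc 0 T) (hr : r ∈ Icc S.a S.b) :
    S.ρ t r ^ (γ - 2) * S.ρr t r ^ 2 * r ^ (n - 1) ≤ S.dissDensity t r ∧
    S.ρ t r * S.ur t r ^ 2 * r ^ (n - 1) ≤ S.dissDensity t r ∧
    S.m t r ^ 2 / S.ρ t r / r ^ 2 * r ^ (n - 1) ≤ S.dissDensity t r := by
  have h2 := S.r_pos hr
  have h3 := S.ρ_pos ht hr
  have a1 : 0 ≤ S.ρ t r ^ (γ - 2) * S.ρr t r ^ 2 * r ^ (n - 1) := by positivity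
  have a2 : 0 ≤ S.ρ t r * S.ur t r ^ 2 * r ^ (n - 1) := by positivity
  have a3 : 0 ≤ S.m t r ^ 2 / S.ρ t r / r ^ 2 * r ^ (n - 1) := by positivity
  unfold dissDensity
  refine ⟨?_, ?_, ?_⟩ <;> linarith

/-- Pointwise bound of the integrand in the logarithmic entropy balance. -/
theorem logPhi_balance_le {ω : ℝ → ℝ} {W : ℝ} (h : IsCutoff ω W)
    {d k₁ k₂ : ℝ} (hd : 0 < d) (hk₁ : 0 ≤ k₁) (hk₂ : 0 ≤ k₂) {t r : ℝ}
    (ht : t ∈ Icc 0 T) (hr : r ∈ Icc S.a S.b)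
    (hX : r < 2 → |2 * ω r * deriv ω r * logPhi' d (S.ρ t r) * S.ε * S.ρr t r| * r ^ (n - 1)
      ≤ 1 / 2 * (ω r ^ 2 * (S.ε * (d / (S.ρ t r * (S.ρ t r + d))) * S.ρr t r ^ 2) * r ^ (n - 1))
        + k₁ * decay r + k₂ * (S.ε * S.dissDensity t r)) :
    (-2 * ω r * deriv ω r * (logPhi' d (S.ρ t r) * S.ε * S.ρr t r
          - logPhi d (S.ρ t r) * (S.m t r / S.ρ t r))
        - ω r ^ 2 * (S.ε * (d / (S.ρ t r * (S.ρ t r + d))) * S.ρr t r ^ 2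
          + logG d (S.ρ t r) * S.ur t r
          + (n - 1 : ℝ) * (logG d (S.ρ t r) * (S.m t r / S.ρ t r / r)))) * r ^ (n - 1)
      ≤ -(1 / 2 * (ω r ^ 2 * (S.ε * (d / (S.ρ t r * (S.ρ t r + d))) * S.ρr t r ^ 2)
          * r ^ (n - 1)))
        + k₁ * decay r + k₂ * (S.ε * S.dissDensity t r)
        + 4 * W ^ 2 * √d * (9 * 2 ^ (n - 1) * decay r + S.energyDensity t r)
        + n * W ^ 2 * (√d / √S.ε) * (9 * 2 ^ (n - 1) * decay r + S.ε * S.dissDensity t r) := by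
  have h0 := S.ρ_pos ht hr
  have hr0 := S.r_pos hr
  have hε := S.hε
  have hD := S.dissDensity_nonneg ht hr
  have hE := S.energyDensity_nonneg ht hr
  have hdec := decay_nonneg r
  have hW := h.one_le
  rcases lt_or_ge r 2 with h2 | h2
  swap
  · rw [h.eq_zero r h2]
    have : 0 ≤ k₁ * decay r + k₂ * (S.ε * S.dissDensity t r)
        + 4 * W ^ 2 * √d * (9 * 2 ^ (n - 1) * decay r + S.energyDensity t r)
        + n * W ^ 2 * (√d / √S.ε) * (9 * 2 ^ (n - 1) * decay r + S.ε * S.dissDensity t r) := by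
      positivity
    simpa using this
  specialize hX h2
  have hc := pow_le_decay (k := n - 1) hr0 h2
  obtain ⟨-, D2, D3⟩ := S.diss_terms_le ht hr
  have hmE := S.m_sq_div_mul_le ht hr
  set c := r ^ (n - 1) with hcdef
  have hc0 : 0 < c := by positivity
  set L := 9 * 2 ^ (n - 1) * decay r
  set x := S.ρ t r
  set D := S.dissDensity t r
  set E := S.energyDensity t r
  set s := √d / √S.ε with hs
  have hs0 : 0 ≤ s := by positivity
  have hg := sq_logG_le hd h0
  have hphi := sq_logPhi_le hd h0
  have b1 : |logPhi d x * (S.m t r / x) / 2| ≤ √d / √1 * (1 + 1 * (S.m t r ^ 2 / x)) := by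
    refine abs_le_of_sq_le_mul hd one_pos (by positivity) ?_
    have e : d * (S.m t r ^ 2 / x) = (4 * (d * x)) * ((S.m t r / x) ^ 2 / 4) := by
      field_simp
    rw [e]
    have := mul_le_mul_of_nonneg_right hphi (by positivity : 0 ≤ (S.m t r / x) ^ 2 / 4)
    linarith
  have b2 : |logG d x * S.ur t r| ≤ s * (1 + S.ε * (x * S.ur t r ^ 2)) := by
    refine abs_le_of_sq_le_mul hd hε (by positivity) ?_
    have := mul_le_mul_of_nonneg_right hg (sq_nonneg (S.ur t r))
    linarith
  have b3 : |logG d x * (S.m t r / x / r)| ≤ s * (1 + S.ε * (S.m t r ^ 2 / x / r ^ 2)) := by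
    refine abs_le_of_sq_le_mul hd hε (by positivity) ?_
    have := mul_le_mul_of_nonneg_right hg (sq_nonneg (S.m t r / x / r))
    have e : d * (S.m t r ^ 2 / x / r ^ 2) = d * x * (S.m t r / x / r) ^ 2 := by field_simp
    rw [e]; linarith
  have hww : |2 * (ω r * deriv ω r)| ≤ 2 * W ^ 2 := by
    rw [abs_mul, abs_mul, abs_two]
    have := mul_le_mul (h.abs_le r) (h.abs_deriv_le r) (abs_nonneg _) (by linarith)
    nlinarith
  have hw2 : |ω r ^ 2| ≤ W ^ 2 := by rw [abs_of_nonneg (sq_nonneg _)]; exact h.sq_le r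
  have e1 : |logPhi d x * (S.m t r / x)| ≤ 2 * √d * (1 + S.m t r ^ 2 / x) := by
    rw [abs_div, abs_two] at b1
    simp only [sqrt_one, div_one, one_mul] at b1
    linarith
  have f1 : 2 * (ω r * deriv ω r) * (logPhi d x * (S.m t r / x)) * c
      ≤ 4 * W ^ 2 * √d * (L + E) := by
    have := neg_mul_le_mul_abs (X := 2 * (ω r * deriv ω r)) (Y := -(logPhi d x * (S.m t r / x))) hww
    rw [abs_neg] at this
    have h3 : 2 * (ω r * deriv ω r) * (logPhi d x * (S.m t r / x))
        ≤ 2 * W ^ 2 * (2 * √d * (1 + S.m t r ^ 2 / x)) := by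
      have := mul_le_mul_of_nonneg_left e1 (by positivity : 0 ≤ 2 * W ^ 2)
      linarith
    calc _ ≤ 2 * W ^ 2 * (2 * √d * (1 + S.m t r ^ 2 / x)) * c :=
          mul_le_mul_of_nonneg_right h3 hc0.le
      _ = 4 * W ^ 2 * √d * (c + S.m t r ^ 2 / x * c) := by ring
      _ ≤ _ := by gcongr
  have f2 : -(ω r ^ 2 * (logG d x * S.ur t r)) * c ≤ W ^ 2 * s * (L + S.ε * D) := by
    have h3 := (neg_mul_le_mul_abs (Y := logG d x * S.ur t r) hw2).trans
      (mul_le_mul_of_nonneg_left b2 (by positivity : 0 ≤ W ^ 2))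
    calc _ ≤ _ := mul_le_mul_of_nonneg_right h3 hc0.le
      _ = W ^ 2 * s * (c + S.ε * (x * S.ur t r ^ 2 * c)) := by ring
      _ ≤ _ := by gcongr
  have f3 : -(ω r ^ 2 * (logG d x * (S.m t r / x / r))) * c ≤ W ^ 2 * s * (L + S.ε * D) := by
    have h3 := (neg_mul_le_mul_abs (Y := logG d x * (S.m t r / x / r)) hw2).trans
      (mul_le_mul_of_nonneg_left b3 (by positivity : 0 ≤ W ^ 2))
    calc _ ≤ _ := mul_le_mul_of_nonneg_right h3 hc0.le
      _ = W ^ 2 * s * (c + S.ε * (S.m t r ^ 2 / x / r ^ 2 * c)) := by ring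
      _ ≤ _ := by gcongr
  have f4 := mul_le_mul_of_nonneg_left f3 (by linarith [S.one_le_n_sub_one] : (0:ℝ) ≤ n - 1)
  have f5 : -(2 * ω r * deriv ω r * logPhi' d x * S.ε * S.ρr t r) * c
      ≤ 1 / 2 * (ω r ^ 2 * (S.ε * (d / (x * (x + d))) * S.ρr t r ^ 2) * c)
        + k₁ * decay r + k₂ * (S.ε * D) :=
    (mul_le_mul_of_nonneg_right (neg_le_abs _) hc0.le).trans hX
  linarith

theorem integrableOn_dom {f : ℝ × ℝ → ℝ} (hf : ContinuousOn f S.dom) : IntegrableOn f S.dom :=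
  hf.integrableOn_compact S.isCompact_dom

/-- Integral of a combination of the three reference densities. -/
theorem integral_combination_le {c₁ c₂ c₃ : ℝ} (h₁ : 0 ≤ c₁) (h₂ : 0 ≤ c₂) (h₃ : 0 ≤ c₃) :
    ∫ p in S.dom, (c₁ * decay p.2 + c₂ * S.energyDensity p.1 p.2
        + c₃ * (S.ε * S.dissDensity p.1 p.2))
      ≤ c₁ * T + c₂ * (T * (2 * E₀)) + c₃ * ((4 / (γ - 1) ^ 2 + 1) * E₀) := by
  have i1 := (S.integrableOn_dom S.continuousOn_decay_dom).const_mul c₁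
  have i2 := (S.integrableOn_dom S.continuousOn_energyDensity).const_mul c₂
  have i3 := ((S.integrableOn_dom S.continuousOn_dissDensity).const_mul S.ε).const_mul c₃
  rw [integral_add (by exact i1.add i2) i3, integral_add i1 i2, integral_const_mul,
    integral_const_mul, integral_const_mul, integral_const_mul]
  have a1 := mul_le_mul_of_nonneg_left S.integral_decay_dom_le h₁
  have a2 := mul_le_mul_of_nonneg_left S.integral_energyDensity_dom_le h₂
  have a3 := mul_le_mul_of_nonneg_left S.integral_dissDensity_le h₃
  linarith

end ViscousSetup

namespace ViscousSetup

theorem exists_integral_abs_logPhi_le (n : ℕ) {γ : ℝ} (T E₀ W : ℝ) (hγ : 1 < γ) :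
    ∃ C : ℝ, 0 < C ∧ ∀ (S : ViscousSetup n γ T E₀) (ω : ℝ → ℝ), IsCutoff ω W → S.ρbar ≤ 1 →
      ∀ d : ℝ, 0 < d → ∀ t ∈ Icc 0 T,
      -∫ r in Icc S.a S.b, r ^ (n - 1) * logPhi d (S.ρ t r) * ω r ^ 2 ≤ C * √d := by
  obtain ⟨K, hK1, hK⟩ := exists_rpow_le_hBarDelta hγ
  refine ⟨W ^ 2 * (2 + K) * (9 * 2 ^ (n - 1) + 2 * |E₀|) + 1, by positivity, ?_⟩
  intro S ω h hρ1 d hd t ht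
  have hE₀ := abs_of_nonneg S.E₀_nonneg
  have hω := h.continuous
  have c1 := S.continuousOn_slice (f := fun t r => logPhi d (S.ρ t r))
    (S.continuousOn_comp_ρ (continuousOn_logPhi hd)) ht
  have c2 := S.continuousOn_slice S.continuousOn_energyDensity ht
  have c3 := continuousOn_decay (b := S.b) S.ha0.le
  rw [← integral_neg]
  have hmono : ∫ r in Icc S.a S.b, -(r ^ (n - 1) * logPhi d (S.ρ t r) * ω r ^ 2)
      ≤ ∫ r in Icc S.a S.b, W ^ 2 * (2 + K) * √d *
        (9 * 2 ^ (n - 1) * decay r + S.energyDensity t r) := by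
    refine setIntegral_mono_on (ContinuousOn.integrableOn_Icc (by fun_prop))
      (ContinuousOn.integrableOn_Icc (by fun_prop)) measurableSet_Icc fun r hr => ?_
    have h0 := S.ρ_pos ht hr
    have hr0 := S.r_pos hr
    have hE := S.energyDensity_nonneg ht hr
    have hdec := decay_nonneg r
    rcases lt_or_ge r 2 with h2 | h2
    swap
    · rw [h.eq_zero r h2]
      have : 0 ≤ W ^ 2 * (2 + K) * √d *
        (9 * 2 ^ (n - 1) * decay r + S.energyDensity t r) := by positivity
      simpa using this
    have hc := pow_le_decay (k := n - 1) hr0 h2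
    have hh := S.hbar_nonneg ht hr
    have a1 : |logPhi d (S.ρ t r)| ≤ √d * (1 + S.ρ t r) := by
      refine abs_le_of_sq_le_sq ?_ (by positivity)
      rw [mul_pow, sq_sqrt hd.le]
      have := sq_logPhi_le hd h0
      nlinarith [sq_nonneg (1 - S.ρ t r)]
    have a2 : 1 + S.ρ t r ≤ (2 + K) * (1 + S.hbar t r) := by
      have b1 := rpow_le_one_add_rpow h0 (p := 1) (by norm_num) hγ.le
      have b2 : S.ρ t r ^ γ ≤ K * (1 + S.hbar t r) := hK S.δ _ _ S.hδ h0 S.hρbar hρ1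
      rw [rpow_one] at b1
      linarith
    have a3 : -logPhi d (S.ρ t r) ≤ √d * ((2 + K) * (1 + S.hbar t r)) :=
      ((neg_le_abs _).trans a1).trans (by gcongr)
    have a4 : ω r ^ 2 * (-logPhi d (S.ρ t r)) ≤ W ^ 2 * (√d * ((2 + K) * (1 + S.hbar t r))) :=
      mul_le_mul (h.sq_le r) a3 (by linarith [logPhi_nonpos hd h0]) (by positivity)
    have a5 : r ^ (n - 1) * (1 + S.hbar t r)
        ≤ 9 * 2 ^ (n - 1) * decay r + S.energyDensity t r := by
      unfold energyDensity
      have : 0 ≤ S.m t r ^ 2 / S.ρ t r * r ^ (n - 1) := by positivity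
      linarith
    calc -(r ^ (n - 1) * logPhi d (S.ρ t r) * ω r ^ 2)
        = r ^ (n - 1) * (ω r ^ 2 * (-logPhi d (S.ρ t r))) := by ring
      _ ≤ r ^ (n - 1) * (W ^ 2 * (√d * ((2 + K) * (1 + S.hbar t r)))) := by gcongr
      _ = W ^ 2 * (2 + K) * √d * (r ^ (n - 1) * (1 + S.hbar t r)) := by ring
      _ ≤ _ := by gcongr
  refine hmono.trans ?_
  rw [integral_const_mul, integral_add (by
    exact (c3.integrableOn_Icc).const_mul _) c2.integrableOn_Icc, integral_const_mul]
  have b1 := integral_decay_le S.ha0.le S.a_le_b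
  have b2 := S.integral_energyDensity_le ht
  calc _ ≤ W ^ 2 * (2 + K) * √d * (9 * 2 ^ (n - 1) * 1 + 2 * E₀) := by gcongr
    _ ≤ _ := by
      rw [hE₀]
      have := sqrt_nonneg d
      linarith

/-- The logarithmic entropy estimate with a general bound on the cutoff commutator. -/
theorem exists_logPhi_dissipation_le (n : ℕ) {γ : ℝ} (T E₀ W : ℝ) (hγ : 1 < γ) :
    ∃ C : ℝ, 0 < C ∧ ∀ (S : ViscousSetup n γ T E₀) (ω : ℝ → ℝ), IsCutoff ω W → 2 < S.b →
      S.ρbar ≤ 1 → ∀ d k₁ k₂ : ℝ, 0 < d → 0 ≤ k₁ → 0 ≤ k₂ →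
      (∀ t ∈ Icc 0 T, ∀ r ∈ Icc S.a S.b, r < 2 →
        |2 * ω r * deriv ω r * logPhi' d (S.ρ t r) * S.ε * S.ρr t r| * r ^ (n - 1)
        ≤ 1 / 2 * (ω r ^ 2 * (S.ε * (d / (S.ρ t r * (S.ρ t r + d))) * S.ρr t r ^ 2)
          * r ^ (n - 1)) + k₁ * decay r + k₂ * (S.ε * S.dissDensity t r)) →
      ∫ p in S.dom, ω p.2 ^ 2 * (S.ε * (d / (S.ρ p.1 p.2 * (S.ρ p.1 p.2 + d)))
        * S.ρr p.1 p.2 ^ 2) * p.2 ^ (n - 1) ≤ C * (√d + √d / √S.ε + k₁ + k₂) := by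
  obtain ⟨C₁, hC₁, hA⟩ := exists_integral_abs_logPhi_le n T E₀ W hγ
  set Λ : ℝ := 9 * 2 ^ (n - 1) with hΛ
  set KE : ℝ := (4 / (γ - 1) ^ 2 + 1) * |E₀| with hKE
  refine ⟨2 * (|T| + KE + 4 * W ^ 2 * (Λ * |T| + |T| * (2 * |E₀|)) + n * W ^ 2 * (Λ * |T| + KE)
    + C₁), by positivity, ?_⟩
  intro S ω h hb hρ1 d k₁ k₂ hd hk₁ hk₂ hX
  have hE₀ := abs_of_nonneg S.E₀_nonneg
  have hT := abs_of_nonneg S.hT.le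
  have hω := h.continuous
  have hω' := h.continuous_deriv
  have hε := S.hε
  have bal := S.integral_logPhi_balance h hb hd
  have c1 := S.continuousOn_comp_ρ (continuousOn_logPhi hd)
  have c2 := S.continuousOn_comp_ρ (continuousOn_logPhi' hd)
  have c3 := S.continuousOn_comp_ρ (continuousOn_logG hd)
  have c4 := S.continuousOn_ur
  have c5 : ContinuousOn (fun p : ℝ × ℝ => S.m p.1 p.2 / S.ρ p.1 p.2) S.dom :=
    ContinuousOn.div (by fun_prop) (by fun_prop) S.ρ_ne_dom
  have c6 : ContinuousOn (fun p : ℝ × ℝ => S.m p.1 p.2 / S.ρ p.1 p.2 / p.2) S.dom :=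
    ContinuousOn.div (by fun_prop) (by fun_prop) S.r_ne_dom
  have c7 : ContinuousOn (fun p : ℝ × ℝ => d / (S.ρ p.1 p.2 * (S.ρ p.1 p.2 + d))) S.dom :=
    ContinuousOn.div (by fun_prop) (by fun_prop) fun p hp => by
      have := S.ρ_pos_dom hp; positivity
  have hω2 : ContinuousOn (fun p : ℝ × ℝ => ω p.2) S.dom := by fun_prop
  have hω2' : ContinuousOn (fun p : ℝ × ℝ => deriv ω p.2) S.dom := by fun_prop
  have cdec := S.continuousOn_decay_dom
  have cE := S.continuousOn_energyDensity
  have cD := S.continuousOn_dissDensity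
  set s := √d / √S.ε with hs
  have hs0 : 0 ≤ s := by positivity
  have cG : ContinuousOn (fun p : ℝ × ℝ => ω p.2 ^ 2
      * (S.ε * (d / (S.ρ p.1 p.2 * (S.ρ p.1 p.2 + d))) * S.ρr p.1 p.2 ^ 2) * p.2 ^ (n - 1))
      S.dom := by fun_prop
  have hmono : ∫ p in S.dom, _ ≤ ∫ p in S.dom, (-(1 / 2 * (ω p.2 ^ 2
      * (S.ε * (d / (S.ρ p.1 p.2 * (S.ρ p.1 p.2 + d))) * S.ρr p.1 p.2 ^ 2) * p.2 ^ (n - 1)))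
      + ((k₁ + 4 * W ^ 2 * √d * Λ + n * W ^ 2 * s * Λ) * decay p.2
        + (4 * W ^ 2 * √d) * S.energyDensity p.1 p.2
        + (k₂ + n * W ^ 2 * s) * (S.ε * S.dissDensity p.1 p.2))) :=
    setIntegral_mono_on (S.integrableOn_dom (by fun_prop)) (S.integrableOn_dom (by fun_prop))
      S.measurableSet_dom fun p hp =>
        (S.logPhi_balance_le h hd hk₁ hk₂ hp.1 hp.2 (hX _ hp.1 _ hp.2)).trans (le_of_eq (by ring))
  rw [bal, integral_add (S.integrableOn_dom (by fun_prop)) (S.integrableOn_dom (by fun_prop)),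
    integral_neg, integral_const_mul] at hmono
  have hcomb := S.integral_combination_le (c₁ := k₁ + 4 * W ^ 2 * √d * Λ + n * W ^ 2 * s * Λ)
    (c₂ := 4 * W ^ 2 * √d) (c₃ := k₂ + n * W ^ 2 * s) (by positivity) (by positivity)
    (by positivity)
  have t0 : (0 : ℝ) ∈ Icc 0 T := ⟨le_rfl, S.hT.le⟩
  have tT : T ∈ Icc 0 T := ⟨S.hT.le, le_rfl⟩
  have s0 := S.continuousOn_slice (f := fun t r => logPhi d (S.ρ t r)) c1 t0
  have sT := S.continuousOn_slice (f := fun t r => logPhi d (S.ρ t r)) c1 tT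
  rw [integral_sub (ContinuousOn.integrableOn_Icc (by fun_prop))
    (ContinuousOn.integrableOn_Icc (by fun_prop))] at hmono
  have hAT := hA S ω h hρ1 d hd T tT
  have hA0 : ∫ r in Icc S.a S.b, r ^ (n - 1) * logPhi d (S.ρ 0 r) * ω r ^ 2 ≤ 0 := by
    refine setIntegral_nonpos measurableSet_Icc fun r hr => ?_
    have := logPhi_nonpos hd (S.ρ_pos t0 hr)
    have hr0 := S.r_pos hr
    have : 0 ≤ (r ^ (n - 1) * ω r ^ 2) * (-logPhi d (S.ρ 0 r)) :=
      mul_nonneg (by positivity) (by linarith)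
    linarith
  have hKE' : (4 / (γ - 1) ^ 2 + 1) * E₀ = KE := by rw [hKE, hE₀]
  rw [hKE'] at hcomb
  rw [hT, hE₀]
  set X := ∫ p in S.dom, ω p.2 ^ 2 * (S.ε * (d / (S.ρ p.1 p.2 * (S.ρ p.1 p.2 + d)))
        * S.ρr p.1 p.2 ^ 2) * p.2 ^ (n - 1)
  have hTpos := S.hT
  have hKE0 : 0 ≤ KE := by positivity
  have hE00 := S.E₀_nonneg
  have hfin : X ≤ 2 * (k₁ * T + k₂ * KE + 4 * W ^ 2 * √d * (Λ * T + T * (2 * E₀))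
      + n * W ^ 2 * s * (Λ * T + KE) + C₁ * √d) := by
    have e : (k₁ + 4 * W ^ 2 * √d * Λ + n * W ^ 2 * s * Λ) * T
      + 4 * W ^ 2 * √d * (T * (2 * E₀)) + (k₂ + n * W ^ 2 * s) * KE
      = k₁ * T + k₂ * KE + 4 * W ^ 2 * √d * (Λ * T + T * (2 * E₀))
      + n * W ^ 2 * s * (Λ * T + KE) := by ring
    linarith
  refine hfin.trans ?_
  have hd0 := sqrt_nonneg d
  have z1 : 0 ≤ Λ * T + T * (2 * E₀) := by positivity
  have z2 : 0 ≤ Λ * T + KE := by positivity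
  rw [← sub_nonneg]
  have : 0 ≤ T * (√d + s + k₂) + KE * (√d + s + k₁)
      + 4 * W ^ 2 * (Λ * T + T * (2 * E₀)) * (s + k₁ + k₂)
      + n * W ^ 2 * (Λ * T + KE) * (√d + k₁ + k₂) + C₁ * (s + k₁ + k₂) := by positivity
  linarith

theorem commutator_le {ω : ℝ → ℝ} {W : ℝ} (h : IsCutoff ω W) {n : ℕ} {γ T E₀ : ℝ}
    (S : ViscousSetup n γ T E₀) {d : ℝ} (hd : 0 < d) {t r : ℝ} (ht : t ∈ Icc 0 T)
    (hr : r ∈ Icc S.a S.b) (h2 : r < 2) :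
    |2 * ω r * deriv ω r * logPhi' d (S.ρ t r) * S.ε * S.ρr t r| * r ^ (n - 1)
        ≤ 1 / 2 * (ω r ^ 2 * (S.ε * (d / (S.ρ t r * (S.ρ t r + d))) * S.ρr t r ^ 2)
          * r ^ (n - 1)) + (2 * W ^ 2 * (9 * 2 ^ (n - 1)) * (S.ε * d)) * decay r
          + 0 * (S.ε * S.dissDensity t r) := by
  have h0 := S.ρ_pos ht hr
  have hr0 := S.r_pos hr
  have hε := S.hε
  have hc := pow_le_decay (k := n - 1) hr0 h2
  have hp := sq_logPhi'_le hd h0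
  set P := d / (S.ρ t r * (S.ρ t r + d))
  set f := logPhi' d (S.ρ t r)
  have hw : deriv ω r ^ 2 ≤ W ^ 2 :=
    sq_le_sq' (abs_le.1 (h.abs_deriv_le r)).1 (abs_le.1 (h.abs_deriv_le r)).2
  have key : |2 * ω r * deriv ω r * f * S.ρr t r| ≤ 1 / 2 * (ω r ^ 2 * P * S.ρr t r ^ 2)
      + 2 * W ^ 2 * d := by
    have h1 : ω r ^ 2 * S.ρr t r ^ 2 * f ^ 2 ≤ ω r ^ 2 * S.ρr t r ^ 2 * (d * P) := by gcongr
    have h3 : |2 * ω r * deriv ω r * f * S.ρr t r| * (2 * d)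
        ≤ (ω r * S.ρr t r * f) ^ 2 + (2 * d * deriv ω r) ^ 2 := by
      rw [← abs_of_pos (by positivity : 0 < 2 * d), ← abs_mul, abs_of_pos (by positivity : 0 < 2 * d)]
      refine abs_le.2 ⟨?_, ?_⟩
      · nlinarith [sq_nonneg (ω r * S.ρr t r * f + 2 * d * deriv ω r)]
      · nlinarith [sq_nonneg (ω r * S.ρr t r * f - 2 * d * deriv ω r)]
    have h4 : (2 * d) ^ 2 * deriv ω r ^ 2 ≤ (2 * d) ^ 2 * W ^ 2 := by gcongr
    refine le_of_mul_le_mul_right ?_ (by positivity : 0 < 2 * d)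
    nlinarith
  have e : |2 * ω r * deriv ω r * f * S.ε * S.ρr t r| * r ^ (n - 1)
      = |2 * ω r * deriv ω r * f * S.ρr t r| * (S.ε * r ^ (n - 1)) := by
    rw [show 2 * ω r * deriv ω r * f * S.ε * S.ρr t r
      = (2 * ω r * deriv ω r * f * S.ρr t r) * S.ε by ring, abs_mul, abs_of_pos hε]; ring
  rw [e]
  calc _ ≤ (1 / 2 * (ω r ^ 2 * P * S.ρr t r ^ 2) + 2 * W ^ 2 * d) * (S.ε * r ^ (n - 1)) := by
        gcongr
    _ = 1 / 2 * (ω r ^ 2 * (S.ε * P * S.ρr t r ^ 2) * r ^ (n - 1))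
        + 2 * W ^ 2 * (S.ε * d) * r ^ (n - 1) := by ring
    _ ≤ 1 / 2 * (ω r ^ 2 * (S.ε * P * S.ρr t r ^ 2) * r ^ (n - 1))
        + 2 * W ^ 2 * (S.ε * d) * (9 * 2 ^ (n - 1) * decay r) := by gcongr
    _ = _ := by ring

theorem commutator_le_of_rpow {ω : ℝ → ℝ} {W : ℝ} (h : IsCutoff ω W) {n : ℕ} {γ T E₀ K : ℝ}
    (hK0 : 0 < K) (S : ViscousSetup n γ T E₀)
    {d : ℝ} (hd : 0 < d) {t r : ℝ} (ht : t ∈ Icc 0 T)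
    (hK : logPhi' d (S.ρ t r) ^ 2 ≤ K * (d ^ (2 - γ) * S.ρ t r ^ (γ - 2)))
    (hr : r ∈ Icc S.a S.b) (h2 : r < 2) :
    |2 * ω r * deriv ω r * logPhi' d (S.ρ t r) * S.ε * S.ρr t r| * r ^ (n - 1)
        ≤ 1 / 2 * (ω r ^ 2 * (S.ε * (d / (S.ρ t r * (S.ρ t r + d))) * S.ρr t r ^ 2)
          * r ^ (n - 1))
          + (2 * W ^ 2 * √K * (9 * 2 ^ (n - 1)) * (√S.ε * d ^ ((2 - γ) / 2))) * decay r
          + (2 * W ^ 2 * √K * (√S.ε * d ^ ((2 - γ) / 2))) * (S.ε * S.dissDensity t r) := by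
  have h0 := S.ρ_pos ht hr
  have hr0 := S.r_pos hr
  have hε := S.hε
  have hc := pow_le_decay (k := n - 1) hr0 h2
  obtain ⟨D1, -, -⟩ := S.diss_terms_le ht hr
  set f := logPhi' d (S.ρ t r)
  set q := S.ρ t r ^ (γ - 2) * S.ρr t r ^ 2 with hq
  have hq0 : 0 ≤ q := by positivity
  have e1 : √(K * d ^ (2 - γ)) = √K * d ^ ((2 - γ) / 2) := by
    rw [sqrt_mul hK0.le, sqrt_eq_rpow (d ^ (2 - γ)), ← rpow_mul hd.le]
    congr 2; ring
  have key : |f * S.ρr t r| ≤ √K * d ^ ((2 - γ) / 2) / √S.ε * (1 + S.ε * q) := by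
    rw [← e1]
    refine abs_le_of_sq_le_mul (by positivity) hε hq0 ?_
    have := mul_le_mul_of_nonneg_right hK (sq_nonneg (S.ρr t r))
    rw [mul_pow]
    linarith
  have hww : |2 * (ω r * deriv ω r)| ≤ 2 * W ^ 2 := by
    have hW := h.one_le
    rw [abs_mul, abs_mul, abs_two]
    have := mul_le_mul (h.abs_le r) (h.abs_deriv_le r) (abs_nonneg _) (by linarith)
    nlinarith
  have e : |2 * ω r * deriv ω r * f * S.ε * S.ρr t r| * r ^ (n - 1)
      = |2 * (ω r * deriv ω r)| * |f * S.ρr t r| * (S.ε * r ^ (n - 1)) := by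
    rw [show 2 * ω r * deriv ω r * f * S.ε * S.ρr t r
      = (2 * (ω r * deriv ω r)) * (f * S.ρr t r) * S.ε by ring, abs_mul, abs_mul (2 * _),
      abs_of_pos hε]; ring
  have es : S.ε / √S.ε = √S.ε := div_sqrt
  rw [e]
  set B := √K * d ^ ((2 - γ) / 2) with hB
  have hB0 : 0 ≤ B := by positivity
  have hfirst : 0 ≤ 1 / 2 * (ω r ^ 2 * (S.ε * (d / (S.ρ t r * (S.ρ t r + d))) * S.ρr t r ^ 2)
          * r ^ (n - 1)) := by positivity
  calc _ ≤ 2 * W ^ 2 * (B / √S.ε * (1 + S.ε * q)) * (S.ε * r ^ (n - 1)) := by gcongr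
    _ = 2 * W ^ 2 * B * (S.ε / √S.ε) * (r ^ (n - 1) + S.ε * (q * r ^ (n - 1))) := by ring
    _ ≤ 2 * W ^ 2 * B * (S.ε / √S.ε) * (9 * 2 ^ (n - 1) * decay r
          + S.ε * S.dissDensity t r) := by gcongr
    _ ≤ _ := by rw [es, hB]; linarith

end ViscousSetup

/-- Weighted Cauchy–Schwarz bound of an increment. -/
theorem sq_sub_le_integral_mul_integral {f f' w : ℝ → ℝ} {p q : ℝ} (hpq : p ≤ q)
    (hf : ∀ x ∈ Icc p q, HasDerivAt f (f' x) x) (hf' : ContinuousOn f' (Icc p q))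
    (hw : ContinuousOn w (Icc p q)) (hw0 : ∀ x ∈ Icc p q, 0 < w x) :
    (f q - f p) ^ 2 ≤ (∫ x in Icc p q, f' x ^ 2 * w x) * ∫ x in Icc p q, 1 / w x := by
  have h1 : f q - f p = ∫ x in Icc p q, f' x := by
    have := intervalIntegral.integral_eq_sub_of_hasDerivAt_of_le hpq
      (fun x hx => (hf x hx).continuousAt.continuousWithinAt)
      (fun x hx => hf x (Ioo_subset_Icc_self hx)) (hf'.intervalIntegrable_of_Icc hpq)
    rw [← this, intervalIntegral.integral_of_le hpq, integral_Icc_eq_integral_Ioc]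
  have hs : ContinuousOn (fun x => √(w x)) (Icc p q) := hw.sqrt
  have h2 := sq_setIntegral_mul_le (f := fun x => f' x * √(w x)) (g := fun x => 1 / √(w x))
    (hf'.mul hs) (continuousOn_const.div hs fun x hx => (sqrt_pos.2 (hw0 x hx)).ne')
  have e1 : ∫ x in Icc p q, f' x * √(w x) * (1 / √(w x)) = ∫ x in Icc p q, f' x :=
    setIntegral_congr_fun measurableSet_Icc fun x hx => by
      have := sqrt_pos.2 (hw0 x hx)
      field_simp
  have e2 : ∫ x in Icc p q, (f' x * √(w x)) ^ 2 = ∫ x in Icc p q, f' x ^ 2 * w x :=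
    setIntegral_congr_fun measurableSet_Icc fun x hx => by
      simp only [mul_pow, sq_sqrt (hw0 x hx).le]
  have e3 : ∫ x in Icc p q, (1 / √(w x)) ^ 2 = ∫ x in Icc p q, 1 / w x :=
    setIntegral_congr_fun measurableSet_Icc fun x hx => by
      simp only [div_pow, sq_sqrt (hw0 x hx).le, one_pow]
  rw [e1, e2, e3] at h2
  rwa [h1]

theorem setIntegral_Icc_le_of_subset {f : ℝ → ℝ} {a b p q : ℝ} (hf : ContinuousOn f (Icc a b))
    (hf0 : ∀ x ∈ Icc a b, 0 ≤ f x) (hs : Icc p q ⊆ Icc a b) :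
    ∫ x in Icc p q, f x ≤ ∫ x in Icc a b, f x :=
  setIntegral_mono_set hf.integrableOn_Icc
    ((ae_restrict_iff' measurableSet_Icc).2 (Filter.Eventually.of_forall hf0))
    (Filter.Eventually.of_forall hs)

theorem setIntegral_Icc_le_mul {f : ℝ → ℝ} {p q B : ℝ} (hpq : p ≤ q)
    (hf : ContinuousOn f (Icc p q)) (hB : ∀ x ∈ Icc p q, f x ≤ B) :
    ∫ x in Icc p q, f x ≤ (q - p) * B := by
  calc _ ≤ ∫ x in Icc p q, B :=
        setIntegral_mono_on hf.integrableOn_Icc (by simp) measurableSet_Icc hB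
    _ = (q - p) * B := by simp [hpq]

/-- The flux weight. -/
def fluxWeight (n : ℕ) (r : ℝ) : ℝ := r ^ (n - 1) / (1 + r) ^ (2 * n)

/-- The density weight. -/
def densWeight (n : ℕ) (r : ℝ) : ℝ := fluxWeight n r * r ^ (n - 1)

theorem fluxWeight_pos {n : ℕ} {r : ℝ} (hr : 0 < r) : 0 < fluxWeight n r := by
  unfold fluxWeight; positivity

theorem densWeight_pos {n : ℕ} {r : ℝ} (hr : 0 < r) : 0 < densWeight n r :=
  mul_pos (fluxWeight_pos hr) (by positivity)

theorem fluxWeight_le_one {n : ℕ} {r : ℝ} (hr : 0 < r) : fluxWeight n r ≤ 1 := by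
  unfold fluxWeight
  rw [div_le_one (by positivity)]
  calc r ^ (n - 1) ≤ (1 + r) ^ (n - 1) := pow_le_pow_left₀ hr.le (by linarith) _
    _ ≤ (1 + r) ^ (2 * n) := pow_le_pow_right₀ (by linarith) (by omega)

theorem densWeight_le_pow {n : ℕ} {r : ℝ} (hr : 0 < r) : densWeight n r ≤ r ^ (n - 1) := by
  have := mul_le_mul_of_nonneg_right (fluxWeight_le_one (n := n) hr)
    (by positivity : 0 ≤ r ^ (n - 1))
  unfold densWeight; linarith

theorem densWeight_le_decay {n : ℕ} (hn : 2 ≤ n) {r : ℝ} (hr : 0 < r) :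
    densWeight n r ≤ decay r := by
  unfold densWeight fluxWeight decay
  rw [div_mul_eq_mul_div, div_le_div_iff₀ (by positivity) (by positivity), one_mul,
    ← pow_add]
  calc r ^ (n - 1 + (n - 1)) * (1 + r) ^ 2 ≤ (1 + r) ^ (n - 1 + (n - 1)) * (1 + r) ^ 2 := by
        gcongr; linarith
    _ = (1 + r) ^ (2 * n) := by rw [← pow_add]; congr 1; omega

theorem continuousOn_fluxWeight {n : ℕ} : ContinuousOn (fluxWeight n) (Ioi 0) := by
  unfold fluxWeight
  refine ContinuousOn.div (by fun_prop) (by fun_prop) fun r hr => ?_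
  have : 0 < 1 + r := by have : 0 < r := hr
                         linarith
  positivity

theorem continuousOn_densWeight {n : ℕ} : ContinuousOn (densWeight n) (Ioi 0) := by
  unfold densWeight
  have := continuousOn_fluxWeight (n := n)
  fun_prop

/-- The geometric factor entering the pointwise density bound. -/
theorem fluxWeight_mul_le {n : ℕ} (hn : 2 ≤ n) {r : ℝ} (hr : 0 < r) :
    fluxWeight n r * ((r + 2) * (1 + 1 / r ^ (n - 1))) ≤ 4 := by
  have h1 : r ^ (n - 1) ≤ (1 + r) ^ (n - 1) := pow_le_pow_left₀ hr.le (by linarith) _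
  have h2 : (1 : ℝ) ≤ (1 + r) ^ (n - 1) := one_le_pow₀ (by linarith)
  have h3 : (1 + r) ^ (n - 1) * (1 + r) ≤ (1 + r) ^ (2 * n) * 1 := by
    rw [← pow_succ, mul_one]; exact pow_le_pow_right₀ (by linarith) (by omega)
  have e : fluxWeight n r * ((r + 2) * (1 + 1 / r ^ (n - 1)))
      = (r + 2) * (r ^ (n - 1) + 1) / (1 + r) ^ (2 * n) := by
    unfold fluxWeight; field_simp
  rw [e, div_le_iff₀ (by positivity)]
  calc (r + 2) * (r ^ (n - 1) + 1) ≤ (2 * (1 + r)) * (2 * (1 + r) ^ (n - 1)) := by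
        gcongr <;> linarith
    _ = 4 * ((1 + r) ^ (n - 1) * (1 + r)) := by ring
    _ ≤ 4 * (1 + r) ^ (2 * n) := by linarith

namespace ViscousSetup

variable {n : ℕ} {γ T E₀ : ℝ} (S : ViscousSetup n γ T E₀)

/-- Some point of `[1,2]` carries at most the mean energy. -/
theorem exists_hbar_le (hb : 2 < S.b) {t : ℝ} (ht : t ∈ Icc 0 T) :
    ∃ r ∈ Icc (1 : ℝ) 2, S.hbar t r ≤ 2 * E₀ := by
  have hs : Icc (1 : ℝ) 2 ⊆ Icc S.a S.b := Icc_subset_Icc S.ha1.le hb.le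
  have hc : ContinuousOn (fun r => S.energyDensity t r) (Icc S.a S.b) :=
    S.continuousOn_energyDensity.slice_right ht
  obtain ⟨r, hr, hmin⟩ := isCompact_Icc.exists_isMinOn ⟨1, by norm_num⟩ (hc.mono hs)
  refine ⟨r, hr, ?_⟩
  have h1 : S.energyDensity t r ≤ ∫ x in Icc (1 : ℝ) 2, S.energyDensity t x := by
    calc S.energyDensity t r = ∫ x in Icc (1 : ℝ) 2, S.energyDensity t r := by norm_num
      _ ≤ _ := setIntegral_mono_on (by simp) (hc.mono hs).integrableOn_Icc measurableSet_Icc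
          fun x hx => hmin hx
  have h2 := setIntegral_Icc_le_of_subset hc (fun x hx => S.energyDensity_nonneg ht hx) hs
  have h3 := S.integral_energyDensity_le ht
  have h4 : S.hbar t r ≤ S.energyDensity t r := by
    have hp : (1 : ℝ) ≤ r ^ (n - 1) := one_le_pow₀ hr.1
    have h5 := S.hbar_nonneg ht (hs hr)
    have h6 : 0 ≤ S.m t r ^ 2 / S.ρ t r := div_nonneg (sq_nonneg _) (S.ρ_pos ht (hs hr)).le
    unfold energyDensity
    nlinarith [mul_nonneg (add_nonneg h6 h5) (sub_nonneg.2 hp)]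
  linarith

/-- Increments of `ρ^{γ/2}` are controlled by the dissipation. -/
theorem sq_rpow_sub_le {t p q : ℝ} (ht : t ∈ Icc 0 T) (hpq : p ≤ q)
    (hs : Icc p q ⊆ Icc S.a S.b) :
    (S.ρ t q ^ (γ / 2) - S.ρ t p ^ (γ / 2)) ^ 2
      ≤ γ ^ 2 / 4 * (∫ x in Icc S.a S.b, S.dissDensity t x) * ((q - p) * (1 / p ^ (n - 1))) := by
  have hp0 : 0 < p := S.r_pos (hs ⟨le_rfl, hpq⟩)
  have hpos : ∀ x ∈ Icc p q, 0 < x := fun x hx => S.r_pos (hs hx)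
  have hρ : ContinuousOn (fun x => S.ρ t x) (Icc p q) :=
    fun x _ => (S.hasDerivAt_ρ_right t x).continuousAt.continuousWithinAt
  have hρr : ContinuousOn (fun x => S.ρr t x) (Icc p q) :=
    (S.continuous_ρr.comp (Continuous.prodMk_right t)).continuousOn
  have hdc : ContinuousOn (fun x => S.dissDensity t x) (Icc S.a S.b) :=
    S.continuousOn_dissDensity.slice_right ht
  have h := sq_sub_le_integral_mul_integral (f := fun x => S.ρ t x ^ (γ / 2))
    (f' := fun x => S.ρr t x * (γ / 2) * S.ρ t x ^ (γ / 2 - 1)) (w := fun x => x ^ (n - 1)) hpq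
    (fun x hx => (S.hasDerivAt_ρ_right t x).rpow_const (Or.inl (S.ρ_pos ht (hs hx)).ne'))
    ((hρr.mul continuousOn_const).mul
      (hρ.rpow_const fun x hx => Or.inl (S.ρ_pos ht (hs hx)).ne'))
    (by fun_prop) (fun x hx => pow_pos (hpos x hx) _)
  refine h.trans (mul_le_mul ?_ ?_ (setIntegral_nonneg measurableSet_Icc fun x hx => ?_) ?_)
  · calc _ ≤ ∫ x in Icc p q, γ ^ 2 / 4 * S.dissDensity t x := by
          refine setIntegral_mono_on (ContinuousOn.integrableOn_Icc ?_)
            (ContinuousOn.integrableOn_Icc (continuousOn_const.mul (hdc.mono hs)))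
            measurableSet_Icc fun x hx => ?_
          · exact (((hρr.mul continuousOn_const).mul
              (hρ.rpow_const fun x hx => Or.inl (S.ρ_pos ht (hs hx)).ne')).pow 2).mul
              (by fun_prop)
          · have hx0 := S.ρ_pos ht (hs hx)
            have e : (S.ρ t x ^ (γ / 2 - 1)) ^ 2 = S.ρ t x ^ (γ - 2) := by
              rw [← rpow_natCast, ← rpow_mul hx0.le]; congr 1; push_cast; ring
            have h1 : 0 ≤ S.ρ t x * S.ur t x ^ 2 := by positivity
            have h2 : 0 ≤ S.m t x ^ 2 / S.ρ t x / x ^ 2 := by positivity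
            have h3 : 0 ≤ x ^ (n - 1) := pow_nonneg (hpos x hx).le _
            rw [mul_pow, mul_pow, e]
            unfold dissDensity
            nlinarith [mul_nonneg (mul_nonneg (add_nonneg h1 h2) h3) (sq_nonneg γ)]
      _ = γ ^ 2 / 4 * ∫ x in Icc p q, S.dissDensity t x := integral_const_mul _ _
      _ ≤ _ := mul_le_mul_of_nonneg_left (setIntegral_Icc_le_of_subset hdc
          (fun x hx => S.dissDensity_nonneg ht hx) hs) (by positivity)
  · refine setIntegral_Icc_le_mul hpq ?_ fun x hx => ?_
    · exact continuousOn_const.div (by fun_prop) fun x hx => (pow_pos (hpos x hx) _).ne'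
    · exact one_div_le_one_div_of_le (pow_pos hp0 _) (pow_le_pow_left₀ hp0.le hx.1 _)
  · exact (one_div_pos.2 (pow_pos (hpos x hx) _)).le
  · exact mul_nonneg (by positivity)
      (setIntegral_nonneg measurableSet_Icc fun x hx => S.dissDensity_nonneg ht hx)

end ViscousSetup

/-- Weighted pointwise bound of the density by the dissipation of the same time. -/
theorem exists_ρ_mul_fluxWeight_le (n : ℕ) {γ : ℝ} (E₀ : ℝ) (hγ : 1 < γ) :
    ∃ C, 0 < C ∧ ∀ {T : ℝ} (S : ViscousSetup n γ T E₀), 2 < S.b → S.ρbar ≤ 1 →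
      ∀ t ∈ Icc 0 T, ∀ r ∈ Icc S.a S.b,
        S.ρ t r * fluxWeight n r ≤ C * (1 + ∫ x in Icc S.a S.b, S.dissDensity t x) := by
  obtain ⟨K, hK1, hK⟩ := exists_rpow_le_hBarDelta hγ
  refine ⟨1 + 2 * γ ^ 2 + 2 * (K * (1 + 2 * |E₀|)), by positivity, ?_⟩
  intro T S hb hρb t ht r hr
  have hE := S.E₀_nonneg
  rw [abs_of_nonneg hE]
  set D := ∫ x in Icc S.a S.b, S.dissDensity t x with hD
  have hD0 : 0 ≤ D := setIntegral_nonneg measurableSet_Icc fun x hx => S.dissDensity_nonneg ht hx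
  obtain ⟨r₁, hr₁, hh⟩ := S.exists_hbar_le hb ht
  have hr₁' : r₁ ∈ Icc S.a S.b := Icc_subset_Icc S.ha1.le hb.le hr₁
  have hr0 := S.r_pos hr
  have hρ0 := S.ρ_pos ht hr
  have hρ1 := S.ρ_pos ht hr₁'
  have hr10 := S.r_pos hr₁'
  have hK₁ : S.ρ t r₁ ^ γ ≤ K * (1 + 2 * E₀) :=
    (hK S.δ _ _ S.hδ hρ1 S.hρbar hρb).trans
      (mul_le_mul_of_nonneg_left (by unfold ViscousSetup.hbar at hh; linarith) (by linarith))
  have hsq : ∀ x : ℝ, 0 < x → (x ^ (γ / 2)) ^ 2 = x ^ γ := fun x hx => by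
    rw [← rpow_natCast, ← rpow_mul hx.le]; congr 1; push_cast; ring
  have hinc : (S.ρ t r ^ (γ / 2) - S.ρ t r₁ ^ (γ / 2)) ^ 2
      ≤ γ ^ 2 / 4 * D * ((r + 2) * (1 + 1 / r ^ (n - 1))) := by
    have hpw : 0 < 1 / r ^ (n - 1) := by positivity
    have hpw1 : 1 / r₁ ^ (n - 1) ≤ 1 := by
      rw [div_le_one (by positivity)]; exact one_le_pow₀ hr₁.1
    have hpw1' : 0 < 1 / r₁ ^ (n - 1) := by positivity
    rcases le_total r r₁ with h | h
    · have := S.sq_rpow_sub_le ht h (Icc_subset_Icc hr.1 hr₁'.2)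
      rw [← neg_sub, neg_sq]
      refine this.trans (mul_le_mul_of_nonneg_left ?_ (by positivity))
      apply mul_le_mul <;> linarith [hr₁.2]
    · have := S.sq_rpow_sub_le ht h (Icc_subset_Icc hr₁'.1 hr.2)
      refine this.trans (mul_le_mul_of_nonneg_left ?_ (by positivity))
      apply mul_le_mul <;> linarith [hr₁.1]
  have h1 : S.ρ t r ≤ 1 + S.ρ t r ^ γ := by
    simpa using rpow_le_one_add_rpow hρ0 zero_le_one hγ.le
  have h2 : S.ρ t r ^ γ ≤ 2 * (γ ^ 2 / 4 * D * ((r + 2) * (1 + 1 / r ^ (n - 1))))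
      + 2 * (K * (1 + 2 * E₀)) := by
    rw [← hsq _ hρ1] at hK₁
    rw [← hsq _ hρ0]
    nlinarith [sq_nonneg (S.ρ t r ^ (γ / 2) - 2 * S.ρ t r₁ ^ (γ / 2))]
  have hχ := fluxWeight_pos (n := n) hr0
  have hχ1 := fluxWeight_le_one (n := n) hr0
  have hχ4 := fluxWeight_mul_le S.hn hr0
  have hK0 : 0 ≤ K * (1 + 2 * E₀) := by positivity
  calc S.ρ t r * fluxWeight n r
      ≤ (1 + (2 * (γ ^ 2 / 4 * D * ((r + 2) * (1 + 1 / r ^ (n - 1))))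
          + 2 * (K * (1 + 2 * E₀)))) * fluxWeight n r := by
        apply mul_le_mul_of_nonneg_right _ hχ.le; linarith
    _ = (1 + 2 * (K * (1 + 2 * E₀))) * fluxWeight n r + γ ^ 2 / 2 * D *
          (fluxWeight n r * ((r + 2) * (1 + 1 / r ^ (n - 1)))) := by ring
    _ ≤ (1 + 2 * (K * (1 + 2 * E₀))) * 1 + γ ^ 2 / 2 * D * 4 := by
        gcongr
    _ ≤ _ := by
        nlinarith [mul_nonneg hK0 hD0, sq_nonneg γ]

theorem exists_integral_m_sq_le (n : ℕ) {γ : ℝ} (T E₀ : ℝ) (hγ : 1 < γ) :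
    ∃ C, 0 < C ∧ ∀ S : ViscousSetup n γ T E₀, 2 < S.b → S.ρbar ≤ 1 → 1 ≤ S.ε →
      ∫ p in S.dom, S.m p.1 p.2 ^ 2 * densWeight n p.2 ≤ C := by
  obtain ⟨C, hC, hCb⟩ := exists_ρ_mul_fluxWeight_le n E₀ hγ
  refine ⟨2 * |E₀| * C * (|T| + (4 / (γ - 1) ^ 2 + 1) * |E₀|) + 1, by positivity, ?_⟩
  intro S hb hρb hε
  have hE := S.E₀_nonneg
  rw [abs_of_nonneg hE, abs_of_nonneg S.hT.le]
  set D : ℝ → ℝ := fun t => ∫ x in Icc S.a S.b, S.dissDensity t x with hD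
  have hμ : ContinuousOn (fun p : ℝ × ℝ => densWeight n p.2) S.dom :=
    continuousOn_densWeight.comp continuousOn_snd fun p hp => S.r_pos_dom hp
  have hDi : IntegrableOn D (Icc 0 T) := integrableOn_slice_integral S.continuousOn_dissDensity
  have hslice : ∀ t ∈ Icc 0 T, ∫ r in Icc S.a S.b, S.m t r ^ 2 * densWeight n r
      ≤ 2 * E₀ * C * (1 + D t) := by
    intro t ht
    have hD0 : 0 ≤ D t := setIntegral_nonneg measurableSet_Icc fun x hx =>
      S.dissDensity_nonneg ht hx
    calc _ ≤ ∫ r in Icc S.a S.b, C * (1 + D t) * S.energyDensity t r := by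
          refine setIntegral_mono_on ?_ ?_ measurableSet_Icc fun r hr => ?_
          · exact (ContinuousOn.slice_right (f := fun t r => S.m t r ^ 2 * densWeight n r)
              (s := Icc 0 T) (u := Icc S.a S.b) (ContinuousOn.mul (by fun_prop) hμ)
              ht).integrableOn_Icc
          · exact (continuousOn_const.mul
              (S.continuousOn_energyDensity.slice_right ht)).integrableOn_Icc
          · have h0 := S.ρ_pos ht hr
            have h1 := hCb S hb hρb t ht r hr
            have h2 : S.m t r ^ 2 / S.ρ t r * r ^ (n - 1) ≤ S.energyDensity t r := by
              have := mul_nonneg (S.hbar_nonneg ht hr) (pow_nonneg (S.r_pos hr).le (n - 1))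
              unfold ViscousSetup.energyDensity; linarith
            have h3 : 0 ≤ S.m t r ^ 2 / S.ρ t r * r ^ (n - 1) :=
              mul_nonneg (by positivity) (pow_nonneg (S.r_pos hr).le _)
            calc S.m t r ^ 2 * densWeight n r
                = (S.ρ t r * fluxWeight n r) * (S.m t r ^ 2 / S.ρ t r * r ^ (n - 1)) := by
                  unfold densWeight; field_simp
              _ ≤ _ := mul_le_mul h1 h2 h3 (by positivity)
      _ = C * (1 + D t) * ∫ r in Icc S.a S.b, S.energyDensity t r := integral_const_mul _ _
      _ ≤ C * (1 + D t) * (2 * E₀) :=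
          mul_le_mul_of_nonneg_left (S.integral_energyDensity_le ht) (by positivity)
      _ = _ := by ring
  have h1 := setIntegral_rect_le_integral (f := fun t r => S.m t r ^ 2 * densWeight n r)
    (ContinuousOn.mul (by fun_prop) hμ)
    (g := fun t => 2 * E₀ * C * (1 + D t)) ((integrable_const _ |>.add hDi).const_mul _) hslice
  have h2 : ∫ t in Icc 0 T, 2 * E₀ * C * (1 + D t) = 2 * E₀ * C * (T + ∫ p in S.dom,
      S.dissDensity p.1 p.2) := by
    rw [integral_const_mul, integral_add (by simp) hDi, ViscousSetup.dom,
      setIntegral_rect_eq S.continuousOn_dissDensity]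
    simp only [measureReal_restrict_apply_univ, integral_const, smul_eq_mul, mul_one,
      volume_real_Icc_of_le S.hT.le, sub_zero, hD]
  have h3 : ∫ p in S.dom, S.dissDensity p.1 p.2 ≤ (4 / (γ - 1) ^ 2 + 1) * E₀ := by
    have h0 : 0 ≤ ∫ p in S.dom, S.dissDensity p.1 p.2 :=
      setIntegral_nonneg S.measurableSet_dom fun p hp => S.dissDensity_nonneg hp.1 hp.2
    nlinarith [S.integral_dissDensity_le]
  calc _ ≤ 2 * E₀ * C * (T + ∫ p in S.dom, S.dissDensity p.1 p.2) := h2 ▸ h1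
    _ ≤ 2 * E₀ * C * (T + (4 / (γ - 1) ^ 2 + 1) * E₀) := by gcongr
    _ ≤ _ := by linarith

/-- The density is square integrable against the density weight. -/
theorem exists_integral_ρ_sq_le (n : ℕ) {γ : ℝ} (E₀ : ℝ) (hγ : 2 ≤ γ) :
    ∃ C, 0 < C ∧ ∀ {T : ℝ} (S : ViscousSetup n γ T E₀), S.ρbar ≤ 1 → ∀ t ∈ Icc 0 T,
      ∫ r in Icc S.a S.b, (1 + S.ρ t r ^ 2) * densWeight n r ≤ C := by
  obtain ⟨K, hK1, hK⟩ := exists_rpow_le_hBarDelta (show 1 < γ by linarith)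
  refine ⟨2 + K + K * (2 * |E₀|), by positivity, ?_⟩
  intro T S hρb t ht
  rw [abs_of_nonneg S.E₀_nonneg]
  have hs : ∀ r ∈ Icc S.a S.b, r ∈ Ioi (0 : ℝ) := fun r hr => S.r_pos hr
  have hρ : ContinuousOn (fun x => S.ρ t x) (Icc S.a S.b) :=
    fun x _ => (S.hasDerivAt_ρ_right t x).continuousAt.continuousWithinAt
  have hdec := continuousOn_decay S.ha0.le (b := S.b)
  have hen : ContinuousOn (fun x => S.energyDensity t x) (Icc S.a S.b) :=
    S.continuousOn_energyDensity.slice_right ht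
  calc _ ≤ ∫ r in Icc S.a S.b, ((2 + K) * decay r + K * S.energyDensity t r) := by
        refine setIntegral_mono_on ?_ ?_ measurableSet_Icc fun r hr => ?_
        · exact (((continuousOn_const.add (hρ.pow 2))).mul
            (continuousOn_densWeight.mono hs)).integrableOn_Icc
        · exact ((continuousOn_const.mul hdec).add (continuousOn_const.mul hen)).integrableOn_Icc
        · have h0 := S.ρ_pos ht hr
          have h1 : S.ρ t r ^ 2 ≤ 1 + S.ρ t r ^ γ := by
            have := rpow_le_one_add_rpow h0 zero_le_two hγ
            rwa [rpow_two] at this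
          have h2 := hK S.δ _ _ S.hδ h0 S.hρbar hρb
          have h3 : S.hbar t r * r ^ (n - 1) ≤ S.energyDensity t r := by
            have : 0 ≤ S.m t r ^ 2 / S.ρ t r * r ^ (n - 1) :=
              mul_nonneg (by positivity) (pow_nonneg (S.r_pos hr).le _)
            unfold ViscousSetup.energyDensity; linarith
          have h4 := densWeight_le_decay S.hn (S.r_pos hr)
          have h5 := densWeight_le_pow (n := n) (S.r_pos hr)
          have h6 := densWeight_pos (n := n) (S.r_pos hr)
          have h7 := S.hbar_nonneg ht hr
          calc (1 + S.ρ t r ^ 2) * densWeight n r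
              ≤ (2 + K * (1 + S.hbar t r)) * densWeight n r := by
                apply mul_le_mul_of_nonneg_right _ h6.le
                unfold ViscousSetup.hbar; linarith
            _ = (2 + K) * densWeight n r + K * (S.hbar t r * densWeight n r) := by ring
            _ ≤ (2 + K) * decay r + K * (S.hbar t r * r ^ (n - 1)) := by gcongr
            _ ≤ _ := by gcongr
    _ = (2 + K) * (∫ r in Icc S.a S.b, decay r) + K * ∫ r in Icc S.a S.b,
          S.energyDensity t r := by
        rw [integral_add (by exact (continuousOn_const.mul hdec).integrableOn_Icc)
          (by exact (continuousOn_const.mul hen).integrableOn_Icc), integral_const_mul,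
          integral_const_mul]
    _ ≤ (2 + K) * 1 + K * (2 * E₀) := by
        gcongr
        · exact integral_decay_le S.ha0.le S.a_le_b
        · exact S.integral_energyDensity_le ht
    _ = _ := by ring

/-- Differentiation under the integral sign over a compact interval. -/
theorem hasDerivAt_intervalIntegral_param {f f' : ℝ → ℝ → ℝ} {a b : ℝ} (hab : a ≤ b)
    (hf : Continuous fun p : ℝ × ℝ => f p.1 p.2) (hf' : Continuous fun p : ℝ × ℝ => f' p.1 p.2)
    (hd : ∀ t x, HasDerivAt (fun s => f s x) (f' t x) t) (t : ℝ) :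
    HasDerivAt (fun s => ∫ x in a..b, f s x) (∫ x in a..b, f' t x) t := by
  obtain ⟨B, hB⟩ := ((isCompact_Icc (a := t - 1) (b := t + 1)).prod
    (isCompact_Icc (a := a) (b := b))).exists_bound_of_continuousOn hf'.continuousOn
  have sl : ∀ {g : ℝ → ℝ → ℝ}, (Continuous fun p : ℝ × ℝ => g p.1 p.2) → ∀ s,
      Continuous (g s) := fun hg s => hg.comp (Continuous.prodMk_right s)
  refine (intervalIntegral.hasDerivAt_integral_of_dominated_loc_of_deriv_le
    (s := Icc (t - 1) (t + 1)) (bound := fun _ => B) (Icc_mem_nhds (by linarith) (by linarith))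
    (Filter.Eventually.of_forall fun s => (sl hf s).aestronglyMeasurable)
    ((sl hf t).intervalIntegrable _ _) (sl hf' t).aestronglyMeasurable
    (Filter.Eventually.of_forall fun x hx s hs => ?_) (by simp)
    (Filter.Eventually.of_forall fun x _ s _ => hd s x)).2
  rw [uIoc_of_le hab] at hx
  exact hB (s, x) ⟨hs, Ioc_subset_Icc_self hx⟩

/-- The logarithmic derivative exponent of the flux weight: `χ' = -π χ / r`. -/
def fluxExponent (n : ℕ) (r : ℝ) : ℝ := -((n : ℝ) - 1) + 2 * n * r / (1 + r)

theorem hasDerivAt_fluxWeight {n : ℕ} (hn : 1 ≤ n) {r : ℝ} (hr : 0 < r) :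
    HasDerivAt (fluxWeight n) (-(fluxExponent n r * fluxWeight n r / r)) r := by
  have h1 : HasDerivAt (fun x : ℝ => (1 + x) ^ (2 * n))
      (((2 * n : ℕ) : ℝ) * (1 + r) ^ (2 * n - 1) * 1) r :=
    ((hasDerivAt_id r).const_add 1).pow (2 * n)
  have h0 : (1 + r) ^ (2 * n) ≠ 0 := by positivity
  refine ((hasDerivAt_pow_div (k := n - 1) hr.ne').div h1 h0).congr_deriv ?_
  have e : (1 + r) ^ (2 * n) = (1 + r) ^ (2 * n - 1) * (1 + r) := by
    rw [← pow_succ]; congr 1; omega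
  unfold fluxExponent fluxWeight
  rw [Nat.cast_sub hn, e]
  push_cast
  have : (1 + r) ≠ 0 := by positivity
  field_simp
  ring

theorem neg_le_fluxExponent {n : ℕ} {r : ℝ} (hr : 0 < r) : -((n : ℝ) - 1) ≤ fluxExponent n r := by
  have : 0 ≤ 2 * (n : ℝ) * r / (1 + r) := by positivity
  unfold fluxExponent; linarith

theorem fluxExponent_le {n : ℕ} {r : ℝ} (hr : 0 < r) : fluxExponent n r ≤ n + 1 := by
  have : 2 * (n : ℝ) * r / (1 + r) ≤ 2 * n := by
    rw [div_le_iff₀ (by positivity)]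
    nlinarith [Nat.cast_nonneg (α := ℝ) n]
  unfold fluxExponent; linarith

theorem continuousOn_fluxExponent {n : ℕ} : ContinuousOn (fluxExponent n) (Ioi 0) := by
  unfold fluxExponent
  refine continuousOn_const.add (ContinuousOn.div (by fun_prop) (by fun_prop) fun r hr => ?_)
  have : 0 < r := hr
  positivity

namespace ViscousSetup

variable {n : ℕ} {γ T E₀ : ℝ} (S : ViscousSetup n γ T E₀)

/-- `n` times the measure of the shell between the radii `a` and `r`. -/
def shell (r : ℝ) : ℝ := r ^ n - S.a ^ n

/-- The mass excess over the far-field density between the radii `a` and `r`. -/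
def excess (t r : ℝ) : ℝ := ∫ s in S.a..r, (S.ρ t s - S.ρbar) * s ^ (n - 1)

/-- The difference of the density and its mean over the shell between `a` and `r`. -/
def osc (t r : ℝ) : ℝ := (S.shell r * (S.ρ t r - S.ρbar) - n * S.excess t r) / S.shell r

theorem excess_a (t : ℝ) : S.excess t S.a = 0 := by simp [excess]

theorem shell_a : S.shell S.a = 0 := by simp [shell]

theorem osc_a (t : ℝ) : S.osc t S.a = 0 := by simp [osc, shell_a]

theorem continuous_shell : Continuous S.shell := by unfold shell; fun_prop

theorem hasDerivAt_shell (r : ℝ) : HasDerivAt S.shell (n * r ^ (n - 1)) r :=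
  (hasDerivAt_pow n r).sub_const _

theorem continuous_excess : Continuous (fun p : ℝ × ℝ => S.excess p.1 p.2) := by
  unfold excess
  refine intervalIntegral.continuous_parametric_intervalIntegral_of_continuous
    (f := fun (p : ℝ × ℝ) s => (S.ρ p.1 s - S.ρbar) * s ^ (n - 1)) ?_ continuous_snd
  have : Continuous fun q : (ℝ × ℝ) × ℝ => S.ρ q.1.1 q.2 :=
    S.continuous_ρ.comp (f := fun q : (ℝ × ℝ) × ℝ => (q.1.1, q.2)) (by fun_prop)
  simp only [Function.uncurry_def]
  fun_prop

theorem hasDerivAt_excess_right (t r : ℝ) :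
    HasDerivAt (fun y => S.excess t y) ((S.ρ t r - S.ρbar) * r ^ (n - 1)) r := by
  have hc : Continuous fun s => (S.ρ t s - S.ρbar) * s ^ (n - 1) := by
    have : Continuous fun s => S.ρ t s := S.continuous_ρ.comp (Continuous.prodMk_right t)
    fun_prop
  exact (hc.integral_hasStrictDerivAt S.a r).hasDerivAt

theorem flux_eq_integral {t r : ℝ} (ht : t ∈ Ioo 0 T) (hr : r ∈ Icc S.a S.b) :
    S.flux t r = ∫ y in S.a..r, S.ρt t y * y ^ (n - 1) := by
  have e := intervalIntegral.integral_eq_sub_of_hasDerivAt_of_le (f := fun y => S.flux t y)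
    (f' := fun y => S.ρt t y * y ^ (n - 1)) hr.1
    (S.continuous_flux.comp (Continuous.prodMk_right t)).continuousOn
    (fun x hx => (S.hasDerivAt_flux ht ⟨hx.1, hx.2.trans_le hr.2⟩).congr_deriv (mul_comm _ _))
    (Continuous.intervalIntegrable (by
      have : Continuous fun s => S.ρt t s := S.continuous_ρt.comp (Continuous.prodMk_right t)
      fun_prop) _ _)
  rw [e, S.flux_a (Ioo_subset_Icc_self ht), sub_zero]

theorem hasDerivAt_excess_left {t r : ℝ} (ht : t ∈ Ioo 0 T) (hr : r ∈ Icc S.a S.b) :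
    HasDerivAt (fun s => S.excess s r) (S.flux t r) t := by
  rw [S.flux_eq_integral ht hr]
  exact hasDerivAt_intervalIntegral_param
    (f := fun t s => (S.ρ t s - S.ρbar) * s ^ (n - 1)) (f' := fun t s => S.ρt t s * s ^ (n - 1))
    hr.1 (by fun_prop) (by fun_prop)
    (fun t x => ((S.hasDerivAt_ρ_left t x).sub_const _).mul_const _) t

theorem mul_sub_le_shell {r : ℝ} (hr : S.a ≤ r) : S.a ^ (n - 1) * (r - S.a) ≤ S.shell r := by
  have hn := S.hn
  have ha := S.ha0
  have e : ∀ x : ℝ, x ^ n = x ^ (n - 1) * x := fun x => by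
    rw [← pow_succ]; congr 1; omega
  unfold shell
  rw [e r, e S.a, mul_sub]
  have : S.a ^ (n - 1) ≤ r ^ (n - 1) := pow_le_pow_left₀ ha.le hr _
  nlinarith [mul_le_mul_of_nonneg_right this (ha.le.trans hr)]

theorem shell_pos {r : ℝ} (hr : S.a < r) : 0 < S.shell r :=
  lt_of_lt_of_le (mul_pos (pow_pos S.ha0 _) (sub_pos.2 hr)) (S.mul_sub_le_shell hr.le)

theorem shell_nonneg {r : ℝ} (hr : S.a ≤ r) : 0 ≤ S.shell r :=
  (mul_nonneg (pow_pos S.ha0 _).le (sub_nonneg.2 hr)).trans (S.mul_sub_le_shell hr)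

theorem shell_le (r : ℝ) : S.shell r ≤ r ^ n := by
  have := pow_pos S.ha0 n
  unfold shell; linarith

theorem shell_mul_osc {t r : ℝ} (hr : S.a ≤ r) :
    S.shell r * S.osc t r = S.shell r * (S.ρ t r - S.ρbar) - n * S.excess t r := by
  rcases hr.eq_or_lt with rfl | hr
  · simp [shell_a, excess_a]
  · have := (S.shell_pos hr).ne'
    unfold osc; field_simp

theorem hasDerivAt_osc_right {t r : ℝ} (hr : S.a < r) :
    HasDerivAt (fun y => S.osc t y)
      (S.ρr t r - n * r ^ (n - 1) * S.osc t r / S.shell r) r := by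
  have hP := (S.shell_pos hr).ne'
  refine (((S.hasDerivAt_shell r).mul ((S.hasDerivAt_ρ_right t r).sub_const _)).sub
    ((S.hasDerivAt_excess_right t r).const_mul (n : ℝ)) |>.div
    (S.hasDerivAt_shell r) hP).congr_deriv ?_
  simp only [Pi.sub_apply, Pi.mul_apply]
  unfold osc
  field_simp
  ring

theorem hasDerivAt_osc_left {t r : ℝ} (ht : t ∈ Ioo 0 T) (hr : r ∈ Ioc S.a S.b) :
    HasDerivAt (fun s => S.osc s r) (S.ρt t r - n * (S.flux t r / S.shell r)) t := by
  have hP := (S.shell_pos hr.1).ne'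
  refine ((((S.hasDerivAt_ρ_left t r).sub_const S.ρbar).const_mul (S.shell r)).sub
    ((S.hasDerivAt_excess_left ht ⟨hr.1.le, hr.2⟩).const_mul (n : ℝ)) |>.div_const
    (S.shell r)).congr_deriv ?_
  field_simp

/-- A function on the rectangle which is continuous off the inner boundary and vanishes
linearly there is continuous. -/
theorem continuousOn_dom_of_abs_le {f : ℝ × ℝ → ℝ} {L : ℝ}
    (hf : ContinuousOn f (S.dom ∩ {p | S.a < p.2}))
    (hL : ∀ p ∈ S.dom, |f p| ≤ L * (p.2 - S.a)) : ContinuousOn f S.dom := by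
  intro p hp
  have ho : IsOpen {p : ℝ × ℝ | S.a < p.2} := isOpen_lt continuous_const continuous_snd
  rcases hp.2.1.eq_or_lt with h | h
  · have h0 : f p = 0 := by
      have := hL p hp
      rw [← h, sub_self, mul_zero] at this
      exact abs_eq_zero.1 (le_antisymm this (abs_nonneg _))
    rw [ContinuousWithinAt, h0]
    refine squeeze_zero_norm' (a := fun p : ℝ × ℝ => L * (p.2 - S.a)) ?_ ?_
    · filter_upwards [self_mem_nhdsWithin] with q hq using hL q hq
    · have : Filter.Tendsto (fun p : ℝ × ℝ => L * (p.2 - S.a)) (nhds p)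
          (nhds (L * (p.2 - S.a))) := Continuous.tendsto (by fun_prop) p
      rw [← h, sub_self, mul_zero] at this
      exact this.mono_left nhdsWithin_le_nhds
  · exact (hf p ⟨hp, h⟩).mono_of_mem_nhdsWithin
      (Filter.inter_mem self_mem_nhdsWithin (mem_nhdsWithin_of_mem_nhds (ho.mem_nhds h)))

theorem exists_abs_osc_le :
    ∃ L, 0 ≤ L ∧ ∀ p ∈ S.dom, |S.osc p.1 p.2| ≤ L * (p.2 - S.a) := by
  obtain ⟨L, hL⟩ := S.isCompact_dom.exists_bound_of_continuousOn S.continuous_ρr.continuousOn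
  have hL0 : 0 ≤ L := (norm_nonneg _).trans
    (hL (0, S.a) ⟨⟨le_rfl, S.hT.le⟩, ⟨le_rfl, S.a_le_b⟩⟩)
  refine ⟨L, hL0, fun ⟨t, r⟩ ⟨ht, hr⟩ => ?_⟩
  simp only at ht hr ⊢
  rcases hr.1.eq_or_lt with h | h
  · simp [← h, osc_a]
  have hP := S.shell_pos h
  set y : ℝ → ℝ := fun x => S.shell x * (S.ρ t x - S.ρbar) - n * S.excess t x with hy
  have hd : ∀ x ∈ Icc S.a r, HasDerivWithinAt y (S.shell x * S.ρr t x) (Icc S.a r) x := by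
    intro x _
    refine HasDerivAt.hasDerivWithinAt ((((S.hasDerivAt_shell x).mul
      ((S.hasDerivAt_ρ_right t x).sub_const _)).sub
      ((S.hasDerivAt_excess_right t x).const_mul (n : ℝ))).congr_deriv ?_)
    ring
  have hb : ∀ x ∈ Icc S.a r, ‖S.shell x * S.ρr t x‖ ≤ S.shell r * L := by
    intro x hx
    rw [norm_mul, norm_of_nonneg (S.shell_nonneg hx.1)]
    refine mul_le_mul ?_ (hL (t, x) ⟨ht, hx.1, hx.2.trans hr.2⟩) (norm_nonneg _) hP.le
    unfold shell
    have := pow_le_pow_left₀ (S.ha0.le.trans hx.1) hx.2 n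
    linarith
  have key := (convex_Icc S.a r).norm_image_sub_le_of_norm_hasDerivWithin_le hd hb
    (left_mem_Icc.2 h.le) (right_mem_Icc.2 h.le)
  have hya : y S.a = 0 := by simp [hy, shell_a, excess_a]
  rw [hya, sub_zero, norm_eq_abs, norm_eq_abs, abs_of_pos (sub_pos.2 h)] at key
  have e : S.osc t r = y r / S.shell r := rfl
  rw [e, abs_div, abs_of_pos hP, div_le_iff₀ hP]
  linarith

theorem exists_abs_flux_le :
    ∃ L, 0 ≤ L ∧ ∀ p ∈ S.dom, |S.flux p.1 p.2| ≤ L * (p.2 - S.a) := by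
  obtain ⟨L, hL⟩ := S.isCompact_dom.exists_bound_of_continuousOn
    (f := fun p : ℝ × ℝ => p.2 ^ (n - 1) * S.ρt p.1 p.2) (by fun_prop)
  have hL0 : 0 ≤ L := (norm_nonneg _).trans
    (hL (0, S.a) ⟨⟨le_rfl, S.hT.le⟩, ⟨le_rfl, S.a_le_b⟩⟩)
  refine ⟨L, hL0, fun ⟨t, r⟩ ⟨ht, hr⟩ => ?_⟩
  simp only at ht hr ⊢
  have hcl : IsClosed {s | |S.flux s r| ≤ L * (r - S.a)} :=
    isClosed_le ((S.continuous_flux.comp (Continuous.prodMk_left r)).abs) continuous_const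
  refine (closure_minimal (s := Ioo 0 T) (fun s hs => ?_) hcl)
    (by rwa [closure_Ioo S.hT.ne])
  have key := intervalIntegral.norm_integral_le_of_norm_le_const (a := S.a) (b := r)
    (f := fun y => S.ρt s y * y ^ (n - 1)) (C := L) fun x hx => by
      rw [uIoc_of_le hr.1] at hx
      rw [mul_comm]
      exact hL (s, x) ⟨Ioo_subset_Icc_self hs, hx.1.le, hx.2.trans hr.2⟩
  rwa [← S.flux_eq_integral hs hr, abs_of_nonneg (sub_nonneg.2 hr.1)] at key

end ViscousSetup

namespace ViscousSetup

variable {n : ℕ} {γ T E₀ : ℝ} (S : ViscousSetup n γ T E₀)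

theorem continuousOn_fluxWeight_dom : ContinuousOn (fun p : ℝ × ℝ => fluxWeight n p.2) S.dom :=
  continuousOn_fluxWeight.comp continuousOn_snd fun _ hp => S.r_pos_dom hp

theorem continuousOn_densWeight_dom : ContinuousOn (fun p : ℝ × ℝ => densWeight n p.2) S.dom :=
  continuousOn_densWeight.comp continuousOn_snd fun _ hp => S.r_pos_dom hp

theorem continuousOn_fluxExponent_dom :
    ContinuousOn (fun p : ℝ × ℝ => fluxExponent n p.2) S.dom :=
  continuousOn_fluxExponent.comp continuousOn_snd fun _ hp => S.r_pos_dom hp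

theorem continuousOn_osc_inner :
    ContinuousOn (fun p : ℝ × ℝ => S.osc p.1 p.2) (S.dom ∩ {p | S.a < p.2}) := by
  have h1 := S.continuous_excess
  have h2 : Continuous fun p : ℝ × ℝ => S.shell p.2 := S.continuous_shell.comp continuous_snd
  unfold osc
  exact ContinuousOn.div (by fun_prop) h2.continuousOn fun p hp => (S.shell_pos hp.2).ne'

theorem continuousOn_osc : ContinuousOn (fun p : ℝ × ℝ => S.osc p.1 p.2) S.dom := by
  obtain ⟨L, -, hL⟩ := S.exists_abs_osc_le
  exact S.continuousOn_dom_of_abs_le S.continuousOn_osc_inner hL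

theorem continuousOn_osc_mul_flux_div :
    ContinuousOn (fun p : ℝ × ℝ => S.osc p.1 p.2 * (S.flux p.1 p.2 / S.shell p.2)) S.dom := by
  obtain ⟨L, hL0, hL⟩ := S.exists_abs_osc_le
  obtain ⟨L', hL'0, hL'⟩ := S.exists_abs_flux_le
  have hP : Continuous fun p : ℝ × ℝ => S.shell p.2 := S.continuous_shell.comp continuous_snd
  refine S.continuousOn_dom_of_abs_le (L := L * (L' / S.a ^ (n - 1)))
    (S.continuousOn_osc_inner.mul (ContinuousOn.div (by fun_prop) hP.continuousOn
      fun p hp => (S.shell_pos hp.2).ne')) fun p hp => ?_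
  have ha := pow_pos S.ha0 (n - 1)
  have hr := sub_nonneg.2 hp.2.1
  have h1 : |S.flux p.1 p.2 / S.shell p.2| ≤ L' / S.a ^ (n - 1) := by
    rw [abs_div, abs_of_nonneg (S.shell_nonneg hp.2.1)]
    rcases hp.2.1.eq_or_lt with h | h
    · rw [← h, shell_a, div_zero]; positivity
    rw [div_le_div_iff₀ (S.shell_pos h) ha]
    calc |S.flux p.1 p.2| * S.a ^ (n - 1) ≤ L' * (p.2 - S.a) * S.a ^ (n - 1) := by
          gcongr; exact hL' p hp
      _ = L' * (S.a ^ (n - 1) * (p.2 - S.a)) := by ring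
      _ ≤ _ := by gcongr; exact S.mul_sub_le_shell hp.2.1
  rw [abs_mul]
  calc _ ≤ L * (p.2 - S.a) * (L' / S.a ^ (n - 1)) := by gcongr; exact hL p hp
    _ = _ := by ring

/-- The functional whose dissipation controls the density gradient. -/
def oscEnergy (t : ℝ) : ℝ :=
  (∫ r in Icc S.a S.b, 1 / 2 * S.osc t r ^ 2 * densWeight n r)
    + n / 2 * fluxWeight n S.b * S.excess t S.b ^ 2 / S.shell S.b

theorem a_lt_b : S.a < S.b := S.ha1.trans S.hb

theorem b_mem : S.b ∈ Icc S.a S.b := ⟨S.a_le_b, le_rfl⟩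

theorem oscEnergy_nonneg (t : ℝ) : 0 ≤ S.oscEnergy t := by
  have h1 : 0 < S.shell S.b := S.shell_pos S.a_lt_b
  have h2 := fluxWeight_pos (n := n) (S.r_pos S.b_mem)
  refine add_nonneg (setIntegral_nonneg measurableSet_Icc fun r hr => ?_) (by positivity)
  have := densWeight_pos (n := n) (S.r_pos hr)
  positivity

theorem osc_b {t : ℝ} (ht : t ∈ Icc 0 T) :
    S.osc t S.b = -(n * S.excess t S.b) / S.shell S.b := by
  unfold osc; rw [S.bc_ρb t ht]; ring_nf

theorem integral_excess_mul_flux :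
    ∫ t in Icc 0 T, S.excess t S.b * S.flux t S.b
      = 1 / 2 * S.excess T S.b ^ 2 - 1 / 2 * S.excess 0 S.b ^ 2 := by
  have c1 : Continuous fun t => S.excess t S.b :=
    S.continuous_excess.comp (Continuous.prodMk_left S.b)
  have c2 : Continuous fun t => S.flux t S.b :=
    S.continuous_flux.comp (Continuous.prodMk_left S.b)
  have := intervalIntegral.integral_eq_sub_of_hasDerivAt_of_le
    (f := fun t => 1 / 2 * S.excess t S.b ^ 2)
    (f' := fun t => S.excess t S.b * S.flux t S.b) S.hT.le (by fun_prop)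
    (fun t ht => (((S.hasDerivAt_excess_left ht S.b_mem).pow 2).const_mul
      (1 / 2 : ℝ)).congr_deriv (by push_cast; ring))
    (Continuous.intervalIntegrable (by fun_prop) _ _)
  rw [intervalIntegral.integral_of_le S.hT.le, ← integral_Icc_eq_integral_Ioc] at this
  exact this

/-- The balance of the oscillation functional. -/
theorem integral_osc_balance :
    ∫ p in S.dom, (S.ρr p.1 p.2 - fluxExponent n p.2 * (S.osc p.1 p.2 / p.2))
        * (S.ε * S.ρr p.1 p.2 - S.m p.1 p.2) * densWeight n p.2
      = S.oscEnergy 0 - S.oscEnergy T := by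
  have c1 := S.continuousOn_osc
  have c2 := S.continuousOn_osc_mul_flux_div
  have c3 := S.continuousOn_fluxWeight_dom
  have c4 := S.continuousOn_densWeight_dom
  have c5 := S.continuousOn_fluxExponent_dom
  have c6 : ContinuousOn (fun p : ℝ × ℝ => fluxExponent n p.2 * fluxWeight n p.2 / p.2) S.dom :=
    (c5.mul c3).div continuousOn_snd S.r_ne_dom
  have c7 : ContinuousOn (fun p : ℝ × ℝ => S.ρr p.1 p.2) S.dom := S.continuous_ρr.continuousOn
  have c8 : ContinuousOn (fun p : ℝ × ℝ => S.ρt p.1 p.2) S.dom := S.continuous_ρt.continuousOn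
  have c9 : ContinuousOn (fun p : ℝ × ℝ => S.flux p.1 p.2) S.dom := S.continuous_flux.continuousOn
  have hn1 : 1 ≤ n := by have := S.hn; omega
  have hg := S.green (A := fun t r => 1 / 2 * S.osc t r ^ 2 * densWeight n r)
    (A' := fun t r => S.osc t r * densWeight n r * S.ρt t r
      - n * densWeight n r * (S.osc t r * (S.flux t r / S.shell r)))
    (J := fun t r => S.osc t r * fluxWeight n r * S.flux t r)
    (J' := fun t r => S.ρr t r * fluxWeight n r * S.flux t r
      - n * densWeight n r * (S.osc t r * (S.flux t r / S.shell r))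
      - S.osc t r * (fluxExponent n r * fluxWeight n r / r) * S.flux t r
      + S.osc t r * densWeight n r * S.ρt t r)
    ((continuousOn_const.mul (c1.pow 2)).mul c4)
    (((c1.mul c4).mul c8).sub ((continuousOn_const.mul c4).mul c2))
    ((c1.mul c3).mul c9)
    (((((c7.mul c3).mul c9).sub ((continuousOn_const.mul c4).mul c2)).sub
      ((c1.mul c6).mul c9)).add ((c1.mul c4).mul c8))
    (fun t ht r hr => ((((S.hasDerivAt_osc_left ht ⟨hr.1, hr.2.le⟩).pow 2).const_mul
      (1 / 2 : ℝ)).mul_const (densWeight n r)).congr_deriv (by push_cast; ring))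
    (fun t ht r hr => by
      refine (((S.hasDerivAt_osc_right hr.1).mul (hasDerivAt_fluxWeight hn1
        (S.ha0.trans hr.1))).mul (S.hasDerivAt_flux ht hr)).congr_deriv ?_
      simp only [Pi.mul_apply]
      unfold densWeight
      ring)
  have e1 : ∫ p in S.dom, (S.ρr p.1 p.2 - fluxExponent n p.2 * (S.osc p.1 p.2 / p.2))
        * (S.ε * S.ρr p.1 p.2 - S.m p.1 p.2) * densWeight n p.2
      = -∫ p in S.dom, ((S.osc p.1 p.2 * densWeight n p.2 * S.ρt p.1 p.2
      - n * densWeight n p.2 * (S.osc p.1 p.2 * (S.flux p.1 p.2 / S.shell p.2)))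
      - (S.ρr p.1 p.2 * fluxWeight n p.2 * S.flux p.1 p.2
      - n * densWeight n p.2 * (S.osc p.1 p.2 * (S.flux p.1 p.2 / S.shell p.2))
      - S.osc p.1 p.2 * (fluxExponent n p.2 * fluxWeight n p.2 / p.2) * S.flux p.1 p.2
      + S.osc p.1 p.2 * densWeight n p.2 * S.ρt p.1 p.2)) := by
    rw [← integral_neg]
    congr 1
    ext p
    simp only [flux, densWeight]
    ring
  have hA : ∀ t ∈ Icc 0 T, IntegrableOn (fun r => 1 / 2 * S.osc t r ^ 2 * densWeight n r)
      (Icc S.a S.b) := fun t ht =>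
    (ContinuousOn.slice_right (f := fun t r => 1 / 2 * S.osc t r ^ 2 * densWeight n r)
      (s := Icc 0 T) (u := Icc S.a S.b) ((continuousOn_const.mul (c1.pow 2)).mul c4)
      ht).integrableOn_Icc
  have e2 : ∫ t in Icc 0 T, (S.osc t S.b * fluxWeight n S.b * S.flux t S.b
        - S.osc t S.a * fluxWeight n S.a * S.flux t S.a)
      = -(n * fluxWeight n S.b / S.shell S.b) *
        ∫ t in Icc 0 T, S.excess t S.b * S.flux t S.b := by
    rw [← integral_const_mul]
    refine setIntegral_congr_fun measurableSet_Icc fun t ht => ?_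
    simp only [S.osc_b ht, osc_a]
    ring
  rw [e1, hg, e2, S.integral_excess_mul_flux,
    integral_sub (hA T ⟨S.hT.le, le_rfl⟩) (hA 0 ⟨le_rfl, S.hT.le⟩)]
  unfold oscEnergy
  ring

/-- A Hardy inequality on time slices. -/
theorem integral_hardy_nonneg {t : ℝ} (ht : t ∈ Icc 0 T) :
    0 ≤ ∫ r in Icc S.a S.b, (S.ρr t r * (S.osc t r / r)
      - 1 / 2 * (n + 2 + fluxExponent n r) * (S.osc t r / r) ^ 2) * densWeight n r := by
  have hn1 : 1 ≤ n := by have := S.hn; omega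
  have hpos : ∀ r ∈ Icc S.a S.b, r ∈ Ioi (0 : ℝ) := fun r hr => S.r_pos hr
  have c1 : ContinuousOn (fun r => S.osc t r) (Icc S.a S.b) :=
    S.continuousOn_osc.slice_right ht
  have c2 : ContinuousOn (fun r => S.ρr t r) (Icc S.a S.b) :=
    (S.continuous_ρr.comp (Continuous.prodMk_right t)).continuousOn
  have c3 : ContinuousOn (densWeight n) (Icc S.a S.b) := continuousOn_densWeight.mono hpos
  have c4 : ContinuousOn (fluxExponent n) (Icc S.a S.b) := continuousOn_fluxExponent.mono hpos
  have c5 : ContinuousOn (fun r => S.osc t r / r) (Icc S.a S.b) :=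
    c1.div continuousOn_id fun r hr => (S.r_pos hr).ne'
  have c6 : ContinuousOn (fun r => 1 / 2 * S.osc t r ^ 2 * (densWeight n r / r)) (Icc S.a S.b) :=
    (continuousOn_const.mul (c1.pow 2)).mul (c3.div continuousOn_id fun r hr => (S.r_pos hr).ne')
  have key := intervalIntegral.sub_le_integral_of_hasDeriv_right_of_le (a := S.a) (b := S.b)
    (g := fun r => 1 / 2 * S.osc t r ^ 2 * (densWeight n r / r))
    (g' := fun r => densWeight n r * (S.ρr t r * (S.osc t r / r)
      - n * (r ^ n / S.shell r) * (S.osc t r / r) ^ 2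
      + 1 / 2 * (n - 2 - fluxExponent n r) * (S.osc t r / r) ^ 2))
    (φ := fun r => (S.ρr t r * (S.osc t r / r)
      - 1 / 2 * (n + 2 + fluxExponent n r) * (S.osc t r / r) ^ 2) * densWeight n r) S.a_le_b c6
    (fun r hr => ?_)
    (((c2.mul c5).sub (((continuousOn_const.mul (continuousOn_const.add c4))).mul
      (c5.pow 2))).mul c3).integrableOn_Icc (fun r hr => ?_)
  · rw [intervalIntegral.integral_of_le S.a_le_b, ← integral_Icc_eq_integral_Ioc] at key
    have hb : 0 ≤ 1 / 2 * S.osc t S.b ^ 2 * (densWeight n S.b / S.b) := by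
      have h1 := S.r_pos S.b_mem
      have h2 := densWeight_pos (n := n) h1
      positivity
    simp only [osc_a] at key
    linarith
  · have hr0 : 0 < r := S.ha0.trans hr.1
    have hP := S.shell_pos hr.1
    have e : r ^ n = r ^ (n - 1) * r := by rw [← pow_succ]; congr 1; omega
    refine HasDerivAt.hasDerivWithinAt (((((S.hasDerivAt_osc_right hr.1).pow 2).const_mul
      (1 / 2 : ℝ)).mul (((hasDerivAt_fluxWeight hn1 hr0).mul
      (hasDerivAt_pow_div (k := n - 1) hr0.ne')).div (hasDerivAt_id r)
      hr0.ne')).congr_deriv ?_)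
    simp only [Pi.mul_apply, Pi.div_apply, Pi.pow_apply, id]
    unfold densWeight
    rw [e, Nat.cast_sub hn1]
    push_cast
    field_simp
    ring
  · have hr0 : 0 < r := S.ha0.trans hr.1
    have hP := S.shell_pos hr.1
    have h1 : 1 ≤ r ^ n / S.shell r := by rw [one_le_div hP]; exact S.shell_le r
    have h2 : (n : ℝ) * (S.osc t r / r) ^ 2
        ≤ n * (r ^ n / S.shell r) * (S.osc t r / r) ^ 2 :=
      mul_le_mul_of_nonneg_right (by nlinarith [Nat.cast_nonneg (α := ℝ) n]) (sq_nonneg _)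
    rw [mul_comm (densWeight n r)]
    apply mul_le_mul_of_nonneg_right _ (densWeight_pos hr0).le
    linarith

end ViscousSetup

theorem sub_mul_sub_add_hardy_le {A q x z y : ℝ} (hA : 4 ≤ A) (h1 : 3 ≤ A + q) (h2 : q ≤ A - 1) :
    -((x - q * z) * (x - y)) + A * (x * z - 1 / 2 * (A + q) * z ^ 2)
      ≤ -(x ^ 2 / (4 * A)) + 5 * A * y ^ 2 := by
  obtain ⟨w, rfl⟩ : ∃ w, z = w + x / A := ⟨z - x / A, by ring⟩
  have hA0 : 0 < A := by linarith
  have hB : 0 < A + q := by linarith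
  have e : -((x - q * (w + x / A)) * (x - y))
      + A * (x * (w + x / A) - 1 / 2 * (A + q) * (w + x / A) ^ 2)
      = (A - q) / A * (-(1 / 2) * x ^ 2 + x * y) + (-(1 / 2) * (A * (A + q)) * w ^ 2
        - q * w * y) := by
    field_simp; ring
  have hβ : 1 / A ≤ (A - q) / A := by gcongr; linarith
  have hβ2 : (A - q) / A ≤ 2 := by rw [div_le_iff₀ hA0]; linarith
  have i1 : (A - q) / A * (-(1 / 2) * x ^ 2 + x * y) ≤ -(x ^ 2 / (4 * A)) + 2 * y ^ 2 := by
    have h0 : 0 < 1 / A := by positivity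
    have h3 : -(1 / 2) * x ^ 2 + x * y ≤ -(1 / 4) * x ^ 2 + y ^ 2 := by
      nlinarith [sq_nonneg (x - 2 * y)]
    have h4 := mul_le_mul_of_nonneg_left h3 (h0.le.trans hβ)
    have h5 : (1 / A) * x ^ 2 ≤ (A - q) / A * x ^ 2 := by gcongr
    have h6 : (A - q) / A * y ^ 2 ≤ 2 * y ^ 2 := by gcongr
    have h7 : x ^ 2 / (4 * A) = 1 / 4 * ((1 / A) * x ^ 2) := by field_simp
    rw [h7]; linarith
  have i2 : -(1 / 2) * (A * (A + q)) * w ^ 2 - q * w * y ≤ A * y ^ 2 := by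
    have hq : q ^ 2 ≤ A ^ 2 := sq_le_sq' (by linarith) (by linarith)
    have h3 : -(q * w * y) ≤ 1 / 4 * (w ^ 2 * q ^ 2 / A) + A * y ^ 2 := by
      have := sq_nonneg (w * q / 2 + A * y)
      have h4 : 1 / 4 * (w ^ 2 * q ^ 2 / A) + A * y ^ 2 + q * w * y
          = (w * q / 2 + A * y) ^ 2 / A := by field_simp; ring
      have h5 : 0 ≤ (w * q / 2 + A * y) ^ 2 / A := by positivity
      linarith
    have h6 : w ^ 2 * q ^ 2 / A ≤ w ^ 2 * A := by
      rw [div_le_iff₀ hA0]; nlinarith [sq_nonneg w]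
    have h7 : A * 3 * w ^ 2 ≤ A * (A + q) * w ^ 2 := by gcongr
    nlinarith [mul_nonneg hA0.le (sq_nonneg w)]
  rw [e]
  nlinarith [mul_nonneg (sub_nonneg.2 hA) (sq_nonneg y)]

namespace ViscousSetup

variable {n : ℕ} {γ T E₀ : ℝ} (S : ViscousSetup n γ T E₀)

/-- Weighted gradient bound by the initial oscillation and the momentum. -/
theorem integral_ρr_sq_le_oscEnergy :
    S.ε / (4 * (n + 2)) * ∫ p in S.dom, S.ρr p.1 p.2 ^ 2 * densWeight n p.2
      ≤ S.oscEnergy 0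
        + 5 * (n + 2) / S.ε * ∫ p in S.dom, S.m p.1 p.2 ^ 2 * densWeight n p.2 := by
  have hn : (2 : ℝ) ≤ n := by exact_mod_cast S.hn
  have hε := S.hε
  have c1 := S.continuousOn_osc
  have c4 := S.continuousOn_densWeight_dom
  have c5 := S.continuousOn_fluxExponent_dom
  have c6 : ContinuousOn (fun p : ℝ × ℝ => S.osc p.1 p.2 / p.2) S.dom :=
    c1.div continuousOn_snd S.r_ne_dom
  have c7 : ContinuousOn (fun p : ℝ × ℝ => S.ρr p.1 p.2) S.dom := S.continuous_ρr.continuousOn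
  have c8 : ContinuousOn (fun p : ℝ × ℝ => S.m p.1 p.2) S.dom := S.continuous_m.continuousOn
  have cH : ContinuousOn (fun p : ℝ × ℝ => (S.ρr p.1 p.2 * (S.osc p.1 p.2 / p.2)
      - 1 / 2 * (n + 2 + fluxExponent n p.2) * (S.osc p.1 p.2 / p.2) ^ 2) * densWeight n p.2)
      S.dom :=
    ((c7.mul c6).sub (((continuousOn_const.mul (continuousOn_const.add c5))).mul
      (c6.pow 2))).mul c4
  have cI : ContinuousOn (fun p : ℝ × ℝ => (S.ρr p.1 p.2 - fluxExponent n p.2 *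
      (S.osc p.1 p.2 / p.2)) * (S.ε * S.ρr p.1 p.2 - S.m p.1 p.2) * densWeight n p.2) S.dom :=
    ((c7.sub (c5.mul c6)).mul ((continuousOn_const.mul c7).sub c8)).mul c4
  have hH : 0 ≤ ∫ p in S.dom, (S.ρr p.1 p.2 * (S.osc p.1 p.2 / p.2)
      - 1 / 2 * (n + 2 + fluxExponent n p.2) * (S.osc p.1 p.2 / p.2) ^ 2) * densWeight n p.2 := by
    have := setIntegral_rect_eq (f := fun t r => (S.ρr t r * (S.osc t r / r)
      - 1 / 2 * (n + 2 + fluxExponent n r) * (S.osc t r / r) ^ 2) * densWeight n r) cH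
    rw [dom, this]
    exact setIntegral_nonneg measurableSet_Icc fun t ht => S.integral_hardy_nonneg ht
  have hI := S.integral_osc_balance
  have h0 := S.oscEnergy_nonneg T
  have i1 := S.integrableOn_dom (f := fun p => S.ρr p.1 p.2 ^ 2 * densWeight n p.2)
    ((c7.pow 2).mul c4)
  have i2 := S.integrableOn_dom (f := fun p => S.m p.1 p.2 ^ 2 * densWeight n p.2)
    ((c8.pow 2).mul c4)
  have i3 := S.integrableOn_dom cI
  have i4 := S.integrableOn_dom cH
  have key : ∫ p in S.dom, S.ε / (4 * (n + 2)) * (S.ρr p.1 p.2 ^ 2 * densWeight n p.2)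
      ≤ ∫ p in S.dom, ((S.ρr p.1 p.2 - fluxExponent n p.2 * (S.osc p.1 p.2 / p.2))
        * (S.ε * S.ρr p.1 p.2 - S.m p.1 p.2) * densWeight n p.2
        + 5 * (n + 2) / S.ε * (S.m p.1 p.2 ^ 2 * densWeight n p.2)
        - S.ε * (n + 2) * ((S.ρr p.1 p.2 * (S.osc p.1 p.2 / p.2)
      - 1 / 2 * (n + 2 + fluxExponent n p.2) * (S.osc p.1 p.2 / p.2) ^ 2)
        * densWeight n p.2)) := by
    refine setIntegral_mono_on (i1.const_mul _) ((i3.add (i2.const_mul _)).sub (i4.const_mul _))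
      S.measurableSet_dom fun p hp => ?_
    have hr := S.r_pos_dom hp
    have hμ := densWeight_pos (n := n) hr
    have h := sub_mul_sub_add_hardy_le (A := (n : ℝ) + 2) (q := fluxExponent n p.2)
      (x := S.ρr p.1 p.2) (z := S.osc p.1 p.2 / p.2) (y := S.m p.1 p.2 / S.ε) (by linarith)
      (by linarith [neg_le_fluxExponent (n := n) hr]) (by linarith [fluxExponent_le (n := n) hr])
    have h' := mul_le_mul_of_nonneg_left h (mul_nonneg hε.le hμ.le)
    have e : S.ε * densWeight n p.2 * (-((S.ρr p.1 p.2 - fluxExponent n p.2 *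
        (S.osc p.1 p.2 / p.2)) * (S.ρr p.1 p.2 - S.m p.1 p.2 / S.ε))
        + (n + 2) * (S.ρr p.1 p.2 * (S.osc p.1 p.2 / p.2)
        - 1 / 2 * (n + 2 + fluxExponent n p.2) * (S.osc p.1 p.2 / p.2) ^ 2))
        = -((S.ρr p.1 p.2 - fluxExponent n p.2 * (S.osc p.1 p.2 / p.2))
        * (S.ε * S.ρr p.1 p.2 - S.m p.1 p.2) * densWeight n p.2)
        + S.ε * (n + 2) * ((S.ρr p.1 p.2 * (S.osc p.1 p.2 / p.2)
      - 1 / 2 * (n + 2 + fluxExponent n p.2) * (S.osc p.1 p.2 / p.2) ^ 2)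
        * densWeight n p.2) := by
      have : S.ρr p.1 p.2 - S.m p.1 p.2 / S.ε = (S.ε * S.ρr p.1 p.2 - S.m p.1 p.2) / S.ε := by
        field_simp
      rw [this]; field_simp
    have e' : S.ε * densWeight n p.2 * (-(S.ρr p.1 p.2 ^ 2 / (4 * (n + 2)))
        + 5 * (n + 2) * (S.m p.1 p.2 / S.ε) ^ 2)
        = -(S.ε / (4 * (n + 2)) * (S.ρr p.1 p.2 ^ 2 * densWeight n p.2))
        + 5 * (n + 2) / S.ε * (S.m p.1 p.2 ^ 2 * densWeight n p.2) := by
      field_simp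
    rw [e, e'] at h'
    linarith
  rw [integral_const_mul, integral_sub (by exact i3.add (i2.const_mul _)) (i4.const_mul _),
    integral_add i3 (i2.const_mul _), integral_const_mul, integral_const_mul, hI] at key
  have : 0 ≤ S.ε * (n + 2) := by positivity
  nlinarith [mul_nonneg this hH]

end ViscousSetup

namespace ViscousSetup

variable {n : ℕ} {γ T E₀ : ℝ} (S : ViscousSetup n γ T E₀)

theorem excess_sq_div_eq {t r : ℝ} (hr : S.a ≤ r) :
    n * S.excess t r = S.shell r * (S.ρ t r - S.ρbar - S.osc t r) := by
  linarith [S.shell_mul_osc (t := t) hr]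

theorem osc_balance_integrand_le {n κ v ζ : ℝ} (hn : 1 ≤ n) (hκ : -(n - 1) / n ≤ κ) :
    1 / 2 * ζ ^ 2 + (n + 1) * ((v - ζ) * ζ + 1 / 2 * (1 - κ) * (v - ζ) ^ 2)
      ≤ (1 + n ^ 3) * v ^ 2 := by
  obtain ⟨q, rfl⟩ : ∃ q, ζ = v - q := ⟨v - ζ, by ring⟩
  have hn0 : 0 < n := by linarith
  have h1 : -(n + 1) * κ ≤ n - 1 / n := by
    have : (n + 1) * (-(n - 1) / n) ≤ (n + 1) * κ := by gcongr
    have e : (n + 1) * (-(n - 1) / n) = -(n - 1 / n) := by field_simp; ring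
    linarith
  have h2 : n * q * v ≤ 1 / (2 * n) * q ^ 2 + n ^ 3 / 2 * v ^ 2 := by
    have e : 1 / (2 * n) * q ^ 2 + n ^ 3 / 2 * v ^ 2 - n * q * v
        = (q - n ^ 2 * v) ^ 2 / (2 * n) := by field_simp; ring
    have : 0 ≤ (q - n ^ 2 * v) ^ 2 / (2 * n) := by positivity
    linarith
  have h3 := mul_le_mul_of_nonneg_right h1 (sq_nonneg q)
  have e : 1 / (2 * n) = 1 / 2 * (1 / n) := by field_simp
  rw [e] at h2
  have h4 : 0 ≤ n ^ 3 * v ^ 2 := by positivity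
  nlinarith [sq_nonneg v]

theorem oscEnergy_le {t : ℝ} (ht : t ∈ Icc 0 T) :
    S.oscEnergy t
      ≤ (1 + (n : ℝ) ^ 3) * ∫ r in Icc S.a S.b, (S.ρ t r - S.ρbar) ^ 2 * densWeight n r := by
  have hn1 : 1 ≤ n := by have := S.hn; omega
  have hn : (1 : ℝ) ≤ n := by exact_mod_cast hn1
  have hpos : ∀ r ∈ Icc S.a S.b, r ∈ Ioi (0 : ℝ) := fun r hr => S.r_pos hr
  have c1 : ContinuousOn (fun r => S.osc t r) (Icc S.a S.b) :=
    S.continuousOn_osc.slice_right ht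
  have c2 : ContinuousOn (fun r => S.ρ t r - S.ρbar) (Icc S.a S.b) :=
    fun x _ => ((S.hasDerivAt_ρ_right t x).continuousAt.sub
      continuousAt_const).continuousWithinAt
  have c3 : ContinuousOn (densWeight n) (Icc S.a S.b) := continuousOn_densWeight.mono hpos
  have c4 : ContinuousOn (fluxExponent n) (Icc S.a S.b) := continuousOn_fluxExponent.mono hpos
  have c5 : ContinuousOn (fun r => fluxExponent n r * S.shell r / (n * r ^ n)) (Icc S.a S.b) :=
    (c4.mul S.continuous_shell.continuousOn).div (by fun_prop) fun r hr => by
      have := S.r_pos hr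
      positivity
  have c6 : ContinuousOn (fluxWeight n) (Icc S.a S.b) := continuousOn_fluxWeight.mono hpos
  have c7 := c2.sub c1
  have key := intervalIntegral.integral_eq_sub_of_hasDerivAt_of_le (a := S.a) (b := S.b)
    (f := fun r => 1 / (2 * n) * (S.ρ t r - S.ρbar - S.osc t r) ^ 2 * S.shell r * fluxWeight n r)
    (f' := fun r => ((S.ρ t r - S.ρbar - S.osc t r) * S.osc t r
      + 1 / 2 * (1 - fluxExponent n r * S.shell r / (n * r ^ n))
        * (S.ρ t r - S.ρbar - S.osc t r) ^ 2) * densWeight n r) S.a_le_b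
    (((continuousOn_const.mul (c7.pow 2)).mul S.continuous_shell.continuousOn).mul c6)
    (fun r hr => ?_)
    (ContinuousOn.intervalIntegrable_of_Icc S.a_le_b (((c7.mul c1).add ((continuousOn_const.mul
      (continuousOn_const.sub c5)).mul (c7.pow 2))).mul c3))
  · rw [intervalIntegral.integral_of_le S.a_le_b, ← integral_Icc_eq_integral_Ioc] at key
    have hPb := S.shell_pos S.a_lt_b
    have hb := fluxWeight_pos (n := n) (S.r_pos S.b_mem)
    have eb : n / 2 * fluxWeight n S.b * S.excess t S.b ^ 2 / S.shell S.b
        = 1 / (2 * n) * (S.ρ t S.b - S.ρbar - S.osc t S.b) ^ 2 * S.shell S.b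
          * fluxWeight n S.b := by
      have h := S.excess_sq_div_eq (t := t) S.a_le_b
      have h' : S.excess t S.b = S.shell S.b * (S.ρ t S.b - S.ρbar - S.osc t S.b) / n := by
        rw [← h]; field_simp
      rw [h']; field_simp
    have hq0 : 0 ≤ n / 2 * fluxWeight n S.b * S.excess t S.b ^ 2 / S.shell S.b := by positivity
    simp only [shell_a, mul_zero, zero_mul, sub_zero] at key
    rw [← eb] at key
    have i1 : IntegrableOn (fun r => 1 / 2 * S.osc t r ^ 2 * densWeight n r) (Icc S.a S.b) :=
      ((continuousOn_const.mul (c1.pow 2)).mul c3).integrableOn_Icc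
    have i2 : IntegrableOn (fun r => ((S.ρ t r - S.ρbar - S.osc t r) * S.osc t r
      + 1 / 2 * (1 - fluxExponent n r * S.shell r / (n * r ^ n))
        * (S.ρ t r - S.ρbar - S.osc t r) ^ 2) * densWeight n r) (Icc S.a S.b) :=
      (((c7.mul c1).add ((continuousOn_const.mul
      (continuousOn_const.sub c5)).mul (c7.pow 2))).mul c3).integrableOn_Icc
    have i3 : IntegrableOn (fun r => (S.ρ t r - S.ρbar) ^ 2 * densWeight n r) (Icc S.a S.b) :=
      ((c2.pow 2).mul c3).integrableOn_Icc
    calc S.oscEnergy t ≤ (∫ r in Icc S.a S.b, 1 / 2 * S.osc t r ^ 2 * densWeight n r)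
          + (n + 1) * (n / 2 * fluxWeight n S.b * S.excess t S.b ^ 2 / S.shell S.b) := by
          unfold oscEnergy
          nlinarith
      _ = ∫ r in Icc S.a S.b, (1 / 2 * S.osc t r ^ 2 * densWeight n r
          + (n + 1) * (((S.ρ t r - S.ρbar - S.osc t r) * S.osc t r
      + 1 / 2 * (1 - fluxExponent n r * S.shell r / (n * r ^ n))
        * (S.ρ t r - S.ρbar - S.osc t r) ^ 2) * densWeight n r)) := by
          rw [integral_add i1 (i2.const_mul _), integral_const_mul, key]
      _ ≤ ∫ r in Icc S.a S.b, (1 + (n : ℝ) ^ 3) * ((S.ρ t r - S.ρbar) ^ 2 * densWeight n r) := by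
          refine setIntegral_mono_on (i1.add (i2.const_mul _)) (i3.const_mul _) measurableSet_Icc
            fun r hr => ?_
          have hr0 := S.r_pos hr
          have hκ : -((n : ℝ) - 1) / n ≤ fluxExponent n r * S.shell r / (n * r ^ n) := by
            have h1 := neg_le_fluxExponent (n := n) hr0
            have h2 := S.shell_nonneg hr.1
            have h3 := S.shell_le r
            have h4 : 0 < r ^ n := by positivity
            rw [div_le_div_iff₀ (by positivity) (by positivity)]
            have h5 := mul_le_mul_of_nonneg_right h1 h2
            have h6 : -((n : ℝ) - 1) * r ^ n ≤ fluxExponent n r * S.shell r := by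
              nlinarith [mul_le_mul_of_nonneg_left h3 (sub_nonneg.2 hn)]
            nlinarith
          have h := osc_balance_integrand_le (v := S.ρ t r - S.ρbar) (ζ := S.osc t r) hn hκ
          have := mul_le_mul_of_nonneg_right h (densWeight_pos (n := n) hr0).le
          linarith
      _ = _ := integral_const_mul _ _
  · have hr0 : 0 < r := S.ha0.trans hr.1
    have hP := S.shell_pos hr.1
    have e : r ^ n = r ^ (n - 1) * r := by rw [← pow_succ]; congr 1; omega
    refine (((((((S.hasDerivAt_ρ_right t r).sub_const S.ρbar).sub
      (S.hasDerivAt_osc_right hr.1)).pow 2).const_mul (1 / (2 * n : ℝ))).mul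
      (S.hasDerivAt_shell r)).mul (hasDerivAt_fluxWeight hn1 hr0)).congr_deriv ?_
    simp only [Pi.mul_apply, Pi.pow_apply, Pi.sub_apply]
    unfold densWeight
    rw [e]
    push_cast
    field_simp
    ring

end ViscousSetup

/-- For large viscosity and `γ ≥ 2` the density gradient obeys a viscosity independent
weighted bound. -/
theorem exists_integral_ρr_sq_le (n : ℕ) {γ : ℝ} (T E₀ : ℝ) (hγ : 2 ≤ γ) :
    ∃ C, 0 < C ∧ ∀ S : ViscousSetup n γ T E₀, 2 < S.b → S.ρbar ≤ 1 → 1 ≤ S.ε →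
      S.ε * ∫ p in S.dom, S.ρr p.1 p.2 ^ 2 * densWeight n p.2 ≤ C := by
  obtain ⟨C₁, hC₁, h₁⟩ := exists_integral_m_sq_le n T E₀ (show 1 < γ by linarith)
  obtain ⟨C₂, hC₂, h₂⟩ := exists_integral_ρ_sq_le n E₀ hγ
  refine ⟨4 * (n + 2) * ((1 + (n : ℝ) ^ 3) * C₂ + 5 * (n + 2) * C₁), by positivity, ?_⟩
  intro S hb hρb hε
  have ht : (0 : ℝ) ∈ Icc 0 T := ⟨le_rfl, S.hT.le⟩
  have hε0 := S.hε
  have h0 := S.oscEnergy_le ht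
  have hv : ∫ r in Icc S.a S.b, (S.ρ 0 r - S.ρbar) ^ 2 * densWeight n r ≤ C₂ := by
    refine le_trans ?_ (h₂ S hρb 0 ht)
    have hpos : ∀ r ∈ Icc S.a S.b, r ∈ Ioi (0 : ℝ) := fun r hr => S.r_pos hr
    have c1 : ContinuousOn (fun r => S.ρ 0 r) (Icc S.a S.b) :=
      fun x _ => (S.hasDerivAt_ρ_right 0 x).continuousAt.continuousWithinAt
    have c2 : ContinuousOn (densWeight n) (Icc S.a S.b) := continuousOn_densWeight.mono hpos
    refine setIntegral_mono_on (((c1.sub continuousOn_const).pow 2).mul c2).integrableOn_Icc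
      ((continuousOn_const.add (c1.pow 2)).mul c2).integrableOn_Icc measurableSet_Icc
      fun r hr => mul_le_mul_of_nonneg_right ?_ (densWeight_pos (S.r_pos hr)).le
    have := S.ρ_pos ht hr
    have := S.hρbar
    nlinarith
  have hm0 : 0 ≤ ∫ p in S.dom, S.m p.1 p.2 ^ 2 * densWeight n p.2 :=
    setIntegral_nonneg S.measurableSet_dom fun p hp =>
      mul_nonneg (sq_nonneg _) (densWeight_pos (S.r_pos_dom hp)).le
  have hm : 5 * (n + 2) / S.ε * ∫ p in S.dom, S.m p.1 p.2 ^ 2 * densWeight n p.2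
      ≤ 5 * (n + 2) * C₁ := by
    refine mul_le_mul (div_le_self (by positivity) hε) (h₁ S hb hρb hε) hm0 (by positivity)
  have h := S.integral_ρr_sq_le_oscEnergy
  have hE : S.oscEnergy 0 ≤ (1 + (n : ℝ) ^ 3) * C₂ :=
    h0.trans (mul_le_mul_of_nonneg_left hv (by positivity))
  rw [div_mul_eq_mul_div, div_le_iff₀ (by positivity)] at h
  calc _ ≤ _ := h
    _ ≤ ((1 + (n : ℝ) ^ 3) * C₂ + 5 * (n + 2) * C₁) * (4 * (n + 2)) := by gcongr
    _ = _ := by ring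

/-- The entropy `(x+s) log((x+s)/(c+s)) - (x-c)` relative to `c`. -/
def relEntropy (s c x : ℝ) : ℝ := (x + s) * log ((x + s) / (c + s)) - (x - c)

theorem relEntropy_nonneg {s c x : ℝ} (hc : 0 < c + s) (hx : 0 < x + s) :
    0 ≤ relEntropy s c x := by
  have h := one_sub_inv_le_log_of_pos (div_pos hx hc)
  have h1 := mul_le_mul_of_nonneg_left h hx.le
  have e : (x + s) * (1 - ((x + s) / (c + s))⁻¹) = x - c := by field_simp; ring
  unfold relEntropy; linarith

theorem relEntropy_le {s c x : ℝ} (hs : 0 < s) (hc : 0 ≤ c) (hx : 0 < x + s) :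
    relEntropy s c x ≤ (x - c) ^ 2 / s := by
  have hcs : 0 < c + s := by linarith
  have h := log_le_sub_one_of_pos (div_pos hx hcs)
  have h1 := mul_le_mul_of_nonneg_left h hx.le
  have e : (x + s) * ((x + s) / (c + s) - 1) - (x - c) = (x - c) ^ 2 / (c + s) := by
    field_simp; ring
  have h2 : (x - c) ^ 2 / (c + s) ≤ (x - c) ^ 2 / s := by gcongr; linarith
  unfold relEntropy; linarith

theorem abs_log_div_le {s c x : ℝ} (hs : 0 < s) (hc : 0 ≤ c) (hx : 0 ≤ x) :
    |log ((x + s) / (c + s))| ≤ |x - c| / s := by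
  have hcs : 0 < c + s := by linarith
  have hxs : 0 < x + s := by linarith
  have bound : ∀ y : ℝ, 0 ≤ y → |x - c| / (y + s) ≤ |x - c| / s := fun y hy => by
    gcongr; linarith
  rw [abs_le]
  constructor
  · have h := one_sub_inv_le_log_of_pos (div_pos hxs hcs)
    have e : 1 - ((x + s) / (c + s))⁻¹ = (x - c) / (x + s) := by field_simp; ring
    have h1 : -(|x - c| / (x + s)) ≤ (x - c) / (x + s) := by
      rw [← neg_div]; gcongr; exact neg_abs_le _
    linarith [bound x hx]
  · have h := log_le_sub_one_of_pos (div_pos hxs hcs)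
    have e : (x + s) / (c + s) - 1 = (x - c) / (c + s) := by field_simp; ring
    have h1 : (x - c) / (c + s) ≤ |x - c| / (c + s) := by gcongr; exact le_abs_self _
    linarith [bound c hc]

theorem hasDerivAt_relEntropy {s : ℝ} {c x : ℝ → ℝ} {c' x' t : ℝ} (hc : HasDerivAt c c' t)
    (hx : HasDerivAt x x' t) (hcs : c t + s ≠ 0) (hxs : x t + s ≠ 0) :
    HasDerivAt (fun y => relEntropy s (c y) (x y))
      (log ((x t + s) / (c t + s)) * x' + (c t - x t) / (c t + s) * c') t := by
  refine (((hx.add_const s).mul (((hx.add_const s).div (hc.add_const s) hcs).log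
    (div_ne_zero hxs hcs))).sub (hx.sub hc)).congr_deriv ?_
  simp only [Pi.div_apply]
  field_simp
  ring

namespace ViscousSetup

variable {n : ℕ} {γ T E₀ : ℝ} (S : ViscousSetup n γ T E₀)

/-- The mass of the localizing weight. -/
def cutMass (ω : ℝ → ℝ) : ℝ := ∫ r in S.a..S.b, ω r ^ 2 * r ^ (n - 1)

/-- The localized mean density. -/
def cutMean (ω : ℝ → ℝ) (t : ℝ) : ℝ :=
  (∫ r in S.a..S.b, S.ρ t r * (ω r ^ 2 * r ^ (n - 1))) / S.cutMass ω

/-- The time derivative of the localized mean density. -/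
def cutMeant (ω : ℝ → ℝ) (t : ℝ) : ℝ :=
  (∫ r in S.a..S.b, S.ρt t r * (ω r ^ 2 * r ^ (n - 1))) / S.cutMass ω

theorem hasDerivAt_cutMean {ω : ℝ → ℝ} (hω : Continuous ω) (t : ℝ) :
    HasDerivAt (S.cutMean ω) (S.cutMeant ω t) t :=
  (hasDerivAt_intervalIntegral_param (f := fun t r => S.ρ t r * (ω r ^ 2 * r ^ (n - 1)))
    (f' := fun t r => S.ρt t r * (ω r ^ 2 * r ^ (n - 1))) S.a_le_b (by fun_prop) (by fun_prop)
    (fun t r => (S.hasDerivAt_ρ_left t r).mul_const _) t).div_const _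

theorem continuous_cutMeant {ω : ℝ → ℝ} (hω : Continuous ω) : Continuous (S.cutMeant ω) :=
  (intervalIntegral.continuous_parametric_intervalIntegral_of_continuous'
    (f := fun t r => S.ρt t r * (ω r ^ 2 * r ^ (n - 1))) (by
      simp only [Function.uncurry_def]; fun_prop) _ _).div_const _

theorem cutMass_ge {ω : ℝ → ℝ} (hω : Continuous ω) (hb : 2 < S.b) :
    ∫ r in Icc (1 : ℝ) 2, ω r ^ 2 * r ^ (n - 1) ≤ S.cutMass ω := by
  unfold cutMass
  rw [intervalIntegral.integral_of_le S.a_le_b, ← integral_Icc_eq_integral_Ioc]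
  exact setIntegral_Icc_le_of_subset (by fun_prop)
    (fun r hr => mul_nonneg (sq_nonneg _) (pow_nonneg (S.r_pos hr).le _))
    (Icc_subset_Icc S.ha1.le hb.le)

theorem cutMean_nonneg {ω : ℝ → ℝ} {t : ℝ} (ht : t ∈ Icc 0 T) : 0 ≤ S.cutMean ω t := by
  refine div_nonneg (intervalIntegral.integral_nonneg S.a_le_b fun r hr => ?_)
    (intervalIntegral.integral_nonneg S.a_le_b fun r hr => ?_) <;>
  have := pow_nonneg (S.r_pos hr).le (n - 1)
  · have := (S.ρ_pos ht hr).le; positivity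
  · positivity

theorem integral_cutMean_sub {ω : ℝ → ℝ} (hω : Continuous ω) (h0 : S.cutMass ω ≠ 0) (t : ℝ) :
    ∫ r in Icc S.a S.b, (S.cutMean ω t - S.ρ t r) * (ω r ^ 2 * r ^ (n - 1)) = 0 := by
  rw [integral_Icc_eq_integral_Ioc, ← intervalIntegral.integral_of_le S.a_le_b]
  have c1 : Continuous fun r => S.ρ t r := S.continuous_ρ.comp (Continuous.prodMk_right t)
  have e : ∀ r, (S.cutMean ω t - S.ρ t r) * (ω r ^ 2 * r ^ (n - 1))
      = S.cutMean ω t * (ω r ^ 2 * r ^ (n - 1)) - S.ρ t r * (ω r ^ 2 * r ^ (n - 1)) :=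
    fun r => by ring
  simp_rw [e]
  rw [intervalIntegral.integral_sub (Continuous.intervalIntegrable (by fun_prop) _ _)
    (Continuous.intervalIntegrable (by fun_prop) _ _), intervalIntegral.integral_const_mul]
  change S.cutMean ω t * S.cutMass ω - _ = 0
  unfold cutMean
  field_simp
  ring

/-- The balance of the entropy relative to the localized mean. -/
theorem integral_relEntropy_balance {ω : ℝ → ℝ} {W s : ℝ} (h : IsCutoff ω W) (hb : 2 < S.b)
    (h0 : S.cutMass ω ≠ 0) (hs : 0 < s) :
    ∫ p in S.dom, ω p.2 ^ 2 * (S.ρr p.1 p.2 / (S.ρ p.1 p.2 + s)) * S.flux p.1 p.2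
      ≤ (∫ r in Icc S.a S.b, ω r ^ 2 * r ^ (n - 1) * relEntropy s (S.cutMean ω 0) (S.ρ 0 r))
        + ∫ p in S.dom, -(2 * ω p.2 * deriv ω p.2
          * log ((S.ρ p.1 p.2 + s) / (S.cutMean ω p.1 + s)) * S.flux p.1 p.2) := by
  have cω := h.continuous
  have cω' := h.continuous_deriv
  have cm : Continuous (S.cutMean ω) :=
    continuous_iff_continuousAt.2 fun t => (S.hasDerivAt_cutMean cω t).continuousAt
  have cm' := S.continuous_cutMeant cω
  have hcs : ∀ t ∈ Icc 0 T, 0 < S.cutMean ω t + s := fun t ht => by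
    linarith [S.cutMean_nonneg (ω := ω) ht]
  have hxs : ∀ t ∈ Icc 0 T, ∀ r ∈ Icc S.a S.b, 0 < S.ρ t r + s := fun t ht r hr => by
    linarith [S.ρ_pos ht hr]
  have c1 : ContinuousOn (fun p : ℝ × ℝ => log ((S.ρ p.1 p.2 + s) / (S.cutMean ω p.1 + s)))
      S.dom :=
    (ContinuousOn.div (by fun_prop) (by fun_prop) fun p hp => (hcs p.1 hp.1).ne').log
      fun p hp => (div_pos (hxs p.1 hp.1 p.2 hp.2) (hcs p.1 hp.1)).ne'
  have c2 : ContinuousOn (fun p : ℝ × ℝ => relEntropy s (S.cutMean ω p.1) (S.ρ p.1 p.2))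
      S.dom := by
    unfold relEntropy
    exact (ContinuousOn.mul (by fun_prop) c1).sub (by fun_prop)
  have c3 : ContinuousOn (fun p : ℝ × ℝ => ω p.2 ^ 2 * p.2 ^ (n - 1)) S.dom := by fun_prop
  have c4 : ContinuousOn (fun p : ℝ × ℝ => S.ρt p.1 p.2) S.dom := S.continuous_ρt.continuousOn
  have c5 : ContinuousOn (fun p : ℝ × ℝ =>
      (S.cutMean ω p.1 - S.ρ p.1 p.2) / (S.cutMean ω p.1 + s)) S.dom :=
    ContinuousOn.div (by fun_prop) (by fun_prop) fun p hp => (hcs p.1 hp.1).ne'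
  have c6 : ContinuousOn (fun p : ℝ × ℝ => S.flux p.1 p.2) S.dom := S.continuous_flux.continuousOn
  have c7 : ContinuousOn (fun p : ℝ × ℝ => S.ρr p.1 p.2 / (S.ρ p.1 p.2 + s)) S.dom :=
    ContinuousOn.div (by fun_prop) (by fun_prop) fun p hp => (hxs p.1 hp.1 p.2 hp.2).ne'
  have c8 : ContinuousOn (fun p : ℝ × ℝ => 2 * ω p.2 * deriv ω p.2) S.dom := by fun_prop
  have c9 : ContinuousOn (fun p : ℝ × ℝ => ω p.2 ^ 2) S.dom := by fun_prop
  have c10 : ContinuousOn (fun p : ℝ × ℝ => S.cutMeant ω p.1) S.dom := by fun_prop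
  have hg := S.green
    (A := fun t r => ω r ^ 2 * r ^ (n - 1) * relEntropy s (S.cutMean ω t) (S.ρ t r))
    (A' := fun t r => ω r ^ 2 * r ^ (n - 1)
      * (log ((S.ρ t r + s) / (S.cutMean ω t + s)) * S.ρt t r
        + (S.cutMean ω t - S.ρ t r) / (S.cutMean ω t + s) * S.cutMeant ω t))
    (J := fun t r => ω r ^ 2 * log ((S.ρ t r + s) / (S.cutMean ω t + s)) * S.flux t r)
    (J' := fun t r =>
      (2 * ω r * deriv ω r * log ((S.ρ t r + s) / (S.cutMean ω t + s))
        + ω r ^ 2 * (S.ρr t r / (S.ρ t r + s))) * S.flux t r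
      + ω r ^ 2 * log ((S.ρ t r + s) / (S.cutMean ω t + s)) * (r ^ (n - 1) * S.ρt t r))
    (c3.mul c2) (c3.mul ((c1.mul c4).add (c5.mul c10))) ((c9.mul c1).mul c6)
    ((((c8.mul c1).add (c9.mul c7)).mul c6).add ((c9.mul c1).mul (by fun_prop)))
    (fun t ht r hr => by
      have ht' := Ioo_subset_Icc_self ht
      have hr' := Ioo_subset_Icc_self hr
      exact (hasDerivAt_relEntropy (S.hasDerivAt_cutMean cω t) (S.hasDerivAt_ρ_left t r)
        (hcs t ht').ne' (hxs t ht' r hr').ne').const_mul _)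
    (fun t ht r hr => by
      have ht' := Ioo_subset_Icc_self ht
      have hr' := Ioo_subset_Icc_self hr
      have hx := (hxs t ht' r hr').ne'
      have hc := (hcs t ht').ne'
      refine ((((h.hasDerivAt r).pow 2).mul ((((S.hasDerivAt_ρ_right t r).add_const s).div_const
        (S.cutMean ω t + s)).log (div_ne_zero hx hc))).mul
        (S.hasDerivAt_flux ht hr)).congr_deriv ?_
      simp only [Pi.mul_apply, Pi.pow_apply]
      push_cast
      field_simp)
  have hωb : ω S.b = 0 := h.eq_zero _ hb.le
  have hJ : ∫ t in Icc 0 T, (ω S.b ^ 2 * log ((S.ρ t S.b + s) / (S.cutMean ω t + s))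
      * S.flux t S.b - ω S.a ^ 2 * log ((S.ρ t S.a + s) / (S.cutMean ω t + s))
      * S.flux t S.a) = 0 := by
    refine setIntegral_eq_zero_of_forall_eq_zero fun t ht => ?_
    simp [hωb, S.flux_a ht]
  have hA : ∀ t ∈ Icc 0 T, IntegrableOn (fun r => ω r ^ 2 * r ^ (n - 1)
      * relEntropy s (S.cutMean ω t) (S.ρ t r)) (Icc S.a S.b) := fun t ht =>
    (ContinuousOn.slice_right (f := fun t r => ω r ^ 2 * r ^ (n - 1)
      * relEntropy s (S.cutMean ω t) (S.ρ t r)) (s := Icc 0 T) (u := Icc S.a S.b)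
      (c3.mul c2) ht).integrableOn_Icc
  have hT : T ∈ Icc 0 T := ⟨S.hT.le, le_rfl⟩
  have hAT : 0 ≤ ∫ r in Icc S.a S.b, ω r ^ 2 * r ^ (n - 1)
      * relEntropy s (S.cutMean ω T) (S.ρ T r) :=
    setIntegral_nonneg measurableSet_Icc fun r hr =>
      mul_nonneg (mul_nonneg (sq_nonneg _) (pow_nonneg (S.r_pos hr).le _))
        (relEntropy_nonneg (hcs T hT) (hxs T hT r hr))
  have hz : ∫ p in S.dom, (S.cutMean ω p.1 - S.ρ p.1 p.2) * (ω p.2 ^ 2 * p.2 ^ (n - 1))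
      * (S.cutMeant ω p.1 / (S.cutMean ω p.1 + s)) = 0 := by
    have cc : ContinuousOn (fun p : ℝ × ℝ => (S.cutMean ω p.1 - S.ρ p.1 p.2)
        * (ω p.2 ^ 2 * p.2 ^ (n - 1)) * (S.cutMeant ω p.1 / (S.cutMean ω p.1 + s))) S.dom :=
      ContinuousOn.mul (by fun_prop)
        (ContinuousOn.div (by fun_prop) (by fun_prop) fun p hp => (hcs p.1 hp.1).ne')
    rw [dom, setIntegral_rect_eq (f := fun t r => (S.cutMean ω t - S.ρ t r)
      * (ω r ^ 2 * r ^ (n - 1)) * (S.cutMeant ω t / (S.cutMean ω t + s))) cc]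
    simp_rw [integral_mul_const, S.integral_cutMean_sub cω h0, zero_mul, integral_zero]
  have i1 := S.integrableOn_dom (f := fun p => -(2 * ω p.2 * deriv ω p.2
    * log ((S.ρ p.1 p.2 + s) / (S.cutMean ω p.1 + s)) * S.flux p.1 p.2))
    ((c8.mul c1).mul c6).neg
  have i2 := S.integrableOn_dom (f := fun p =>
    ω p.2 ^ 2 * (S.ρr p.1 p.2 / (S.ρ p.1 p.2 + s)) * S.flux p.1 p.2) ((c9.mul c7).mul c6)
  have i3 := S.integrableOn_dom (f := fun p => (S.cutMean ω p.1 - S.ρ p.1 p.2)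
      * (ω p.2 ^ 2 * p.2 ^ (n - 1)) * (S.cutMeant ω p.1 / (S.cutMean ω p.1 + s)))
      (ContinuousOn.mul (by fun_prop)
        (ContinuousOn.div (by fun_prop) (by fun_prop) fun p hp => (hcs p.1 hp.1).ne'))
  rw [hJ, sub_zero, integral_sub (hA T hT) (hA 0 ⟨le_rfl, S.hT.le⟩)] at hg
  have e : ∀ p : ℝ × ℝ, ω p.2 ^ 2 * p.2 ^ (n - 1)
      * (log ((S.ρ p.1 p.2 + s) / (S.cutMean ω p.1 + s)) * S.ρt p.1 p.2
        + (S.cutMean ω p.1 - S.ρ p.1 p.2) / (S.cutMean ω p.1 + s) * S.cutMeant ω p.1)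
      - ((2 * ω p.2 * deriv ω p.2 * log ((S.ρ p.1 p.2 + s) / (S.cutMean ω p.1 + s))
        + ω p.2 ^ 2 * (S.ρr p.1 p.2 / (S.ρ p.1 p.2 + s))) * S.flux p.1 p.2
      + ω p.2 ^ 2 * log ((S.ρ p.1 p.2 + s) / (S.cutMean ω p.1 + s))
        * (p.2 ^ (n - 1) * S.ρt p.1 p.2))
      = (S.cutMean ω p.1 - S.ρ p.1 p.2)
      * (ω p.2 ^ 2 * p.2 ^ (n - 1)) * (S.cutMeant ω p.1 / (S.cutMean ω p.1 + s))
      + -(2 * ω p.2 * deriv ω p.2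
          * log ((S.ρ p.1 p.2 + s) / (S.cutMean ω p.1 + s)) * S.flux p.1 p.2)
      - ω p.2 ^ 2 * (S.ρr p.1 p.2 / (S.ρ p.1 p.2 + s)) * S.flux p.1 p.2 := fun p => by ring
  simp_rw [e] at hg
  rw [integral_sub (by exact i3.add i1) i2, integral_add i3 i1, hz, zero_add] at hg
  linarith

end ViscousSetup

theorem pow_le_mul_densWeight {n : ℕ} {r : ℝ} (h1 : 1 ≤ r) (h2 : r ≤ 2) :
    r ^ (n - 1) ≤ 3 ^ (2 * n) * densWeight n r := by
  unfold densWeight fluxWeight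
  have hr : (1 : ℝ) ≤ r ^ (n - 1) := one_le_pow₀ h1
  have h3 : (1 + r) ^ (2 * n) ≤ 3 ^ (2 * n) := pow_le_pow_left₀ (by linarith) (by linarith) _
  rw [div_mul_eq_mul_div, mul_div_assoc', le_div_iff₀ (by positivity)]
  nlinarith [mul_le_mul_of_nonneg_left h3 (by positivity : 0 ≤ r ^ (n - 1) * r ^ (n - 1)),
    mul_le_mul_of_nonneg_left hr (by positivity : 0 ≤ r ^ (n - 1) * (1 + r) ^ (2 * n))]

theorem one_div_densWeight_le {n : ℕ} {q y : ℝ} (hq : 0 < q) (hy : q ≤ y) (h2 : y ≤ 2) :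
    1 / densWeight n y ≤ 3 ^ (2 * n) / (q ^ (n - 1)) ^ 2 := by
  have hy0 : 0 < y := hq.trans_le hy
  have e : 1 / densWeight n y = (1 + y) ^ (2 * n) / (y ^ (n - 1)) ^ 2 := by
    unfold densWeight fluxWeight; field_simp
  rw [e]
  gcongr
  linarith

theorem IsCutoff.deriv_eq_zero {ω : ℝ → ℝ} {W : ℝ} (h : IsCutoff ω W) {r : ℝ} (h0 : 0 < r)
    (h1 : r < 1) : deriv ω r = 0 := by
  have : ω =ᶠ[nhds r] fun _ => 1 := by
    filter_upwards [Ioo_mem_nhds h0 h1] with x hx using h.eq_one x ⟨hx.1.le, hx.2.le⟩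
  rw [this.deriv_eq, deriv_const]

namespace ViscousSetup

variable {n : ℕ} {γ T E₀ : ℝ} (S : ViscousSetup n γ T E₀)

/-- The weighted squared gradient of the density at a fixed time. -/
def gradEnergy (t : ℝ) : ℝ := ∫ r in Icc S.a S.b, S.ρr t r ^ 2 * densWeight n r

theorem gradEnergy_nonneg (t : ℝ) : 0 ≤ S.gradEnergy t :=
  setIntegral_nonneg measurableSet_Icc fun _ hr =>
    mul_nonneg (sq_nonneg _) (densWeight_pos (S.r_pos hr)).le

theorem sq_ρ_sub_le (t : ℝ) {q x y : ℝ} (hq : 0 < q) (hb : 2 < S.b) (hx : S.a ≤ x) (hqx : q ≤ x)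
    (hxy : x ≤ y) (hy : y ≤ 2) :
    (S.ρ t y - S.ρ t x) ^ 2 * (q ^ (n - 1)) ^ 2 ≤ 2 * 3 ^ (2 * n) * S.gradEnergy t := by
  have hs : Icc x y ⊆ Icc S.a S.b := Icc_subset_Icc hx (hy.trans hb.le)
  have cμ : ContinuousOn (densWeight n) (Icc S.a S.b) :=
    continuousOn_densWeight.mono fun r hr => S.r_pos hr
  have cρ : Continuous fun r => S.ρr t r := S.continuous_ρr.comp (Continuous.prodMk_right t)
  have h1 := sq_sub_le_integral_mul_integral hxy (fun z _ => S.hasDerivAt_ρ_right t z)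
    cρ.continuousOn (cμ.mono hs) fun z hz => densWeight_pos (n := n) (S.r_pos (hs hz))
  have h2 : ∫ z in Icc x y, S.ρr t z ^ 2 * densWeight n z ≤ S.gradEnergy t :=
    setIntegral_Icc_le_of_subset (by fun_prop)
      (fun z hz => mul_nonneg (sq_nonneg _) (densWeight_pos (S.r_pos hz)).le) hs
  have h3 : ∫ z in Icc x y, 1 / densWeight n z ≤ (y - x) * (3 ^ (2 * n) / (q ^ (n - 1)) ^ 2) :=
    setIntegral_Icc_le_mul hxy
      (continuousOn_const.div (cμ.mono hs) fun z hz => (densWeight_pos (S.r_pos (hs hz))).ne')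
      fun z hz => one_div_densWeight_le hq (hqx.trans hz.1) (hz.2.trans hy)
  have h4 : (y - x) * (3 ^ (2 * n) / (q ^ (n - 1)) ^ 2)
      ≤ 2 * (3 ^ (2 * n) / (q ^ (n - 1)) ^ 2) := by
    gcongr; linarith
  have h5 : 0 ≤ ∫ z in Icc x y, 1 / densWeight n z :=
    setIntegral_nonneg measurableSet_Icc fun z hz =>
      (one_div_pos.2 (densWeight_pos (S.r_pos (hs hz)))).le
  have h6 := h1.trans (mul_le_mul h2 (h3.trans h4) h5 (S.gradEnergy_nonneg t))
  calc _ ≤ S.gradEnergy t * (2 * (3 ^ (2 * n) / (q ^ (n - 1)) ^ 2)) * (q ^ (n - 1)) ^ 2 := by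
        gcongr
    _ = _ := by field_simp

theorem abs_ρ_sub_mul_pow_le (t : ℝ) {r x : ℝ} (hb : 2 < S.b) (hr : r ∈ Icc (1 : ℝ) 2)
    (hx : S.a ≤ x) (hx2 : x ≤ 2) :
    |S.ρ t r - S.ρ t x| * x ^ (n - 1) ≤ 6 ^ n * √(S.gradEnergy t) := by
  have hx0 : 0 < x := S.ha0.trans_le hx
  have hq : 0 < min x 1 := lt_min hx0 one_pos
  have hY := S.gradEnergy_nonneg t
  have h1 : (S.ρ t r - S.ρ t x) ^ 2 * (min x 1 ^ (n - 1)) ^ 2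
      ≤ 2 * 3 ^ (2 * n) * S.gradEnergy t := by
    rcases le_total x r with h | h
    · exact S.sq_ρ_sub_le t hq hb hx (min_le_left _ _) h hr.2
    · rw [← neg_sub (S.ρ t x), neg_sq]
      exact S.sq_ρ_sub_le t hq hb (S.ha1.le.trans hr.1) ((min_le_right _ _).trans hr.1) h hx2
  have h2 : |S.ρ t r - S.ρ t x| * min x 1 ^ (n - 1) ≤ 2 * 3 ^ n * √(S.gradEnergy t) := by
    refine (abs_le_of_sq_le_sq' ?_ (by positivity)).2
    rw [mul_pow, sq_abs, mul_pow, sq_sqrt hY, mul_pow, ← pow_mul 3, mul_comm n 2]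
    refine h1.trans ?_
    gcongr
    norm_num
  have h3 : x ^ (n - 1) ≤ 2 ^ (n - 1) * min x 1 ^ (n - 1) := by
    rw [← mul_pow]
    refine pow_le_pow_left₀ hx0.le ?_ _
    rcases min_cases x 1 with ⟨h, -⟩ | ⟨h, -⟩ <;> rw [h] <;> linarith
  have e : (2 : ℝ) ^ n = 2 * 2 ^ (n - 1) := by
    rw [← pow_succ', Nat.sub_add_cancel (by linarith [S.hn])]
  calc _ ≤ |S.ρ t r - S.ρ t x| * (2 ^ (n - 1) * min x 1 ^ (n - 1)) := by gcongr
    _ = 2 ^ (n - 1) * (|S.ρ t r - S.ρ t x| * min x 1 ^ (n - 1)) := by ring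
    _ ≤ 2 ^ (n - 1) * (2 * 3 ^ n * √(S.gradEnergy t)) := by gcongr
    _ = 6 ^ n * √(S.gradEnergy t) := by
        rw [show (6 : ℝ) = 2 * 3 by norm_num, mul_pow, e]; ring

/-- Poincaré-type bound of the density oscillation around its localized mean. -/
theorem abs_ρ_sub_cutMean_le {ω : ℝ → ℝ} {W : ℝ} (h : IsCutoff ω W) (hb : 2 < S.b)
    (h0 : 0 < S.cutMass ω) (t : ℝ) {r : ℝ} (hr : r ∈ Icc (1 : ℝ) 2) :
    |S.ρ t r - S.cutMean ω t| * S.cutMass ω ≤ 9 * W ^ 2 * 6 ^ n * √(S.gradEnergy t) := by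
  have cω := h.continuous
  have cρ : Continuous fun r => S.ρ t r := S.continuous_ρ.comp (Continuous.prodMk_right t)
  have e1 : ∫ x in Icc S.a S.b, ω x ^ 2 * x ^ (n - 1) = S.cutMass ω := by
    rw [cutMass, intervalIntegral.integral_of_le S.a_le_b, integral_Icc_eq_integral_Ioc]
  have e2 : ∫ x in Icc S.a S.b, (S.ρ t r - S.ρ t x) * (ω x ^ 2 * x ^ (n - 1))
      = (S.ρ t r - S.cutMean ω t) * S.cutMass ω := by
    rw [← e1, ← integral_const_mul, ← sub_eq_zero, ← S.integral_cutMean_sub cω h0.ne' t,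
      ← integral_sub (Continuous.integrableOn_Icc (by fun_prop))
        (Continuous.integrableOn_Icc (by fun_prop))]
    congr 1; ext x; ring
  rw [← abs_of_pos h0, ← abs_mul, ← e2]
  have cd := continuousOn_decay S.ha0.le (b := S.b)
  calc _ ≤ ∫ x in Icc S.a S.b, |(S.ρ t r - S.ρ t x) * (ω x ^ 2 * x ^ (n - 1))| :=
        abs_integral_le_integral_abs
    _ ≤ ∫ x in Icc S.a S.b, 9 * W ^ 2 * 6 ^ n * √(S.gradEnergy t) * decay x := by
        refine setIntegral_mono_on (Continuous.integrableOn_Icc (by fun_prop))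
          (continuousOn_const.mul cd).integrableOn_Icc measurableSet_Icc fun x hx => ?_
        have hx0 := S.r_pos hx
        have hd := decay_nonneg x
        rcases lt_or_ge x 2 with h2 | h2
        · have k1 := S.abs_ρ_sub_mul_pow_le t hb hr hx.1 h2.le
          have k2 := pow_le_decay (k := 0) hx0 h2
          have k3 := h.sq_le x
          rw [abs_mul, abs_mul, abs_of_nonneg (sq_nonneg (ω x)),
            abs_of_nonneg (pow_nonneg hx0.le _)]
          calc _ = ω x ^ 2 * (|S.ρ t r - S.ρ t x| * x ^ (n - 1)) := by ring
            _ ≤ W ^ 2 * (6 ^ n * √(S.gradEnergy t)) := by gcongr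
            _ ≤ W ^ 2 * (6 ^ n * √(S.gradEnergy t)) * (9 * decay x) :=
                le_mul_of_one_le_right (by positivity) (by simpa using k2)
            _ = _ := by ring
        · rw [h.eq_zero x h2]; simp only [ne_eq, OfNat.ofNat_ne_zero, not_false_eq_true, zero_pow,
            zero_mul, mul_zero, abs_zero]
          positivity
    _ = 9 * W ^ 2 * 6 ^ n * √(S.gradEnergy t) * ∫ x in Icc S.a S.b, decay x :=
        integral_const_mul _ _
    _ ≤ _ := mul_le_of_le_one_right (by positivity) (integral_decay_le S.ha0.le S.a_le_b)

/-- Pointwise bound of the commutator in the relative entropy balance. -/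
theorem relEntropy_commutator_le {ω : ℝ → ℝ} {W s : ℝ} (h : IsCutoff ω W) (hb : 2 < S.b)
    (h0 : 0 < S.cutMass ω) (hs : 0 < s) (hε : 1 ≤ S.ε) {t r : ℝ} (ht : t ∈ Icc 0 T)
    (hr : r ∈ Icc S.a S.b) :
    -(2 * ω r * deriv ω r * log ((S.ρ t r + s) / (S.cutMean ω t + s)) * S.flux t r)
      ≤ 18 * W ^ 4 * 6 ^ n * 3 ^ (2 * n) / S.cutMass ω / s
        * ((S.ε / 2 * S.ρr t r ^ 2 + S.m t r ^ 2 / 2 + S.ε * S.gradEnergy t)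
          * densWeight n r) := by
  have hr0 := S.r_pos hr
  have hY := S.gradEnergy_nonneg t
  have hμ := densWeight_pos (n := n) hr0
  have hR : 0 ≤ 18 * W ^ 4 * 6 ^ n * 3 ^ (2 * n) / S.cutMass ω / s
        * ((S.ε / 2 * S.ρr t r ^ 2 + S.m t r ^ 2 / 2 + S.ε * S.gradEnergy t)
          * densWeight n r) := by positivity
  rcases lt_or_ge r 1 with h1 | h1
  · simpa [h.deriv_eq_zero hr0 h1] using hR
  rcases le_or_gt 2 r with h2 | h2
  · simpa [h.eq_zero r h2] using hR
  have k1 : |log ((S.ρ t r + s) / (S.cutMean ω t + s))|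
      ≤ 9 * W ^ 2 * 6 ^ n * √(S.gradEnergy t) / S.cutMass ω / s := by
    refine (abs_log_div_le hs (S.cutMean_nonneg ht) (S.ρ_pos ht hr).le).trans ?_
    gcongr
    rw [le_div_iff₀ h0]
    exact S.abs_ρ_sub_cutMean_le h hb h0 t ⟨h1, h2.le⟩
  have k2 : |S.flux t r| ≤ 3 ^ (2 * n) * densWeight n r * (S.ε * |S.ρr t r| + |S.m t r|) := by
    unfold flux
    rw [abs_mul, abs_of_nonneg (pow_nonneg hr0.le _)]
    refine mul_le_mul (pow_le_mul_densWeight h1 h2.le) ?_ (abs_nonneg _) (by positivity)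
    refine (abs_sub _ _).trans ?_
    rw [abs_mul, abs_of_pos S.hε]
  have k3 : |2 * ω r * deriv ω r| ≤ 2 * W * W := by
    rw [abs_mul, abs_mul, abs_two]
    have := h.one_le
    gcongr
    · exact h.abs_le r
    · exact h.abs_deriv_le r
  have k4 : √(S.gradEnergy t) * (S.ε * |S.ρr t r| + |S.m t r|)
      ≤ S.ε / 2 * S.ρr t r ^ 2 + S.m t r ^ 2 / 2 + S.ε * S.gradEnergy t := by
    have e := sq_sqrt hY
    set y := √(S.gradEnergy t)
    rw [← e, ← sq_abs (S.ρr t r), ← sq_abs (S.m t r)]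
    nlinarith [mul_nonneg S.hε.le (sq_nonneg (y - |S.ρr t r|)), sq_nonneg (y - |S.m t r|),
      mul_nonneg (sub_nonneg.2 hε) (sq_nonneg y)]
  refine (neg_le_abs _).trans ?_
  rw [abs_mul, abs_mul]
  have hW := h.one_le
  calc _ ≤ 2 * W * W * (9 * W ^ 2 * 6 ^ n * √(S.gradEnergy t) / S.cutMass ω / s)
        * (3 ^ (2 * n) * densWeight n r * (S.ε * |S.ρr t r| + |S.m t r|)) := by gcongr
    _ = 18 * W ^ 4 * 6 ^ n * 3 ^ (2 * n) / S.cutMass ω / s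
        * ((√(S.gradEnergy t) * (S.ε * |S.ρr t r| + |S.m t r|)) * densWeight n r) := by ring
    _ ≤ _ := by gcongr

end ViscousSetup

/-- The localized square integral of the density is controlled by the energy. -/
theorem exists_integral_cut_ρ_sq_le (n : ℕ) {γ : ℝ} (E₀ W : ℝ) (hγ : 2 ≤ γ) :
    ∃ C, 0 < C ∧ ∀ {T : ℝ} (S : ViscousSetup n γ T E₀) {ω : ℝ → ℝ}, IsCutoff ω W →
      S.ρbar ≤ 1 → ∀ t ∈ Icc 0 T,
      ∫ r in Icc S.a S.b, S.ρ t r ^ 2 * (ω r ^ 2 * r ^ (n - 1)) ≤ C := by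
  obtain ⟨K, hK1, hK⟩ := exists_rpow_le_hBarDelta (show 1 < γ by linarith)
  refine ⟨W ^ 2 * ((1 + K) * (9 * 2 ^ (n - 1)) + K * (2 * |E₀|)) + 1, by positivity, ?_⟩
  intro T S ω h hρb t ht
  rw [abs_of_nonneg S.E₀_nonneg]
  have cω := h.continuous
  have cρ : Continuous fun r => S.ρ t r := S.continuous_ρ.comp (Continuous.prodMk_right t)
  have hdec := continuousOn_decay S.ha0.le (b := S.b)
  have hen : ContinuousOn (fun x => S.energyDensity t x) (Icc S.a S.b) :=
    S.continuousOn_energyDensity.slice_right ht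
  have hW := h.one_le
  calc _ ≤ ∫ r in Icc S.a S.b, (W ^ 2 * ((1 + K) * (9 * 2 ^ (n - 1))) * decay r
        + W ^ 2 * K * S.energyDensity t r) := by
        refine setIntegral_mono_on (Continuous.integrableOn_Icc (by fun_prop))
          (ContinuousOn.integrableOn_Icc (by fun_prop)) measurableSet_Icc fun r hr => ?_
        have hd := decay_nonneg r
        have he := S.energyDensity_nonneg ht hr
        have hr0 := S.r_pos hr
        rcases le_or_gt 2 r with h2 | h2
        · rw [h.eq_zero r h2]
          simp only [ne_eq, OfNat.ofNat_ne_zero, not_false_eq_true, zero_pow, zero_mul, mul_zero]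
          positivity
        have h0 := S.ρ_pos ht hr
        have h1 : S.ρ t r ^ 2 ≤ 1 + S.ρ t r ^ γ := by
          have := rpow_le_one_add_rpow h0 zero_le_two hγ
          rwa [rpow_two] at this
        have h2' : S.ρ t r ^ γ ≤ K * (1 + S.hbar t r) := hK S.δ _ _ S.hδ h0 S.hρbar hρb
        have h3 : S.hbar t r * r ^ (n - 1) ≤ S.energyDensity t r := by
          have : 0 ≤ S.m t r ^ 2 / S.ρ t r * r ^ (n - 1) := by positivity
          unfold ViscousSetup.energyDensity; linarith
        have h4 := pow_le_decay (k := n - 1) hr0 h2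
        have h7 := S.hbar_nonneg ht hr
        calc S.ρ t r ^ 2 * (ω r ^ 2 * r ^ (n - 1))
            ≤ (1 + K * (1 + S.hbar t r)) * (W ^ 2 * r ^ (n - 1)) := by
              have := h.sq_le r
              gcongr
              linarith
          _ = W ^ 2 * (1 + K) * r ^ (n - 1) + W ^ 2 * K * (S.hbar t r * r ^ (n - 1)) := by ring
          _ ≤ W ^ 2 * (1 + K) * (9 * 2 ^ (n - 1) * decay r)
              + W ^ 2 * K * S.energyDensity t r := by gcongr
          _ = _ := by ring
    _ = W ^ 2 * ((1 + K) * (9 * 2 ^ (n - 1))) * (∫ r in Icc S.a S.b, decay r)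
          + W ^ 2 * K * ∫ r in Icc S.a S.b, S.energyDensity t r := by
        rw [integral_add (by exact (continuousOn_const.mul hdec).integrableOn_Icc)
          (by exact (continuousOn_const.mul hen).integrableOn_Icc), integral_const_mul,
          integral_const_mul]
    _ ≤ W ^ 2 * ((1 + K) * (9 * 2 ^ (n - 1))) * 1 + W ^ 2 * K * (2 * E₀) := by
        gcongr
        · exact integral_decay_le S.ha0.le S.a_le_b
        · exact S.integral_energyDensity_le ht
    _ ≤ _ := by linarith

namespace ViscousSetup

variable {n : ℕ} {γ T E₀ : ℝ} (S : ViscousSetup n γ T E₀)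

theorem integral_relEntropy_le {ω : ℝ → ℝ} {s t : ℝ} (cω : Continuous ω)
    (h0 : S.cutMass ω ≠ 0) (hs : 0 < s) (ht : t ∈ Icc 0 T) :
    ∫ r in Icc S.a S.b, ω r ^ 2 * r ^ (n - 1) * relEntropy s (S.cutMean ω t) (S.ρ t r)
      ≤ (∫ r in Icc S.a S.b, S.ρ t r ^ 2 * (ω r ^ 2 * r ^ (n - 1))) / s := by
  have cρ : Continuous fun r => S.ρ t r := S.continuous_ρ.comp (Continuous.prodMk_right t)
  have hc := S.cutMean_nonneg (ω := ω) ht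
  have hxs : ∀ r ∈ Icc S.a S.b, 0 < S.ρ t r + s := fun r hr => by linarith [S.ρ_pos ht hr]
  have hlog : ContinuousOn (fun r => log ((S.ρ t r + s) / (S.cutMean ω t + s))) (Icc S.a S.b) :=
    ContinuousOn.log (by fun_prop) fun r hr => (div_pos (hxs r hr) (by linarith)).ne'
  calc _ ≤ ∫ r in Icc S.a S.b, (S.ρ t r ^ 2 * (ω r ^ 2 * r ^ (n - 1)) / s
        + (S.cutMean ω t - S.ρ t r) * (ω r ^ 2 * r ^ (n - 1)) * (2 * S.cutMean ω t / s)) := by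
        refine setIntegral_mono_on (ContinuousOn.integrableOn_Icc (by unfold relEntropy; fun_prop))
          (Continuous.integrableOn_Icc (by fun_prop)) measurableSet_Icc fun r hr => ?_
        have hr0 := S.r_pos hr
        have h1 := relEntropy_le hs hc (hxs r hr)
        have h2 : (S.ρ t r - S.cutMean ω t) ^ 2
            ≤ S.ρ t r ^ 2 + (S.cutMean ω t - S.ρ t r) * (2 * S.cutMean ω t) := by
          nlinarith [sq_nonneg (S.cutMean ω t)]
        calc _ ≤ ω r ^ 2 * r ^ (n - 1)
              * ((S.ρ t r ^ 2 + (S.cutMean ω t - S.ρ t r) * (2 * S.cutMean ω t)) / s) := by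
              refine mul_le_mul_of_nonneg_left (h1.trans ?_) (by positivity)
              gcongr
          _ = _ := by ring
    _ = _ := by
        rw [integral_add (Continuous.integrableOn_Icc (by fun_prop))
          (Continuous.integrableOn_Icc (by fun_prop)), integral_mul_const,
          S.integral_cutMean_sub cω h0, zero_mul, add_zero, integral_div]

theorem integral_relEntropy_commutator_le {ω : ℝ → ℝ} {W s : ℝ} (h : IsCutoff ω W)
    (hb : 2 < S.b) (h0 : 0 < S.cutMass ω) (hs : 0 < s) (hε : 1 ≤ S.ε) :
    ∫ p in S.dom, -(2 * ω p.2 * deriv ω p.2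
        * log ((S.ρ p.1 p.2 + s) / (S.cutMean ω p.1 + s)) * S.flux p.1 p.2)
      ≤ 18 * W ^ 4 * 6 ^ n * 3 ^ (2 * n) / S.cutMass ω / s
        * (3 / 2 * (S.ε * ∫ p in S.dom, S.ρr p.1 p.2 ^ 2 * densWeight n p.2)
          + 1 / 2 * ∫ p in S.dom, S.m p.1 p.2 ^ 2 * densWeight n p.2) := by
  have cω := h.continuous
  have cω' := h.continuous_deriv
  have cm : Continuous (S.cutMean ω) :=
    continuous_iff_continuousAt.2 fun t => (S.hasDerivAt_cutMean cω t).continuousAt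
  have hcs : ∀ t ∈ Icc 0 T, 0 < S.cutMean ω t + s := fun t ht => by
    linarith [S.cutMean_nonneg (ω := ω) ht]
  have c1 : ContinuousOn (fun p : ℝ × ℝ => log ((S.ρ p.1 p.2 + s) / (S.cutMean ω p.1 + s)))
      S.dom :=
    (ContinuousOn.div (by fun_prop) (by fun_prop) fun p hp => (hcs p.1 hp.1).ne').log
      fun p hp => (div_pos (add_pos (S.ρ_pos_dom hp) hs) (hcs p.1 hp.1)).ne'
  have cμ := S.continuousOn_densWeight_dom
  have cr : ContinuousOn (fun p : ℝ × ℝ => S.ρr p.1 p.2 ^ 2 * densWeight n p.2) S.dom := by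
    fun_prop
  have cmm : ContinuousOn (fun p : ℝ × ℝ => S.m p.1 p.2 ^ 2 * densWeight n p.2) S.dom := by
    fun_prop
  set A := 18 * W ^ 4 * 6 ^ n * 3 ^ (2 * n) / S.cutMass ω / s
  have hA : 0 ≤ A := by positivity
  have ig : IntegrableOn S.gradEnergy (Icc 0 T) := integrableOn_slice_integral cr
  have im : IntegrableOn (fun t => ∫ r in Icc S.a S.b, S.m t r ^ 2 * densWeight n r) (Icc 0 T) :=
    integrableOn_slice_integral cmm
  have hcomm : ContinuousOn (fun p : ℝ × ℝ => -(2 * ω p.2 * deriv ω p.2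
      * log ((S.ρ p.1 p.2 + s) / (S.cutMean ω p.1 + s)) * S.flux p.1 p.2)) S.dom := by
    fun_prop
  have key : ∀ t ∈ Icc 0 T, ∫ r in Icc S.a S.b, -(2 * ω r * deriv ω r
      * log ((S.ρ t r + s) / (S.cutMean ω t + s)) * S.flux t r)
      ≤ A * (3 / 2 * (S.ε * S.gradEnergy t)
        + 1 / 2 * ∫ r in Icc S.a S.b, S.m t r ^ 2 * densWeight n r) := by
    intro t ht
    have d1 : ContinuousOn (fun r => S.ρr t r ^ 2 * densWeight n r) (Icc S.a S.b) :=
      ContinuousOn.slice_right (f := fun t r => S.ρr t r ^ 2 * densWeight n r) cr ht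
    have d2 : ContinuousOn (fun r => S.m t r ^ 2 * densWeight n r) (Icc S.a S.b) :=
      ContinuousOn.slice_right (f := fun t r => S.m t r ^ 2 * densWeight n r) cmm ht
    have d3 : ContinuousOn (densWeight n) (Icc S.a S.b) :=
      continuousOn_densWeight.mono fun r hr => S.r_pos hr
    have hμ1 : ∫ r in Icc S.a S.b, densWeight n r ≤ 1 :=
      (setIntegral_mono_on d3.integrableOn_Icc (continuousOn_decay S.ha0.le).integrableOn_Icc
        measurableSet_Icc fun r hr => densWeight_le_decay S.hn (S.r_pos hr)).trans
        (integral_decay_le S.ha0.le S.a_le_b)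
    have hY := mul_nonneg S.hε.le (S.gradEnergy_nonneg t)
    calc _ ≤ ∫ r in Icc S.a S.b, A * (S.ε / 2 * (S.ρr t r ^ 2 * densWeight n r)
          + 1 / 2 * (S.m t r ^ 2 * densWeight n r)
          + S.ε * S.gradEnergy t * densWeight n r) := by
          refine setIntegral_mono_on (ContinuousOn.slice_right (f := fun t r =>
            -(2 * ω r * deriv ω r * log ((S.ρ t r + s) / (S.cutMean ω t + s)) * S.flux t r))
            hcomm ht).integrableOn_Icc (ContinuousOn.integrableOn_Icc (by fun_prop))
            measurableSet_Icc fun r hr =>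
              (S.relEntropy_commutator_le h hb h0 hs hε ht hr).trans_eq (by ring)
      _ = A * (S.ε / 2 * S.gradEnergy t
          + 1 / 2 * (∫ r in Icc S.a S.b, S.m t r ^ 2 * densWeight n r)
          + S.ε * S.gradEnergy t * ∫ r in Icc S.a S.b, densWeight n r) := by
          rw [integral_const_mul, integral_add (ContinuousOn.integrableOn_Icc (by fun_prop))
            (ContinuousOn.integrableOn_Icc (by fun_prop)),
            integral_add (ContinuousOn.integrableOn_Icc (by fun_prop))
            (ContinuousOn.integrableOn_Icc (by fun_prop)), integral_const_mul,
            integral_const_mul, integral_const_mul]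
          rfl
      _ ≤ _ := by
          refine mul_le_mul_of_nonneg_left ?_ hA
          linarith [mul_le_mul_of_nonneg_left hμ1 hY]
  refine (setIntegral_rect_le_integral (f := fun t r => -(2 * ω r * deriv ω r
      * log ((S.ρ t r + s) / (S.cutMean ω t + s)) * S.flux t r)) hcomm
    (((ig.const_mul _).const_mul _ |>.add (im.const_mul _)).const_mul _) key).trans_eq ?_
  rw [integral_const_mul, integral_add' ((ig.const_mul _).const_mul _) (im.const_mul _),
    integral_const_mul, integral_const_mul, integral_const_mul, dom,
    setIntegral_rect_eq (f := fun t r => S.ρr t r ^ 2 * densWeight n r) cr,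
    setIntegral_rect_eq (f := fun t r => S.m t r ^ 2 * densWeight n r) cmm]
  rfl

end ViscousSetup

theorem IsCutoff.integral_pos {ω : ℝ → ℝ} {W : ℝ} (h : IsCutoff ω W) (k : ℕ) :
    0 < ∫ r in Icc (1 : ℝ) 2, ω r ^ 2 * r ^ k := by
  have cω := h.continuous
  rw [integral_Icc_eq_integral_Ioc, ← intervalIntegral.integral_of_le one_le_two]
  refine intervalIntegral.integral_pos one_lt_two (by fun_prop) (fun x hx => ?_)
    ⟨1, by norm_num, by simp [h.eq_one 1 (by norm_num)]⟩
  have : 0 < x := one_pos.trans hx.1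
  positivity

/-- For large viscosity, the dissipation of the shifted logarithmic entropy. -/
theorem exists_integral_shifted_dissipation_le (n : ℕ) {γ : ℝ} (T E₀ : ℝ) (hγ : 2 ≤ γ)
    {ω : ℝ → ℝ} {W : ℝ} (h : IsCutoff ω W) :
    ∃ C, 0 < C ∧ ∀ S : ViscousSetup n γ T E₀, 2 < S.b → S.ρbar ≤ 1 → 1 ≤ S.ε →
      ∀ s : ℝ, 0 < s → s ≤ 1 →
      ∫ p in S.dom, ω p.2 ^ 2 * (S.ε * (1 / (S.ρ p.1 p.2 + s)) * S.ρr p.1 p.2 ^ 2)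
        * p.2 ^ (n - 1) ≤ C / s := by
  obtain ⟨C₁, hC₁, h₁⟩ := exists_integral_cut_ρ_sq_le n E₀ W hγ
  obtain ⟨C₂, hC₂, h₂⟩ := exists_integral_m_sq_le n T E₀ (show 1 < γ by linarith)
  obtain ⟨C₃, hC₃, h₃⟩ := exists_integral_ρr_sq_le n T E₀ hγ
  have hΩ := h.integral_pos (n - 1)
  set Ω := ∫ r in Icc (1 : ℝ) 2, ω r ^ 2 * r ^ (n - 1)
  set B := 18 * W ^ 4 * 6 ^ n * 3 ^ (2 * n) / Ω * (3 / 2 * C₃ + 1 / 2 * C₂) with hB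
  have hW := h.one_le
  refine ⟨2 * (C₁ + B + W ^ 2 * (|T| * |E₀|)), by positivity, ?_⟩
  intro S hb hρb hε s hs hs1
  have hmass := S.cutMass_ge h.continuous hb
  have h0 : 0 < S.cutMass ω := hΩ.trans_le hmass
  rw [abs_of_nonneg S.E₀_nonneg, abs_of_nonneg S.hT.le]
  have ht0 : (0 : ℝ) ∈ Icc 0 T := ⟨le_rfl, S.hT.le⟩
  have cω := h.continuous
  have q1 := S.integral_relEntropy_balance h hb h0.ne' hs
  have q2 := S.integral_relEntropy_le h.continuous h0.ne' hs ht0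
  have q3 : (∫ r in Icc S.a S.b, S.ρ 0 r ^ 2 * (ω r ^ 2 * r ^ (n - 1))) / s ≤ C₁ / s := by
    gcongr; exact h₁ S h hρb 0 ht0
  have q4 : _ ≤ B / s := (S.integral_relEntropy_commutator_le h hb h0 hs hε).trans (by
    calc _ ≤ 18 * W ^ 4 * 6 ^ n * 3 ^ (2 * n) / S.cutMass ω / s
          * (3 / 2 * C₃ + 1 / 2 * C₂) := by
          gcongr
          · exact h₃ S hb hρb hε
          · exact h₂ S hb hρb hε
      _ ≤ 18 * W ^ 4 * 6 ^ n * 3 ^ (2 * n) / Ω / s * (3 / 2 * C₃ + 1 / 2 * C₂) := by gcongr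
      _ = B / s := by rw [hB]; ring)
  have cinv : ContinuousOn (fun p : ℝ × ℝ => 1 / (S.ρ p.1 p.2 + s)) S.dom :=
    ContinuousOn.div (by fun_prop) (by fun_prop) fun p hp => (add_pos (S.ρ_pos_dom hp) hs).ne'
  have cdiv : ContinuousOn (fun p : ℝ × ℝ => S.ρr p.1 p.2 / (S.ρ p.1 p.2 + s)) S.dom :=
    ContinuousOn.div (by fun_prop) (by fun_prop) fun p hp => (add_pos (S.ρ_pos_dom hp) hs).ne'
  have cen := S.continuousOn_energyDensity
  have i1 := S.integrableOn_dom (f := fun p => ω p.2 ^ 2 * (S.ε * (1 / (S.ρ p.1 p.2 + s))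
    * S.ρr p.1 p.2 ^ 2) * p.2 ^ (n - 1)) (by fun_prop)
  have i2 := S.integrableOn_dom (f := fun p => ω p.2 ^ 2 * (S.ρr p.1 p.2 / (S.ρ p.1 p.2 + s))
    * S.flux p.1 p.2) (by fun_prop)
  have i3 := S.integrableOn_dom cen
  have q5 : ∫ p in S.dom, 1 / 2 * (ω p.2 ^ 2 * (S.ε * (1 / (S.ρ p.1 p.2 + s))
      * S.ρr p.1 p.2 ^ 2) * p.2 ^ (n - 1))
      ≤ ∫ p in S.dom, (ω p.2 ^ 2 * (S.ρr p.1 p.2 / (S.ρ p.1 p.2 + s)) * S.flux p.1 p.2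
        + W ^ 2 / 2 * S.energyDensity p.1 p.2) := by
    refine setIntegral_mono_on (i1.const_mul _) (i2.add (i3.const_mul _)) S.measurableSet_dom
      fun p hp => ?_
    have hρ := S.ρ_pos_dom hp
    have hr := S.r_pos_dom hp
    have e1 := S.m_sq_div_mul_le hp.1 hp.2
    have e2 : S.ρr p.1 p.2 * S.m p.1 p.2 / (S.ρ p.1 p.2 + s)
        ≤ 1 / 2 * (S.ε * (1 / (S.ρ p.1 p.2 + s)) * S.ρr p.1 p.2 ^ 2)
          + 1 / 2 * (S.m p.1 p.2 ^ 2 / S.ρ p.1 p.2) := by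
      have a1 : S.m p.1 p.2 ^ 2 / (S.ρ p.1 p.2 + s) ≤ S.m p.1 p.2 ^ 2 / S.ρ p.1 p.2 := by
        gcongr; linarith
      have a2 : S.ρr p.1 p.2 * S.m p.1 p.2 / (S.ρ p.1 p.2 + s)
          ≤ (1 / 2 * (S.ε * S.ρr p.1 p.2 ^ 2) + 1 / 2 * S.m p.1 p.2 ^ 2) / (S.ρ p.1 p.2 + s) := by
        gcongr
        nlinarith [sq_nonneg (S.ρr p.1 p.2 - S.m p.1 p.2),
          mul_nonneg (sub_nonneg.2 hε) (sq_nonneg (S.ρr p.1 p.2))]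
      calc _ ≤ _ := a2
        _ = 1 / 2 * (S.ε * (1 / (S.ρ p.1 p.2 + s)) * S.ρr p.1 p.2 ^ 2)
            + 1 / 2 * (S.m p.1 p.2 ^ 2 / (S.ρ p.1 p.2 + s)) := by ring
        _ ≤ _ := by gcongr
    have e3 : ω p.2 ^ 2 * (S.m p.1 p.2 ^ 2 / S.ρ p.1 p.2 * p.2 ^ (n - 1))
        ≤ W ^ 2 * S.energyDensity p.1 p.2 :=
      mul_le_mul (h.sq_le _) e1 (by positivity) (by positivity)
    have e4 := mul_le_mul_of_nonneg_left e2
      (by positivity : 0 ≤ ω p.2 ^ 2 * p.2 ^ (n - 1))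
    have e5 : ω p.2 ^ 2 * (S.ρr p.1 p.2 / (S.ρ p.1 p.2 + s)) * S.flux p.1 p.2
        = ω p.2 ^ 2 * (S.ε * (1 / (S.ρ p.1 p.2 + s)) * S.ρr p.1 p.2 ^ 2) * p.2 ^ (n - 1)
          - ω p.2 ^ 2 * p.2 ^ (n - 1)
            * (S.ρr p.1 p.2 * S.m p.1 p.2 / (S.ρ p.1 p.2 + s)) := by
      unfold ViscousSetup.flux; ring
    rw [e5]
    linarith
  rw [integral_const_mul, integral_add i2 (i3.const_mul _), integral_const_mul] at q5
  have q6 : W ^ 2 / 2 * ∫ p in S.dom, S.energyDensity p.1 p.2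
      ≤ W ^ 2 * (T * E₀) / s := by
    have hTE : 0 ≤ W ^ 2 * (T * E₀) := mul_nonneg (sq_nonneg _) (mul_nonneg S.hT.le S.E₀_nonneg)
    have := mul_le_mul_of_nonneg_left S.integral_energyDensity_dom_le
      (by positivity : 0 ≤ W ^ 2 / 2)
    have := le_div_self hTE hs hs1
    linarith
  have e : 2 * (C₁ + B + W ^ 2 * (T * E₀)) / s
      = 2 * (C₁ / s + B / s + W ^ 2 * (T * E₀) / s) := by ring
  rw [e]
  linarith

theorem setIntegral_Ioo_Ioo_le {T a b : ℝ} {f g : ℝ → ℝ → ℝ}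
    (hg : ContinuousOn (fun p : ℝ × ℝ => g p.1 p.2) (Icc 0 T ×ˢ Icc a b))
    (h0 : ∀ t ∈ Icc 0 T, ∀ r ∈ Icc a b, 0 ≤ f t r)
    (h : ∀ t ∈ Icc 0 T, ∀ r ∈ Icc a b, f t r ≤ g t r) :
    ∫ t in Ioo 0 T, ∫ r in Ioo a b, f t r ≤ ∫ p in Icc 0 T ×ˢ Icc a b, g p.1 p.2 := by
  simp_rw [← integral_Icc_eq_integral_Ioo]
  rw [setIntegral_rect_eq hg]
  refine integral_mono_of_nonneg ?_ (integrableOn_slice_integral hg) ?_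
  · filter_upwards [ae_restrict_mem measurableSet_Icc] with t ht
    exact setIntegral_nonneg measurableSet_Icc (h0 t ht)
  · filter_upwards [ae_restrict_mem measurableSet_Icc] with t ht
    refine integral_mono_of_nonneg ?_ (hg.slice_right ht).integrableOn_Icc ?_
    · filter_upwards [ae_restrict_mem measurableSet_Icc] with r hr using h0 t ht r hr
    · filter_upwards [ae_restrict_mem measurableSet_Icc] with r hr using h t ht r hr

theorem half_le_abs_log {Δ : ℝ} (hΔ : Δ ∈ Ioo (0 : ℝ) (1 / 2)) : 1 / 2 ≤ |log Δ| := by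
  have h1 : log Δ ≤ log (1 / 2) := log_le_log hΔ.1 hΔ.2.le
  rw [one_div, log_inv] at h1
  have h2 := log_two_gt_d9
  linarith [neg_le_abs (log Δ)]

namespace ViscousSetup

variable {n : ℕ} {γ T E₀ : ℝ} (S : ViscousSetup n γ T E₀)

/-- The localized logarithmic dissipation on the set of low density is bounded by the integral of
any continuous majorant. -/
theorem low_density_dissipation_le {ω : ℝ → ℝ} {Δ : ℝ} {g : ℝ → ℝ → ℝ}
    (hg : ContinuousOn (fun p : ℝ × ℝ => g p.1 p.2) S.dom)
    (h0 : ∀ t ∈ Icc 0 T, ∀ r ∈ Icc S.a S.b, 0 ≤ g t r)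
    (h : ∀ t ∈ Icc 0 T, ∀ r ∈ Icc S.a S.b, S.ρ t r < Δ →
      ω r ^ 2 * (S.ε * (1 / S.ρ t r) * S.ρr t r ^ 2) * r ^ (n - 1) ≤ g t r) :
    S.ε * ∫ t in Ioo 0 T, ∫ r in Ioo S.a S.b,
        (if S.ρ t r < Δ then (deriv (fun y => S.ρ t y) r) ^ (2 : ℕ) / S.ρ t r else 0)
          * (ω r) ^ (2 : ℕ) * r ^ (n - 1)
      ≤ ∫ p in S.dom, g p.1 p.2 := by
  simp_rw [← integral_const_mul]
  have hε := S.hε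
  refine setIntegral_Ioo_Ioo_le hg (fun t ht r hr => ?_) fun t ht r hr => ?_
  · have := S.ρ_pos ht hr
    have := S.r_pos hr
    split_ifs <;> positivity
  · split_ifs with hlt
    · refine le_trans (le_of_eq ?_) (h t ht r hr hlt)
      unfold ρr
      ring
    · simpa using h0 t ht r hr

theorem continuousOn_logPhi_dissipation {ω : ℝ → ℝ} (cω : Continuous ω) {d : ℝ} (hd : 0 < d) :
    ContinuousOn (fun p : ℝ × ℝ => ω p.2 ^ 2 * (S.ε * (d / (S.ρ p.1 p.2 * (S.ρ p.1 p.2 + d)))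
      * S.ρr p.1 p.2 ^ 2) * p.2 ^ (n - 1)) S.dom := by
  have : ContinuousOn (fun p : ℝ × ℝ => d / (S.ρ p.1 p.2 * (S.ρ p.1 p.2 + d))) S.dom :=
    ContinuousOn.div (by fun_prop) (by fun_prop) fun p hp => by
      have := S.ρ_pos_dom hp; positivity
  fun_prop

theorem low_density_dissipation_le_logPhi {ω : ℝ → ℝ} (cω : Continuous ω) {Δ : ℝ} (hΔ : 0 < Δ) :
    S.ε * ∫ t in Ioo 0 T, ∫ r in Ioo S.a S.b,
        (if S.ρ t r < Δ then (deriv (fun y => S.ρ t y) r) ^ (2 : ℕ) / S.ρ t r else 0)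
          * (ω r) ^ (2 : ℕ) * r ^ (n - 1)
      ≤ 2 * ∫ p in S.dom, ω p.2 ^ 2 * (S.ε * (Δ / (S.ρ p.1 p.2 * (S.ρ p.1 p.2 + Δ)))
        * S.ρr p.1 p.2 ^ 2) * p.2 ^ (n - 1) := by
  have hε := S.hε
  rw [← integral_const_mul 2]
  refine S.low_density_dissipation_le (g := fun t r => 2 * (ω r ^ 2
    * (S.ε * (Δ / (S.ρ t r * (S.ρ t r + Δ))) * S.ρr t r ^ 2) * r ^ (n - 1)))
    (continuousOn_const.mul (S.continuousOn_logPhi_dissipation cω hΔ))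
    (fun t ht r hr => ?_) fun t ht r hr hlt => ?_
  · have := S.ρ_pos ht hr
    have := S.r_pos hr
    positivity
  · have h1 := S.ρ_pos ht hr
    have h2 := S.r_pos hr
    have h3 : 1 / S.ρ t r ≤ 2 * (Δ / (S.ρ t r * (S.ρ t r + Δ))) := by
      rw [mul_div_assoc', div_le_div_iff₀ h1 (by positivity)]
      nlinarith
    calc _ ≤ ω r ^ 2 * (S.ε * (2 * (Δ / (S.ρ t r * (S.ρ t r + Δ)))) * S.ρr t r ^ 2)
          * r ^ (n - 1) := by gcongr
      _ = _ := by ring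

theorem low_density_dissipation_le_add {ω : ℝ → ℝ} (cω : Continuous ω) {Δ s : ℝ} (hs : 0 < s) :
    S.ε * ∫ t in Ioo 0 T, ∫ r in Ioo S.a S.b,
        (if S.ρ t r < Δ then (deriv (fun y => S.ρ t y) r) ^ (2 : ℕ) / S.ρ t r else 0)
          * (ω r) ^ (2 : ℕ) * r ^ (n - 1)
      ≤ (∫ p in S.dom, ω p.2 ^ 2 * (S.ε * (s / (S.ρ p.1 p.2 * (S.ρ p.1 p.2 + s)))
        * S.ρr p.1 p.2 ^ 2) * p.2 ^ (n - 1))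
        + ∫ p in S.dom, ω p.2 ^ 2 * (S.ε * (1 / (S.ρ p.1 p.2 + s)) * S.ρr p.1 p.2 ^ 2)
          * p.2 ^ (n - 1) := by
  have hε := S.hε
  have c1 := S.continuousOn_logPhi_dissipation cω hs
  have c2 : ContinuousOn (fun p : ℝ × ℝ => ω p.2 ^ 2 * (S.ε * (1 / (S.ρ p.1 p.2 + s))
      * S.ρr p.1 p.2 ^ 2) * p.2 ^ (n - 1)) S.dom := by
    have : ContinuousOn (fun p : ℝ × ℝ => 1 / (S.ρ p.1 p.2 + s)) S.dom :=
      ContinuousOn.div (by fun_prop) (by fun_prop) fun p hp => (add_pos (S.ρ_pos_dom hp) hs).ne'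
    fun_prop
  rw [← integral_add (S.integrableOn_dom c1) (S.integrableOn_dom c2)]
  refine S.low_density_dissipation_le (g := fun t r =>
    ω r ^ 2 * (S.ε * (s / (S.ρ t r * (S.ρ t r + s))) * S.ρr t r ^ 2) * r ^ (n - 1)
    + ω r ^ 2 * (S.ε * (1 / (S.ρ t r + s)) * S.ρr t r ^ 2) * r ^ (n - 1))
    (c1.add c2) (fun t ht r hr => ?_) fun t ht r hr _ => le_of_eq ?_
  · have := S.ρ_pos ht hr
    have := S.r_pos hr
    positivity
  · have h1 := S.ρ_pos ht hr
    have h3 : 1 / S.ρ t r = s / (S.ρ t r * (S.ρ t r + s)) + 1 / (S.ρ t r + s) := by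
      field_simp; ring
    rw [h3]; ring

end ViscousSetup

/-- The low density bound for soft pressure laws. -/
theorem exists_low_density_bound_of_lt_two (n : ℕ) {γ : ℝ} (T E₀ : ℝ) (hγ : 1 < γ) (hγ2 : γ < 2)
    {ω : ℝ → ℝ} {W : ℝ} (h : IsCutoff ω W) :
    ∃ M : ℝ, 0 < M ∧ ∀ Δ ∈ Ioo (0 : ℝ) (1 / 2), ∀ S : ViscousSetup n γ T E₀,
      2 < S.b → S.ρbar ≤ 1 →
      S.ε * ∫ t in Ioo 0 T, ∫ r in Ioo S.a S.b,
          (if S.ρ t r < Δ then (deriv (fun y => S.ρ t y) r) ^ (2 : ℕ) / S.ρ t r else 0)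
            * (ω r) ^ (2 : ℕ) * r ^ (n - 1)
        ≤ M * (|log Δ| + √Δ / √S.ε + √S.ε * |log Δ| * Δ ^ ((2 - γ) / 2)) := by
  obtain ⟨C, hC, hCb⟩ := ViscousSetup.exists_logPhi_dissipation_le n T E₀ W hγ
  obtain ⟨K, hK, hKb⟩ := exists_sq_logPhi'_le_rpow hγ hγ2
  set k₁ := 2 * W ^ 2 * √K * (9 * 2 ^ (n - 1))
  set k₂ := 2 * W ^ 2 * √K
  have hk₁ : 0 ≤ k₁ := by positivity
  have hk₂ : 0 ≤ k₂ := by positivity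
  refine ⟨4 * C * (1 + k₁ + k₂), by positivity, ?_⟩
  intro Δ hΔ S hb hρb
  have hΔ0 := hΔ.1
  have hL := half_le_abs_log hΔ
  have h1 := hCb S ω h hb hρb Δ (k₁ * (√S.ε * Δ ^ ((2 - γ) / 2)))
    (k₂ * (√S.ε * Δ ^ ((2 - γ) / 2))) hΔ.1 (by positivity) (by positivity)
    fun t ht r hr h2 => ViscousSetup.commutator_le_of_rpow h hK S hΔ.1 ht (hKb _ _ hΔ.1 (S.ρ_pos ht hr)) hr h2
  have h2 := S.low_density_dissipation_le_logPhi h.continuous (Δ := Δ) hΔ.1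
  have h3 : √Δ ≤ 1 := sqrt_le_one.2 (by linarith [hΔ.2])
  have h4 : 0 ≤ √Δ / √S.ε := by positivity
  set X := √S.ε * Δ ^ ((2 - γ) / 2) with hX
  have hX0 : 0 ≤ X := by positivity
  have e : √S.ε * |log Δ| * Δ ^ ((2 - γ) / 2) = |log Δ| * X := by rw [hX]; ring
  rw [e]
  have h5 : X ≤ 2 * (|log Δ| * X) := by nlinarith
  have h6 : √Δ + √Δ / √S.ε + k₁ * X + k₂ * X
      ≤ (1 + k₁ + k₂) * (2 * (|log Δ| + √Δ / √S.ε + |log Δ| * X)) := by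
    nlinarith [mul_nonneg hk₁ h4, mul_nonneg hk₂ h4, mul_nonneg hk₁ (abs_nonneg (log Δ)),
      mul_nonneg hk₂ (abs_nonneg (log Δ)), mul_le_mul_of_nonneg_left h5 hk₁,
      mul_le_mul_of_nonneg_left h5 hk₂]
  nlinarith [mul_le_mul_of_nonneg_left h6 hC.le]

/-- The low density bound for stiff pressure laws. -/
theorem exists_low_density_bound_of_two_le (n : ℕ) {γ : ℝ} (T E₀ : ℝ) (hγ : 2 ≤ γ)
    {ω : ℝ → ℝ} {W : ℝ} (h : IsCutoff ω W) :
    ∃ M : ℝ, 0 < M ∧ ∀ Δ ∈ Ioo (0 : ℝ) (1 / 2), ∀ S : ViscousSetup n γ T E₀,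
      2 < S.b → S.ρbar ≤ 1 →
      S.ε * ∫ t in Ioo 0 T, ∫ r in Ioo S.a S.b,
          (if S.ρ t r < Δ then (deriv (fun y => S.ρ t y) r) ^ (2 : ℕ) / S.ρ t r else 0)
            * (ω r) ^ (2 : ℕ) * r ^ (n - 1)
        ≤ M * (|log Δ| + √Δ / √S.ε + √S.ε * |log Δ| * Δ ^ ((2 - γ) / 2)) := by
  obtain ⟨C, hC, hCb⟩ := ViscousSetup.exists_logPhi_dissipation_le n T E₀ W (show 1 < γ by linarith)
  obtain ⟨C', hC', hCb'⟩ := exists_integral_shifted_dissipation_le n T E₀ hγ h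
  set k := 2 * W ^ 2 * (9 * 2 ^ (n - 1))
  have hk : 0 ≤ k := by positivity
  refine ⟨4 * C * (2 + k) + 2 * C', by positivity, ?_⟩
  intro Δ hΔ S hb hρb
  have hΔ0 := hΔ.1
  have hε := S.hε
  have hL := half_le_abs_log hΔ
  have h4 : 0 ≤ √Δ / √S.ε := by positivity
  have hD := fun (d : ℝ) (hd : 0 < d) => hCb S ω h hb hρb d (k * (S.ε * d)) 0 hd (by positivity)
    le_rfl fun t ht r hr h2 => ViscousSetup.commutator_le h S hd ht hr h2
  rcases le_total S.ε 1 with hε1 | hε1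
  · have h1 := hD Δ hΔ.1
    have h2 := S.low_density_dissipation_le_logPhi h.continuous (Δ := Δ) hΔ.1
    have h3 : √Δ ≤ 1 := sqrt_le_one.2 (by linarith [hΔ.2])
    have h5 : k * (S.ε * Δ) ≤ k :=
      mul_le_of_le_one_right hk (mul_le_one₀ hε1 hΔ0.le (by linarith [hΔ.2]))
    have h6 : √Δ + √Δ / √S.ε + k * (S.ε * Δ) + 0
        ≤ (2 + k) * (2 * (|log Δ| + √Δ / √S.ε)) := by
      nlinarith [mul_nonneg hk h4, mul_le_mul_of_nonneg_left hL hk]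
    have h7 : 0 ≤ √S.ε * |log Δ| * Δ ^ ((2 - γ) / 2) := by positivity
    calc _ ≤ 2 * (C * ((2 + k) * (2 * (|log Δ| + √Δ / √S.ε)))) := by
          linarith [mul_le_mul_of_nonneg_left h6 hC.le]
      _ = 4 * C * (2 + k) * (|log Δ| + √Δ / √S.ε) := by ring
      _ ≤ _ := mul_le_mul (by linarith) (by linarith) (by positivity) (by positivity)
  · have hsε : 1 ≤ √S.ε := one_le_sqrt.2 hε1
    have hs : 0 < (√S.ε)⁻¹ := by positivity
    have hs1 : (√S.ε)⁻¹ ≤ 1 := inv_le_one_of_one_le₀ hsε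
    have h1 := hD _ hs
    have h2 := hCb' S hb hρb hε1 _ hs hs1
    have h3 := S.low_density_dissipation_le_add h.continuous (Δ := Δ) hs
    have h5 : S.ε * (√S.ε)⁻¹ = √S.ε := by
      rw [← div_eq_mul_inv, div_sqrt]
    have h6 : √(√S.ε)⁻¹ ≤ 1 := sqrt_le_one.2 hs1
    have h7 : √(√S.ε)⁻¹ / √S.ε ≤ 1 := (div_le_self (sqrt_nonneg _) hsε).trans h6
    rw [h5] at h1
    rw [div_inv_eq_mul] at h2
    have h8 : 1 ≤ Δ ^ ((2 - γ) / 2) :=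
      one_le_rpow_of_pos_of_le_one_of_nonpos hΔ0 (by linarith [hΔ.2]) (by linarith)
    have h9 : √S.ε ≤ 2 * (√S.ε * |log Δ| * Δ ^ ((2 - γ) / 2)) := by
      have : 1 / 2 * 1 ≤ |log Δ| * Δ ^ ((2 - γ) / 2) := by gcongr
      nlinarith
    have h10 : √(√S.ε)⁻¹ + √(√S.ε)⁻¹ / √S.ε + k * √S.ε + 0 ≤ (2 + k) * √S.ε := by linarith
    calc _ ≤ (C * (2 + k) + C') * √S.ε := by
          linarith [mul_le_mul_of_nonneg_left h10 hC.le]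
      _ ≤ (C * (2 + k) + C') * (2 * (√S.ε * |log Δ| * Δ ^ ((2 - γ) / 2))) := by gcongr
      _ = (2 * C * (2 + k) + 2 * C') * (√S.ε * |log Δ| * Δ ^ ((2 - γ) / 2)) := by ring
      _ ≤ _ := by
          gcongr
          · norm_num
          · linarith

/-- under the Viscous Setup with `b > 2` and `ρ̄ ≤ 1`, for a cutoff
`ω ∈ C_c^∞(ℝ)` with `ω = 1` on `[0,1]` and `ω = 0` on `[2,∞)`, there is `M > 0`
depending only on `n, γ, T, E₀, ω` (independent of `Δ` and `ε`) such that for any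
`Δ ∈ (0,½)`,
`ε∫₀^T∫_a^b (ρ_r²/ρ) 𝟙_{ρ<Δ} ω² r^{n−1} dr dt
  ≤ M(|log Δ| + √Δ/√ε + √Δ/a + √ε|log Δ|Δ^{(2−γ)/2})`. -/
theorem viscous_density_log_derivative_bound (n : ℕ) (γ T E₀ : ℝ)
    (ω : ℝ → ℝ) (hω_smooth : ContDiff ℝ (⊤ : ℕ∞) ω) (hω_supp : HasCompactSupport ω)
    (hω_one : ∀ r ∈ Set.Icc (0:ℝ) 1, ω r = 1) (hω_zero : ∀ r : ℝ, 2 ≤ r → ω r = 0) :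
    ∃ M : ℝ, 0 < M ∧ ∀ Δ ∈ Set.Ioo (0:ℝ) (1/2), ∀ S : ViscousSetup n γ T E₀,
      2 < S.b → S.ρbar ≤ 1 →
      S.ε * ∫ t in Set.Ioo 0 T, ∫ r in Set.Ioo S.a S.b,
          (if S.ρ t r < Δ then (deriv (fun y => S.ρ t y) r) ^ (2:ℕ) / S.ρ t r else 0)
            * (ω r) ^ (2:ℕ) * r ^ (n - 1)
        ≤ M * (|Real.log Δ| + Real.sqrt Δ / Real.sqrt S.ε + Real.sqrt Δ / S.a
            + Real.sqrt S.ε * |Real.log Δ| * Δ ^ ((2 - γ)/2)) := by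
  by_cases hγ : 1 < γ
  swap
  · exact ⟨1, one_pos, fun Δ _ S => absurd S.hγ hγ⟩
  obtain ⟨W, hW⟩ := exists_isCutoff hω_smooth hω_supp hω_one hω_zero
  obtain ⟨M, hM, h⟩ := (lt_or_ge γ 2).elim
    (fun h2 => exists_low_density_bound_of_lt_two n T E₀ hγ h2 hW)
    (fun h2 => exists_low_density_bound_of_two_le n T E₀ h2 hW)
  refine ⟨M, hM, fun Δ hΔ S hb hρb => (h Δ hΔ S hb hρb).trans ?_⟩
  have := S.ha0
  have : 0 ≤ √Δ / S.a := by positivity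
  exact mul_le_mul_of_nonneg_left (by linarith) hM.le
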